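/- Let v be a vexillary permutation. For every bumpless pipe dream B in BPD(v), the recording tableau of the Gao–Huang image of B equals Weigandt's tableau of B; that is, Q̃(φ(B)) = γ(B). In particular, the composition γ ∘ φ⁻¹ of the Weigandt and Gao–Huang bijections equals Lenart's map Q̃ on PD(v). -/

import Mathlib

/- Common definitions for formalizing "Lenart's bijection via bumpless pipe dreams"
   (Gregory–Hamaker). -/

namespace BPDPaper

/-! ### Permutations of the positive integers -/

/-- We model permutations of the positive integers as permutations of `ℕ`
(fixing `0`, with finite support). -/
abbrev Perm' := Equiv.Perm ℕ

/-- The simple transposition `s_a = t_{a,a+1}`. -/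
def sT (a : ℕ) : Perm' := Equiv.swap a (a + 1)

/-- The transposition `t_{ij}`. -/
def tT (i j : ℕ) : Perm' := Equiv.swap i j

/-- The product `s_{a_1} ⋯ s_{a_p}` of a word. -/
def wordProd (l : List ℕ) : Perm' := (l.map sT).prod

/-- `l` is a word for `w` (in the letters `s_1, s_2, …`). -/
def IsWord (w : Perm') (l : List ℕ) : Prop := (∀ x ∈ l, 1 ≤ x) ∧ wordProd l = w

/-- The Coxeter length `ℓ(w)`: the minimal length of a word for `w`. -/
noncomputable def plen (w : Perm') : ℕ :=
  sInf {m | ∃ l : List ℕ, IsWord w l ∧ l.length = m}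

/-- `l` is a reduced word for `w`. -/
def IsReducedWord (w : Perm') (l : List ℕ) : Prop := IsWord w l ∧ l.length = plen w

/-- A permutation of the positive integers: fixes `0` and all but finitely many points. -/
def IsPerm (w : Perm') : Prop := w 0 = 0 ∧ {k | w k ≠ k}.Finite

/-- `k` is a descent of `w`. -/
def Descent (w : Perm') (k : ℕ) : Prop := 1 ≤ k ∧ w (k + 1) < w k

/-- `w` is Grassmannian: at most one descent. -/
def Grassmannian (w : Perm') : Prop := IsPerm w ∧ Set.Subsingleton {k | Descent w k}

/-- `w` is vexillary: no indices `i < j < k < l` with `w j < w i < w l < w k`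
(pattern 2143 avoidance). -/
def Vexillary (w : Perm') : Prop := IsPerm w ∧
  ¬ ∃ i j k l : ℕ, 1 ≤ i ∧ i < j ∧ j < k ∧ k < l ∧ w j < w i ∧ w i < w l ∧ w l < w k

/-- The code `c_i(w) = #{j > i : w j < w i}`. -/
noncomputable def codeOf (w : Perm') (i : ℕ) : ℕ := Nat.card {j : ℕ | i < j ∧ w j < w i}

/-- Insert into a weakly decreasing list, keeping it weakly decreasing. -/
def insDesc (x : ℕ) : List ℕ → List ℕ
  | [] => [x]
  | y :: ys => if y < x then x :: y :: ys else y :: insDesc x ys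

/-- Sort a list into weakly decreasing order. -/
def sortDesc (l : List ℕ) : List ℕ := l.foldr insDesc []

/-- The shape `λ(w)`: the code `(c_1(w), …, c_n(w))` sorted decreasingly, zeros dropped
(`n` is any bound on the support of `w`). -/
noncomputable def shapeOf (w : Perm') (n : ℕ) : List ℕ :=
  (sortDesc ((List.range' 1 n).map (codeOf w))).filter (fun x => decide (0 < x))

/-- The Rothe diagram `D_w = {(i, w j) : i < j, w j < w i}` (matrix coordinates). -/
def RotheDiagram (w : Perm') : Set (ℕ × ℕ) :=
  {p | 1 ≤ p.1 ∧ ∃ j, p.1 < j ∧ w j < w p.1 ∧ p.2 = w j}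

/-- `φ_i`: the row index of the southeast-most box of `D_w` on the diagonal through
`(i, λ_i)`. -/
noncomputable def flagEntry (w : Perm') (i li : ℕ) : ℕ :=
  sSup {r : ℕ | ∃ c : ℕ, (r, c) ∈ RotheDiagram w ∧ (c : ℤ) - (r : ℤ) = (li : ℤ) - (i : ℤ)}

/-- The flag `φ(w) = (φ_1, …, φ_m)` of a vexillary permutation. -/
noncomputable def flagOf (w : Perm') (n : ℕ) : List ℕ :=
  (List.range (shapeOf w n).length).map (fun k => flagEntry w (k + 1) ((shapeOf w n).getD k 0))

/-- `ρ(w)_i`: the `i`-th row of the smallest partition whose Young diagram contains `D_w`. -/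
noncomputable def rhoRow (w : Perm') (i : ℕ) : ℕ :=
  sSup {c : ℕ | ∃ r : ℕ, i ≤ r ∧ (r, c) ∈ RotheDiagram w}

/-! ### Tableaux (lists of rows), flagged SSYT, jeu de taquin -/

/-- Semistandard Young tableau of partition shape, presented as a list of rows. -/
def IsSSYT (T : List (List ℕ)) : Prop :=
  (∀ row ∈ T, row ≠ []) ∧
  List.Chain' (fun r1 r2 : List ℕ => r2.length ≤ r1.length) T ∧
  (∀ row ∈ T, List.Chain' (· ≤ ·) row) ∧
  (∀ i j : ℕ, i + 1 < T.length → j < (T.getD (i + 1) []).length →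
    (T.getD i []).getD j 0 < (T.getD (i + 1) []).getD j 0)

/-- `φ`-flagged semistandard Young tableaux of shape `λ`: the last entry of row `i`
is at most `φ_i`. -/
def IsFlaggedSSYT (lam phi : List ℕ) (T : List (List ℕ)) : Prop :=
  IsSSYT T ∧ T.map List.length = lam ∧
  ∀ i : ℕ, i < T.length → (T.getD i []).getLastD 0 ≤ phi.getD i 0

/-- Semistandard Young tableaux with all entries at most `k` (`SSYT_k`). -/
def IsSSYTBounded (k : ℕ) (T : List (List ℕ)) : Prop :=
  IsSSYT T ∧ ∀ row ∈ T, ∀ x ∈ row, x ≤ k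

/-- Set an entry of a tableau. -/
def setEntry (T : List (List ℕ)) (r c x : ℕ) : List (List ℕ) :=
  T.set r ((T.getD r []).set c x)

/-- One jeu de taquin slide with the empty tile at `(r, c)` (0-indexed):
swap the empty tile with the smaller of the entries to its right and below
(ties move down; missing boxes are `∞`); when both are missing, delete the cell. -/
def jdtAux : ℕ → List (List ℕ) → ℕ → ℕ → List (List ℕ)
  | 0, T, _, _ => T
  | fuel + 1, T, r, c =>
    match (T.getD r [])[c + 1]?, (T.getD (r + 1) [])[c]? with
    | none, none => (T.set r ((T.getD r []).take c)).filter (fun row => !row.isEmpty)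
    | some x, none => jdtAux fuel (setEntry T r c x) r (c + 1)
    | none, some y => jdtAux fuel (setEntry T r c y) (r + 1) c
    | some x, some y =>
      if x < y then jdtAux fuel (setEntry T r c x) r (c + 1)
      else jdtAux fuel (setEntry T r c y) (r + 1) c

/-- `jdt(T)`: remove the top-left box of `T` and rectify by jeu de taquin. -/
def jdt (T : List (List ℕ)) : List (List ℕ) :=
  jdtAux ((T.map List.length).sum + 1) T 0 0

/-! ### Edelman–Greene column insertion and the recording tableau -/

/-- Edelman–Greene insertion of `x` into one increasing column `C`.
Returns the new column together with `none` (if `x` was appended, creating a new box)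
or `some y` (where `y` is to be inserted into the next column). -/
def colIns (x : ℕ) (C : List ℕ) : List ℕ × Option ℕ :=
  if C.all (fun c => decide (c < x)) then (C ++ [x], none)
  else if x ∈ C ∧ (x + 1) ∈ C then (C, some (x + 1))
  else
    match C.find? (fun c => decide (x < c)) with
    | some ck => (C.map (fun c => if c = ck then x else c), some ck)
    | none => (C, none)

/-- Edelman–Greene insertion of `x` into a tableau presented as a list of columns.
Returns the new columns and the (0-indexed) column containing the new box. -/
def egInsert : List (List ℕ) → ℕ → (List (List ℕ)) × ℕ
  | [], x => ([[x]], 0)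
  | C :: rest, x =>
    match colIns x C with
    | (C', none) => (C' :: rest, 0)
    | (C', some y) =>
      let res := egInsert rest y
      (C' :: res.1, res.2 + 1)

/-- One step of the Edelman–Greene algorithm on the pair (insertion, recording) tableau:
insert `ra.2` into `P` and record `ra.1` in the new box of `Q`. -/
def egStep (PQ : (List (List ℕ)) × (List (List ℕ))) (ra : ℕ × ℕ) :
    (List (List ℕ)) × (List (List ℕ)) :=
  let res := egInsert PQ.1 ra.2
  let Q := PQ.2
  let Q' := if res.2 < Q.length then Q.set res.2 (Q.getD res.2 [] ++ [ra.1]) else Q ++ [[ra.1]]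
  (res.1, Q')

/-- A biword `(r_1,…,r_l ; a_1,…,a_l)`. -/
structure Biword where
  top : List ℕ
  bot : List ℕ

/-- The (insertion, recording) column tableaux of a biword under Edelman–Greene insertion. -/
def egPQ (P : Biword) : (List (List ℕ)) × (List (List ℕ)) :=
  (P.top.zip P.bot).foldl egStep ([], [])

/-- Convert a tableau presented as a list of columns into a list of rows. -/
def colsToRows (cols : List (List ℕ)) : List (List ℕ) :=
  (List.range ((cols.map List.length).foldr max 0)).map
    (fun i => cols.filterMap (fun col => col[i]?))

/-- The Edelman–Greene recording tableau `Q̃` of a biword (as a list of rows). -/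
def Qtilde (P : Biword) : List (List ℕ) := colsToRows (egPQ P).2

/-- The Edelman–Greene insertion tableau `P̃` of a biword (as a list of rows). -/
def Ptilde (P : Biword) : List (List ℕ) := colsToRows (egPQ P).1

/-- `(r ; a)` is a reduced compatible sequence for `w`: `a` is a reduced word for `w`,
`r` is weakly increasing, `r_i ≤ a_i`, and `r_i < r_{i+1}` whenever `a_i < a_{i+1}`.
Membership in `PD(w)`. -/
def IsCompatible (w : Perm') (P : Biword) : Prop :=
  IsReducedWord w P.bot ∧
  List.Chain' (· ≤ ·) P.top ∧
  List.Forall₂ (· ≤ ·) P.top P.bot ∧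
  (∀ m : ℕ, m + 1 < P.bot.length →
    P.bot.getD m 0 < P.bot.getD (m + 1) 0 → P.top.getD m 0 < P.top.getD (m + 1) 0)

/-! ### Bumpless pipe dreams -/

/-- The tiles: blank, vertical, horizontal, ⌐-elbow (S–E, "r"), ⌟-elbow (W–N, "j"),
crossing, and the bump tile (for almost bumpless pipe dreams). -/
inductive Tile
  | blank | vert | horiz | se | nw | cross | bump
deriving DecidableEq

/-- A square grid of tiles; rows and columns are 1-indexed, rows increase downward. -/
structure Grid where
  n : ℕ
  tile : ℕ → ℕ → Tile

inductive Dir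
  | north | east
deriving DecidableEq

def hasN : Tile → Bool
  | .vert => true | .nw => true | .cross => true | .bump => true | _ => false
def hasS : Tile → Bool
  | .vert => true | .se => true | .cross => true | .bump => true | _ => false
def hasE : Tile → Bool
  | .horiz => true | .se => true | .cross => true | .bump => true | _ => false
def hasW : Tile → Bool
  | .horiz => true | .nw => true | .cross => true | .bump => true | _ => false

/-- The outgoing direction of a pipe through a tile, given the incoming heading
(`north` = entered through the south edge, `east` = entered through the west edge). -/
def outDir : Tile → Dir → Option Dir
  | .vert, .north => some .north
  | .cross, .north => some .north
  | .se, .north => some .east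
  | .bump, .north => some .east
  | .horiz, .east => some .east
  | .cross, .east => some .east
  | .nw, .east => some .north
  | .bump, .east => some .north
  | _, _ => none

/-- Trace a pipe; returns the row in which it exits through the east edge of the grid. -/
def traceAux (g : Grid) : ℕ → ℕ → ℕ → Dir → Option ℕ
  | 0, _, _, _ => none
  | fuel + 1, x, y, d =>
    match outDir (g.tile x y) d with
    | none => none
    | some Dir.north => if x ≤ 1 then none else traceAux g fuel (x - 1) y Dir.north
    | some Dir.east => if g.n ≤ y then some x else traceAux g fuel x (y + 1) Dir.east

/-- The exit row of the pipe entering at the bottom of column `c`. -/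
def exitRow (g : Grid) (c : ℕ) : Option ℕ := traceAux g (2 * g.n + 2) g.n c Dir.north

/-- The list of states `(row, column, heading)` visited by a pipe. -/
def pathAux (g : Grid) : ℕ → ℕ → ℕ → Dir → List (ℕ × ℕ × Dir)
  | 0, _, _, _ => []
  | fuel + 1, x, y, d =>
    (x, y, d) ::
      (match outDir (g.tile x y) d with
       | none => []
       | some Dir.north => if x ≤ 1 then [] else pathAux g fuel (x - 1) y Dir.north
       | some Dir.east => if g.n ≤ y then [] else pathAux g fuel x (y + 1) Dir.east)

/-- The path of the pipe entering at the bottom of column `c`. -/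
def pipePath (g : Grid) (c : ℕ) : List (ℕ × ℕ × Dir) := pathAux g (2 * g.n + 2) g.n c Dir.north

/-- Pipe `c` passes through position `z`. -/
def passes (g : Grid) (c : ℕ) (z : ℕ × ℕ) : Prop :=
  ∃ d : Dir, (z.1, z.2, d) ∈ pipePath g c

def InGrid (g : Grid) (i j : ℕ) : Prop := 1 ≤ i ∧ i ≤ g.n ∧ 1 ≤ j ∧ j ≤ g.n

/-- A (reduced) bumpless pipe dream: tiles match along edges; pipes enter along the
bottom and exit along the right; no bump tiles; no two pipes cross more than once.
(Tiles outside the grid are normalized to `horiz`.) -/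
def IsBPD (g : Grid) : Prop :=
  1 ≤ g.n ∧
  (∀ i j, ¬ InGrid g i j → g.tile i j = Tile.horiz) ∧
  (∀ i j, InGrid g i j → g.tile i j ≠ Tile.bump) ∧
  (∀ i j, 1 ≤ i → i < g.n → 1 ≤ j → j ≤ g.n → hasS (g.tile i j) = hasN (g.tile (i + 1) j)) ∧
  (∀ i j, 1 ≤ i → i ≤ g.n → 1 ≤ j → j < g.n → hasE (g.tile i j) = hasW (g.tile i (j + 1))) ∧
  (∀ j, 1 ≤ j → j ≤ g.n → hasN (g.tile 1 j) = false) ∧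
  (∀ j, 1 ≤ j → j ≤ g.n → hasS (g.tile g.n j) = true) ∧
  (∀ i, 1 ≤ i → i ≤ g.n → hasW (g.tile i 1) = false) ∧
  (∀ i, 1 ≤ i → i ≤ g.n → hasE (g.tile i g.n) = true) ∧
  (∀ c c', 1 ≤ c → c ≤ g.n → 1 ≤ c' → c' ≤ g.n → c ≠ c' →
    Set.Subsingleton {z : ℕ × ℕ | g.tile z.1 z.2 = Tile.cross ∧ passes g c z ∧ passes g c' z})

/-- `g ∈ BPD(w)`: `g` is a bumpless pipe dream whose permutation is `w`, i.e. the pipe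
entering at the bottom of column `c` exits to the right in row `w⁻¹(c)`. -/
def MemBPD (w : Perm') (g : Grid) : Prop :=
  IsBPD g ∧ w 0 = 0 ∧ (∀ k, g.n < k → w k = k) ∧
  (∀ c, 1 ≤ c → c ≤ g.n → exitRow g c = some (w.symm c))

/-! ### Weigandt's map γ -/

/-- The blank tiles on the diagonal `{(i,j) : j - i = d}`, from northwest to southeast. -/
def blanksOnDiag (g : Grid) (d : ℤ) : List (ℕ × ℕ) :=
  (List.range' 1 g.n).filterMap (fun (i : ℕ) =>
    let jz : ℤ := (i : ℤ) + d
    if 1 ≤ jz ∧ jz ≤ (g.n : ℤ) then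
      (if g.tile i jz.toNat = Tile.blank then some (i, jz.toNat) else none)
    else none)

/-- The number of pipes passing above position `(i,j)`: tiles above it in column `j`
in which a pipe travels eastward. -/
def pipesAbove (g : Grid) (i j : ℕ) : ℕ :=
  ((List.range' 1 g.n).filter (fun x => decide (x < i) && hasE (g.tile x j))).length

/-- Weigandt's map `γ` (for vexillary permutations): fill each blank tile with the number
of pipes above it, slide the filled tiles northwest along their diagonals into the Young
diagram of `lam`, and add `i` to every entry in row `i`. -/
def weigandt (g : Grid) (lam : List ℕ) : List (List ℕ) :=
  (List.range lam.length).map (fun (r0 : ℕ) =>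
    (List.range (lam.getD r0 0)).map (fun (c0 : ℕ) =>
      let r : ℕ := r0 + 1
      let c : ℕ := c0 + 1
      let p := (blanksOnDiag g ((c : ℤ) - (r : ℤ))).getD (min r c - 1) (0, 0)
      pipesAbove g p.1 p.2 + r))

/-! ### The Gao–Huang operator ∇, pop, and the bijection φ -/

/-- Backward tracing: enter tile `(x,y)` through its north edge (`viaN = true`) or its
east edge (`viaN = false`) and follow the pipe backwards; returns the bottom column
at which the pipe enters the grid. -/
def backAux (g : Grid) : ℕ → ℕ → ℕ → Bool → Option ℕ
  | 0, _, _, _ => none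
  | fuel + 1, x, y, viaN =>
    if g.n < x then none
    else if viaN then
      match g.tile x y with
      | .vert | .cross => if x = g.n then some y else backAux g fuel (x + 1) y true
      | .nw | .bump => backAux g fuel x (y - 1) false
      | _ => none
    else
      match g.tile x y with
      | .horiz | .cross => backAux g fuel x (y - 1) false
      | .se | .bump => if x = g.n then some y else backAux g fuel (x + 1) y true
      | _ => none

/-- The label of the pipe passing through `(x,y)` entering from the south. -/
def pipeFromS (g : Grid) (x y : ℕ) : Option ℕ :=
  if x = g.n then some y else backAux g (2 * g.n + 2) (x + 1) y true

/-- Move the mark east to the rightmost blank tile in its contiguous block of blanks. -/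
def slideEast (g : Grid) (i j : ℕ) : ℕ :=
  ((List.range' j (g.n + 1)).takeWhile (fun y => g.tile i y == Tile.blank)).getLastD j

/-- Tile rewrite for the undroop of the pipe `p` (from `(i', j+1)` into `(i, j)`)
performed in one iteration of the Gao–Huang procedure; the `(i', j+1)` case `cross → se`
is the final uncrossing step. -/
def nablaUndroop (T : ℕ → ℕ → Tile) (i i' j : ℕ) : ℕ → ℕ → Tile := fun x y =>
  let t := T x y
  if x = i ∧ y = j then (match t with | Tile.blank => Tile.se | _ => t)
  else if x = i' ∧ y = j then
    (match t with | Tile.se => Tile.vert | Tile.horiz => Tile.nw | _ => t)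
  else if x = i ∧ y = j + 1 then
    (match t with | Tile.se => Tile.horiz | Tile.vert => Tile.nw | _ => t)
  else if x = i' ∧ y = j + 1 then
    (match t with | Tile.nw => Tile.blank | Tile.cross => Tile.se | _ => t)
  else if y = j ∧ i < x ∧ x < i' then
    (match t with | Tile.blank => Tile.vert | Tile.horiz => Tile.cross | _ => t)
  else if y = j + 1 ∧ i < x ∧ x < i' then
    (match t with | Tile.vert => Tile.blank | Tile.cross => Tile.horiz | _ => t)
  else t

/-- Tile rewrite for the droop (from `(k, j)` into `(k', j+1)`) of a pipe `q` having both
a ⌐-turn and a ⌟-turn in column `j`, performed after the undroop of `p`. -/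
def nablaQDroop (T : ℕ → ℕ → Tile) (k k' j : ℕ) : ℕ → ℕ → Tile := fun x y =>
  let t := T x y
  if x = k ∧ y = j then (match t with | Tile.se => Tile.vert | _ => t)
  else if x = k' ∧ y = j then (match t with | Tile.nw => Tile.cross | _ => t)
  else if x = k ∧ y = j + 1 then (match t with | Tile.horiz => Tile.se | _ => t)
  else if x = k' ∧ y = j + 1 then (match t with | Tile.blank => Tile.nw | _ => t)
  else if y = j + 1 ∧ k < x ∧ x < k' then
    (match t with | Tile.blank => Tile.vert | Tile.horiz => Tile.cross | _ => t)
  else t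

/-- The ⌐/⌟ elbow pairs `(k, k')` of pipes in column `j` strictly between rows `i` and `i'`. -/
def qPairs (g : Grid) (i i' j : ℕ) : List (ℕ × ℕ) :=
  (List.range' 1 g.n).filterMap (fun k =>
    if i < k ∧ k < i' ∧ g.tile k j = Tile.se then
      match (List.range' 1 g.n).find?
          (fun k' => decide (k < k' ∧ k' < i' ∧ g.tile k' j = Tile.nw)) with
      | some k' => some (k, k')
      | none => none
    else none)

/-- One iteration of the marked-tile procedure on the rectangle with corners
`(i, j)` and `(i', j+1)`: undroop `p`, then droop the intersecting pipes. -/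
def nablaIter (g : Grid) (i i' j : ℕ) : Grid :=
  ⟨g.n, (qPairs g i i' j).foldl (fun T kk => nablaQDroop T kk.1 kk.2 j)
    (nablaUndroop g.tile i i' j)⟩

/-- The marked-tile loop of the Gao–Huang procedure; returns `(∇B, a)`. -/
def nablaLoop (g : Grid) : ℕ → ℕ × ℕ → Grid × ℕ
  | 0, _ => (g, 0)
  | fuel + 1, (i, j0) =>
    let j := slideEast g i j0
    match pipeFromS g i (j + 1) with
    | none => (g, 0)
    | some p =>
      if p = j + 1 then
        match (List.range' 1 g.n).find? (fun x =>
            decide (i < x) && (g.tile x (j + 1) == Tile.cross) &&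
            (backAux g (2 * g.n + 2) x (j + 1) false == some j)) with
        | some i' => (nablaIter g i i' j, j)
        | none => (g, 0)
      else
        match (List.range' 1 g.n).find? (fun x =>
            decide (i < x) && (g.tile x (j + 1) == Tile.nw)) with
        | some i' => nablaLoop (nablaIter g i i' j) fuel (i', j + 1)
        | none => (g, 0)

/-- The Gao–Huang procedure: returns `(∇B, (r, a))` where `pop(B) = (r, a)`. -/
def nablaPop (g : Grid) : Grid × ℕ × ℕ :=
  match (List.range' 1 g.n).find?
      (fun i => (List.range' 1 g.n).any (fun j => g.tile i j == Tile.blank)) with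
  | none => (g, 0, 0)
  | some r =>
    let j0 := ((List.range' 1 g.n).filter (fun j => g.tile r j == Tile.blank)).getLastD 0
    let res := nablaLoop g (g.n + 1) (r, j0)
    (res.1, r, res.2)

/-- The Gao–Huang operator `∇`. -/
def nabla (g : Grid) : Grid := (nablaPop g).1

/-- `pop(B) = (r, a)`. -/
def pop (g : Grid) : ℕ × ℕ := (nablaPop g).2

/-- The number of crossing tiles of `g` (which equals `ℓ(w)` for `g ∈ BPD(w)`). -/
def crossCount (g : Grid) : ℕ :=
  ((List.range' 1 g.n).map (fun i =>
    ((List.range' 1 g.n).filter (fun j => g.tile i j == Tile.cross)).length)).sum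

def phiAux : ℕ → Grid → List (ℕ × ℕ)
  | 0, _ => []
  | l + 1, g => pop g :: phiAux l (nabla g)

/-- The Gao–Huang bijection `φ : BPD(w) → PD(w)`,
`φ(B) = (r_1,…,r_l ; a_1,…,a_l)` with `(r_i, a_i) = pop(∇^{i-1} B)`. -/
def phi (g : Grid) : Biword :=
  ⟨(phiAux (crossCount g) g).map Prod.fst, (phiAux (crossCount g) g).map Prod.snd⟩

/-! ### Little bumps (relational) -/

/-- The reflection labelling the crossing at position `m` (0-indexed) of the word `a`:
deleting the letter at position `m` from `a` yields a word for `wordProd a * crossingRefl a m`.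
The wires `i` and `j` cross at position `m` iff `crossingRefl a m = t_{ij}`. -/
def crossingRefl (a : List ℕ) (m : ℕ) : Perm' :=
  (wordProd (a.drop (m + 1)))⁻¹ * sT (a.getD m 0) * wordProd (a.drop (m + 1))

/-- `a` is a reduced word (for its own product). -/
def IsReducedSelf (a : List ℕ) : Prop := IsReducedWord (wordProd a) a

/-- Increment the entry of `a` at position `m`. -/
def incrAt (a : List ℕ) (m : ℕ) : List ℕ := a.set m (a.getD m 0 + 1)

/-- The (upward) Little bump `L_{ij}` as a relation on biwords: starting at the position
`m_1` where wires `i` and `j` cross, repeatedly increment the current entry; stop when the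
bottom word becomes reduced, and otherwise move to the unique other position whose crossing
involves the same pair of wires. -/
def LittleBumpRel (i j : ℕ) (P P' : Biword) : Prop :=
  P'.top = P.top ∧
  ∃ ms : List ℕ, ∃ ws : List (List ℕ),
    ms ≠ [] ∧
    ws.length = ms.length + 1 ∧
    ws.getD 0 [] = P.bot ∧
    ws.getLastD [] = P'.bot ∧
    (∀ t : ℕ, t < ms.length → ws.getD (t + 1) [] = incrAt (ws.getD t []) (ms.getD t 0)) ∧
    crossingRefl P.bot (ms.getD 0 0) = tT i j ∧
    (∀ t : ℕ, t + 1 < ms.length →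
      ¬ IsReducedSelf (ws.getD (t + 1) []) ∧
      ms.getD (t + 1) 0 ≠ ms.getD t 0 ∧
      crossingRefl (ws.getD (t + 1) []) (ms.getD t 0)
        = crossingRefl (ws.getD (t + 1) []) (ms.getD (t + 1) 0)) ∧
    IsReducedSelf P'.bot

/-! ### Huang bumps -/

/-- Least offset `t ≥ 1` satisfying `p` (searched up to `bound + 1`). -/
def leastOff (p : ℕ → Bool) (bound : ℕ) : ℕ :=
  ((List.range' 1 (bound + 1)).filter p).headD 1

/-- The southeast corner `(x + k, y + l)` of the min-droop at `(x, y)`: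
`k, l ≥ 1` minimal with `(x+k, y)` and `(x, y+l)` not crossing tiles. -/
def minDroopCorner (g : Grid) (x y : ℕ) : ℕ × ℕ :=
  (x + leastOff (fun k => !(g.tile (x + k) y == Tile.cross)) g.n,
   y + leastOff (fun l => !(g.tile x (y + l) == Tile.cross)) g.n)

/-- The min-droop at `(x, y)`: droop the ⌐-turn at `(x, y)` into `(x+k, y+l)`. -/
def minDroopT (g : Grid) (x y : ℕ) : Grid :=
  let k := leastOff (fun k => !(g.tile (x + k) y == Tile.cross)) g.n
  let l := leastOff (fun l => !(g.tile x (y + l) == Tile.cross)) g.n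
  ⟨g.n, fun a b =>
    let t := g.tile a b
    if a = x ∧ b = y then
      (match t with | Tile.se => Tile.blank | Tile.bump => Tile.nw | _ => t)
    else if a = x + k ∧ b = y then (match t with | Tile.vert => Tile.se | _ => t)
    else if a = x ∧ b = y + l then
      (match t with | Tile.horiz => Tile.se | Tile.nw => Tile.vert | _ => t)
    else if a = x + k ∧ b = y + l then
      (match t with | Tile.blank => Tile.nw | Tile.se => Tile.bump | _ => t)
    else if b = y ∧ x < a ∧ a < x + k then
      (match t with | Tile.cross => Tile.horiz | Tile.vert => Tile.blank | _ => t)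
    else if a = x ∧ y < b ∧ b < y + l then
      (match t with | Tile.cross => Tile.vert | Tile.horiz => Tile.blank | _ => t)
    else if a = x + k ∧ y < b ∧ b < y + l then
      (match t with | Tile.blank => Tile.horiz | Tile.vert => Tile.cross | _ => t)
    else if b = y + l ∧ x < a ∧ a < x + k then
      (match t with | Tile.blank => Tile.vert | Tile.horiz => Tile.cross | _ => t)
    else t⟩

/-- Replace a single tile. -/
def setTile (g : Grid) (x y : ℕ) (t : Tile) : Grid :=
  ⟨g.n, fun a b => if a = x ∧ b = y then t else g.tile a b⟩

/-- Pipe `c` passes through `(x, y)` (Boolean). -/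
def onPath (g : Grid) (c : ℕ) (x y : ℕ) : Bool :=
  decide ((x, y, Dir.north) ∈ pipePath g c) || decide ((x, y, Dir.east) ∈ pipePath g c)

/-- The position of the crossing tile where pipes `c` and `c'` cross, if any. -/
def findCrossing (g : Grid) (c c' : ℕ) : Option (ℕ × ℕ) :=
  (pipePath g c).findSome? (fun s =>
    if (g.tile s.1 s.2.1 == Tile.cross) && onPath g c' s.1 s.2.1 then some (s.1, s.2.1)
    else none)

/-- The column of the ⌐-turn of pipe `c` in row `row`, if any. -/
def seTurnCol (g : Grid) (c row : ℕ) : Option ℕ :=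
  (pipePath g c).findSome? (fun s =>
    if s.1 = row ∧ s.2.2 = Dir.north ∧
        (g.tile s.1 s.2.1 = Tile.se ∨ g.tile s.1 s.2.1 = Tile.bump) then some s.2.1
    else none)

/-- The iteration of the Huang bump: min-droops and cross-bump-swaps until a bump tile
is turned into a crossing tile. -/
def huangLoop (iPipe : ℕ) : ℕ → Grid → ℕ × ℕ → Grid
  | 0, g, _ => g
  | fuel + 1, g, (x, y) =>
    let c := minDroopCorner g x y
    let g1 := minDroopT g x y
    match g1.tile c.1 c.2 with
    | Tile.nw =>
      match seTurnCol g1 iPipe c.1 with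
      | some col => huangLoop iPipe fuel g1 (c.1, col)
      | none => g1
    | Tile.bump =>
      match backAux g1 (2 * g1.n + 2) c.1 c.2 false with
      | some q =>
        match findCrossing g1 iPipe q with
        | some z =>
          huangLoop iPipe fuel (setTile (setTile g1 c.1 c.2 Tile.cross) z.1 z.2 Tile.bump) z
        | none => setTile g1 c.1 c.2 Tile.cross
      | none => g1
    | _ => g1

/-- Fuel exceeding the number of states of the procedure. -/
def huangFuel (g : Grid) : ℕ := 7 ^ (g.n * g.n) * (g.n * g.n) + 2

/-- The Huang bump `H_{ij}`: replace the crossing of pipes `i` and `j` by a bump tile,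
then repeatedly min-droop and cross-bump-swap until a new crossing tile is created. -/
def huang (i j : ℕ) (g : Grid) : Grid :=
  match findCrossing g i j with
  | some z => huangLoop i (huangFuel g) (setTile g z.1 z.2 Tile.bump) z
  | none => g



/-! ### The row machine -/

def passT : Tile → Tile → Option (Tile × Tile)
  | .blank, .vert => some (.vert, .blank)
  | .horiz, .cross => some (.cross, .horiz)
  | .se, .cross => some (.vert, .se)
  | .vert, .vert => some (.vert, .vert)
  | .cross, .cross => some (.cross, .cross)
  | .nw, .vert => some (.cross, .nw)
  | _, _ => none

def halfT : Tile → Tile → Option Tile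
  | .horiz, .nw => some .nw
  | .se, .nw => some .vert
  | _, _ => none

def srcT : Tile → Option Tile
  | .vert => some .nw
  | .se => some .horiz
  | _ => none

/-- One letter processed by one row. -/
inductive StepB (τ : ℕ → Tile) (j j' : ℕ) (τ' : ℕ → Tile) : Prop
  | pass (t1 t2 : Tile) (h : passT (τ j) (τ (j+1)) = some (t1, t2)) (hj : j' = j)
      (ht : ∀ y, τ' y = if y = j then t1 else if y = j + 1 then t2 else τ y)
  | jump (t1 t3 : Tile) (h : halfT (τ j) (τ (j+1)) = some t1) (hj : j + 1 ≤ j')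
      (hb : ∀ y, j + 1 < y → y ≤ j' → τ y = .blank) (h3 : srcT (τ (j'+1)) = some t3)
      (ht : ∀ y, τ' y = if y = j then t1 else if y = j' + 1 then t3 else if y = j' then .se
        else if y = j + 1 then .blank else τ y)

inductive RunB : (ℕ → Tile) → List ℕ → List ℕ → (ℕ → Tile) → Prop
  | nil (τ) : RunB τ [] [] τ
  | cons {τ τ1 τ2 j j' J J'} : StepB τ j j' τ1 → RunB τ1 J J' τ2 → RunB τ (j :: J) (j' :: J') τ2

theorem passT_halfT {a b : Tile} {x y} (h : passT a b = some x) (h2 : halfT a b = some y) :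
    False := by
  cases a <;> cases b <;> simp_all [passT, halfT]

theorem StepB.det {τ j j1 τ1 j2 τ2} (h1 : StepB τ j j1 τ1) (h2 : StepB τ j j2 τ2) :
    j1 = j2 ∧ τ1 = τ2 := by
  cases h1 with
  | pass a b h hj ht =>
    cases h2 with
    | pass a' b' h' hj' ht' =>
      rw [h] at h'; simp at h'
      refine ⟨by omega, ?_⟩
      funext y; rw [ht, ht', h'.1, h'.2]
    | jump a' b' h' hj' hb' h3' ht' => exact (passT_halfT h h').elim
  | jump a b h hj hb h3 ht =>
    cases h2 with
    | pass a' b' h' hj' ht' => exact (passT_halfT h' h).elim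
    | jump a' b' h' hj' hb' h3' ht' =>
      have e : j1 = j2 := by
        rcases lt_trichotomy j1 j2 with hl | hl | hl
        · have := hb' (j1+1) (by omega) (by omega)
          rw [this] at h3; simp [srcT] at h3
        · exact hl
        · have := hb (j2+1) (by omega) (by omega)
          rw [this] at h3'; simp [srcT] at h3'
      subst e
      rw [h] at h'; rw [h3] at h3'; simp at h' h3'
      refine ⟨rfl, ?_⟩
      funext y; rw [ht, ht', h', h3']

theorem RunB.det {τ J J1 τ1 J2 τ2} (h1 : RunB τ J J1 τ1) (h2 : RunB τ J J2 τ2) :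
    J1 = J2 ∧ τ1 = τ2 := by
  induction h1 generalizing J2 τ2 with
  | nil => cases h2; simp
  | cons s r ih =>
    cases h2 with
    | cons s' r' =>
      obtain ⟨rfl, rfl⟩ := s.det s'
      obtain ⟨rfl, rfl⟩ := ih r'
      simp

theorem RunB.append {τ J1 J1' τ1 J2 J2' τ2} (h1 : RunB τ J1 J1' τ1) (h2 : RunB τ1 J2 J2' τ2) :
    RunB τ (J1 ++ J2) (J1' ++ J2') τ2 := by
  induction h1 with
  | nil => exact h2
  | cons s r ih => exact RunB.cons s (ih h2)

theorem RunB.split {τ J1 J2 J' τ2} (h : RunB τ (J1 ++ J2) J' τ2) :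
    ∃ J1' J2' τ1, J' = J1' ++ J2' ∧ RunB τ J1 J1' τ1 ∧ RunB τ1 J2 J2' τ2 := by
  induction J1 generalizing τ J' with
  | nil => exact ⟨[], J', τ, rfl, RunB.nil _, h⟩
  | cons j J1 ih =>
    cases h with
    | cons s r =>
      obtain ⟨a, b, t, rfl, h1, h2⟩ := ih r
      exact ⟨_ :: a, b, t, rfl, RunB.cons s h1, h2⟩

theorem RunB.length {τ J J' τ'} (h : RunB τ J J' τ') : J'.length = J.length := by
  induction h with
  | nil => rfl
  | cons _ _ ih => simp [ih]

/-! ### Coxeter–Knuth moves on triples -/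

def CK3 (p q r p' q' r' : ℕ) : Prop :=
  (p = r ∧ (q = p + 1 ∨ p = q + 1) ∧ p' = q ∧ q' = p ∧ r' = q) ∨
  (((q < p ∧ p < r) ∨ (r < p ∧ p < q)) ∧ p' = p ∧ q' = r ∧ r' = q) ∨
  (((p < r ∧ r < q) ∨ (q < r ∧ r < p)) ∧ p' = q ∧ q' = p ∧ r' = r)

instance (p q r p' q' r' : ℕ) : Decidable (CK3 p q r p' q' r') := by
  unfold CK3; infer_instance

theorem CK3.symm {p q r p' q' r'} (h : CK3 p q r p' q' r') : CK3 p' q' r' p q r := by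
  unfold CK3 at *; omega

theorem CK3.shift {p q r p' q' r'} (a : ℕ) (h : CK3 p q r p' q' r') :
    CK3 (a+p) (a+q) (a+r) (a+p') (a+q') (a+r') := by
  unfold CK3 at *; omega

theorem CK3.det {p q r p' q' r' p2 q2 r2} (h : CK3 p q r p' q' r') (h2 : CK3 p q r p2 q2 r2) :
    p' = p2 ∧ q' = q2 ∧ r' = r2 := by
  unfold CK3 at *; omega

/-! ### Blankless rows -/

def stepF (a b c : Tile) : Option (ℕ × Tile × Tile × Tile) :=
  match passT a b with
  | some (x, y) => some (0, x, y, c)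
  | none =>
    match halfT a b, srcT c with
    | some x, some z => some (1, x, .se, z)
    | _, _ => none

def NB (τ : ℕ → Tile) : Prop := ∀ y, τ y ≠ .blank

theorem passT_nb {a b : Tile} {x} (h : passT a b = some x) (ha : a ≠ .blank) :
    x.1 ≠ .blank ∧ x.2 ≠ .blank := by
  cases a <;> cases b <;> simp_all [passT] <;> subst h <;> simp

theorem halfT_nb {a b : Tile} {x} (h : halfT a b = some x) : x ≠ .blank := by
  cases a <;> cases b <;> simp_all [halfT] <;> subst h <;> simp

theorem srcT_nb {a : Tile} {x} (h : srcT a = some x) : x ≠ .blank := by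
  cases a <;> simp_all [srcT] <;> subst h <;> simp

theorem StepB.toF {τ j j' τ'} (hn : NB τ) (h : StepB τ j j' τ') :
    NB τ' ∧ ∃ d x y z, stepF (τ j) (τ (j+1)) (τ (j+2)) = some (d, x, y, z) ∧ j' = j + d ∧
      τ' j = x ∧ τ' (j+1) = y ∧ τ' (j+2) = z ∧
      ∀ u, u ≠ j → u ≠ j + 1 → u ≠ j + 2 → τ' u = τ u := by
  cases h with
  | pass a b h hj ht =>
    refine ⟨?_, 0, a, b, τ (j+2), by simp [stepF, h], by omega, by simp [ht], by simp [ht],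
      by simp [ht], fun u h1 h2 h3 => by simp [ht, h1, h2]⟩
    intro y; rw [ht]
    have := passT_nb h (hn _)
    split_ifs
    · exact this.1
    · exact this.2
    · exact hn y
  | jump a b h hj hb h3 ht =>
    have e : j' = j + 1 := by
      by_contra hne
      exact hn _ (hb (j+2) (by omega) (by omega))
    subst e
    have hp : passT (τ j) (τ (j+1)) = none := by
      rcases hh : passT (τ j) (τ (j+1)) with _ | w
      · rfl
      · exact (passT_halfT hh h).elim
    refine ⟨?_, 1, a, .se, b, by simp [stepF, h, hp, h3], rfl, by simp [ht], by simp [ht],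
      by simp [ht], fun u h1 h2 h3 => by simp [ht, h1, h2, h3]⟩
    intro y; rw [ht]
    split_ifs
    · exact halfT_nb h
    · exact srcT_nb h3
    · simp
    · exact hn y

theorem stepF_le {a b c d x y z} (h : stepF a b c = some (d, x, y, z)) : d ≤ 1 := by
  unfold stepF at h
  split at h
  · simp at h; omega
  · split at h <;> simp at h; omega

abbrev W5 := Tile × Tile × Tile × Tile × Tile

def stepW : ℕ → W5 → Option (ℕ × W5)
  | 0, (a, b, c, d, e) => (stepF a b c).map fun r => (0 + r.1, r.2.1, r.2.2.1, r.2.2.2, d, e)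
  | 1, (a, b, c, d, e) => (stepF b c d).map fun r => (1 + r.1, a, r.2.1, r.2.2.1, r.2.2.2, e)
  | 2, (a, b, c, d, e) => (stepF c d e).map fun r => (2 + r.1, a, b, r.2.1, r.2.2.1, r.2.2.2)
  | _, _ => none

def win (τ : ℕ → Tile) (a : ℕ) : W5 := (τ a, τ (a+1), τ (a+2), τ (a+3), τ (a+4))

theorem StepB.toW {τ a i j' τ'} (hn : NB τ) (hi : i ≤ 2) (h : StepB τ (a+i) j' τ') :
    NB τ' ∧ ∃ o, j' = a + o ∧ stepW i (win τ a) = some (o, win τ' a) ∧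
      ∀ u, (u < a ∨ a + 4 < u) → τ' u = τ u := by
  obtain ⟨hn', d, x, y, z, hf, hj, h0, h1, h2, hu⟩ := h.toF hn
  refine ⟨hn', i + d, by omega, ?_, fun u hh => hu u (by omega) (by omega) (by omega)⟩
  obtain rfl | rfl | rfl : i = 0 ∨ i = 1 ∨ i = 2 := by omega
  all_goals simp only [add_zero, add_assoc, Nat.reduceAdd] at *
  · simp [stepW, win, hf, h0, h1, h2, hu (a+3) (by omega) (by omega) (by omega),
      hu (a+4) (by omega) (by omega) (by omega)]
  · simp [stepW, win, hf, h0, h1, h2, hu a (by omega) (by omega) (by omega),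
      hu (a+4) (by omega) (by omega) (by omega)]
  · simp [stepW, win, hf, h0, h1, h2, hu (a+1) (by omega) (by omega) (by omega),
      hu a (by omega) (by omega) (by omega)]

def runW (l : List ℕ) (w : W5) : Option (List ℕ × W5) :=
  match l with
  | [] => some ([], w)
  | i :: l => (stepW i w).bind fun r => (runW l r.2).map fun q => (r.1 :: q.1, q.2)

theorem RunB.toW {τ a l J' τ'} (hn : NB τ) (hl : ∀ i ∈ l, i ≤ 2)
    (h : RunB τ (l.map (a + ·)) J' τ') :
    NB τ' ∧ ∃ o : List ℕ, J' = o.map (a + ·) ∧ runW l (win τ a) = some (o, win τ' a) ∧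
      ∀ u, (u < a ∨ a + 4 < u) → τ' u = τ u := by
  induction l generalizing τ J' with
  | nil => cases h; exact ⟨hn, [], rfl, rfl, fun _ _ => rfl⟩
  | cons i l ih =>
    simp only [List.map_cons] at h
    cases h with
    | cons s r =>
      obtain ⟨hn1, o, rfl, e1, hu1⟩ := s.toW hn (hl i (by simp))
      obtain ⟨hn2, o2, rfl, e2, hu2⟩ := ih hn1 (fun i hi => hl i (by simp [hi])) r
      exact ⟨hn2, o :: o2, by simp, by simp [runW, e1, e2],
        fun u hu => by rw [hu2 u hu, hu1 u hu]⟩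

def nbTiles : List Tile := [.vert, .horiz, .se, .nw, .cross, .bump]

def ckOK (l1 l2 : List ℕ) (w : W5) : Bool :=
  match runW l1 w, runW l2 w with
  | some ([p, q, r], w1), some ([p', q', r'], w2) =>
      decide (CK3 p q r p' q' r') && decide (w1 = w2)
  | some _, some _ => false
  | _, _ => true

def ckAll (l1 l2 : List ℕ) : Bool :=
  nbTiles.all fun a => nbTiles.all fun b => nbTiles.all fun c => nbTiles.all fun d =>
    nbTiles.all fun e => ckOK l1 l2 (a, b, c, d, e)

theorem ckAll1 : ckAll [1,0,2] [1,2,0] = true := by decide +kernel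
theorem ckAll2 : ckAll [0,2,1] [2,0,1] = true := by decide +kernel
theorem ckAll3 : ckAll [0,1,0] [1,0,1] = true := by decide +kernel


theorem ckOK_of {l1 l2 w} (h : ckAll l1 l2 = true)
    (hw : w.1 ≠ .blank ∧ w.2.1 ≠ .blank ∧ w.2.2.1 ≠ .blank ∧ w.2.2.2.1 ≠ .blank ∧
      w.2.2.2.2 ≠ .blank) : ckOK l1 l2 w = true := by
  have key : ∀ t : Tile, t ≠ .blank → t ∈ nbTiles := by
    intro t ht; cases t <;> simp_all [nbTiles]
  obtain ⟨a, b, c, d, e⟩ := w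
  simp only [ckAll, List.all_eq_true] at h
  exact h a (key _ hw.1) b (key _ hw.2.1) c (key _ hw.2.2.1) d (key _ hw.2.2.2.1) e
    (key _ hw.2.2.2.2)

theorem ckWin {τ : ℕ → Tile} {a : ℕ} {l1 l2 : List ℕ} {p q r p' q' r' τ1 τ2} (hn : NB τ)
    (hk : ckAll l1 l2 = true) (h1 : ∀ i ∈ l1, i ≤ 2) (h2 : ∀ i ∈ l2, i ≤ 2)
    (r1 : RunB τ (l1.map (a + ·)) [p, q, r] τ1) (r2 : RunB τ (l2.map (a + ·)) [p', q', r'] τ2) :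
    CK3 p q r p' q' r' ∧ τ1 = τ2 := by
  have hk := ckOK_of (w := win τ a) hk ⟨hn _, hn _, hn _, hn _, hn _⟩
  obtain ⟨-, o1, e1, w1, u1⟩ := r1.toW hn h1
  obtain ⟨-, o2, e2, w2, u2⟩ := r2.toW hn h2
  rcases o1 with _ | ⟨x1, _ | ⟨y1, _ | ⟨z1, _ | _⟩⟩⟩ <;> simp at e1
  rcases o2 with _ | ⟨x2, _ | ⟨y2, _ | ⟨z2, _ | _⟩⟩⟩ <;> simp at e2
  simp only [ckOK, w1, w2, Bool.and_eq_true, decide_eq_true_eq] at hk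
  obtain ⟨rfl, rfl, rfl⟩ := e1
  obtain ⟨rfl, rfl, rfl⟩ := e2
  refine ⟨hk.1.shift a, ?_⟩
  have hw := hk.2
  simp only [win, Prod.mk.injEq] at hw
  funext u
  by_cases hu : u < a ∨ a + 4 < u
  · rw [u1 u hu, u2 u hu]
  · obtain rfl | rfl | rfl | rfl | rfl : u = a ∨ u = a + 1 ∨ u = a + 2 ∨ u = a + 3 ∨ u = a + 4 := by
      omega
    all_goals simp [hw]

theorem passT_vert {a b : Tile} {x} (h : passT a b = some x) (hn : a ≠ .blank) :
    (x.2 = .nw → a = .nw) := by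
  cases a <;> cases b <;> simp_all [passT] <;> subst h <;> simp

/-- strict ascents and descents are preserved (blankless). -/
theorem descNB {τ x y x' y' τ'} (hn : NB τ) (h : RunB τ [x, y] [x', y'] τ') :
    (x < y → x' < y') ∧ (y < x → y' < x') := by
  cases h with
  | cons s r =>
  rename_i τ1
  cases r with
  | cons s' r' =>
  obtain ⟨hn1, d, t1, t2, t3, hf, rfl, h0, h1, h2, hu⟩ := s.toF hn
  obtain ⟨hn2, d', s1, s2, s3, hf', rfl, h0', h1', h2', hu'⟩ := s'.toF hn1
  have hd := stepF_le hf
  have hd' := stepF_le hf'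
  refine ⟨fun hlt => ?_, fun hlt => ?_⟩
  · by_contra hc
    obtain ⟨rfl, rfl, rfl⟩ : d = 1 ∧ d' = 0 ∧ y = x + 1 := by omega
    have a1 : τ1 (x+1) = .se ∧ (τ1 (x+1+1) = .nw ∨ τ1 (x+1+1) = .horiz) := by
      unfold stepF at hf
      split at hf
      · simp at hf
      · split at hf <;> simp at hf
        rename_i hs
        rw [h1, show x+1+1 = x+2 from rfl, h2]
        refine ⟨hf.2.1.symm, ?_⟩
        rw [← hf.2.2]
        unfold srcT at hs; split at hs <;> simp_all
    unfold stepF at hf'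
    rw [a1.1] at hf'
    rcases a1.2 with e | e <;> rw [e] at hf' <;> simp [passT, halfT] at hf'
    split at hf' <;> simp at hf'
  · by_contra hc
    obtain ⟨rfl, rfl, rfl⟩ : d = 0 ∧ d' = 1 ∧ x = y + 1 := by omega
    have a1 : τ1 (y+1) = .nw := by
      unfold stepF at hf'
      generalize τ1 y = u at hf'
      generalize τ1 (y+1) = v at hf'
      generalize τ1 (y+2) = w at hf'
      cases u <;> cases v <;> simp [passT, halfT] at hf' <;> rfl
    rw [h0] at a1
    subst a1
    unfold stepF at hf
    generalize τ (y+1) = u at hf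
    generalize τ (y+1+1) = v at hf
    generalize τ (y+1+2) = w at hf
    cases u <;> cases v <;> simp [passT, halfT] at hf <;> (split at hf <;> simp at hf)

theorem StepB.congr {τ j j' τ' σ} (hn : NB τ) (hs : NB σ) (h : StepB τ j j' τ')
    (h0 : σ j = τ j) (h1 : σ (j+1) = τ (j+1)) (h2 : σ (j+2) = τ (j+2)) :
    StepB σ j j' (fun y => if y = j ∨ y = j+1 ∨ y = j+2 then τ' y else σ y) := by
  cases h with
  | pass a b h hj ht =>
    refine StepB.pass a b (by rw [h0, h1]; exact h) hj ?_
    intro y; rw [ht]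
    split_ifs <;> simp_all
  | jump a b h hj hb h3 ht =>
    have e : j' = j + 1 := by
      by_contra hne
      exact hn _ (hb (j+2) (by omega) (by omega))
    subst e
    refine StepB.jump a b (by rw [h0, h1]; exact h) hj (fun y _ _ => by omega)
      (by rw [show j+1+1 = j+2 from rfl, h2]; exact h3) ?_
    intro y; rw [ht]
    split_ifs <;> first | rfl | omega

/-- far letters commute (blankless). -/
theorem farComm {τ a c a' c' τ'} (hn : NB τ) (hac : a + 3 ≤ c ∨ c + 3 ≤ a)
    (h : RunB τ [a, c] [a', c'] τ') : RunB τ [c, a] [c', a'] τ' := by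
  cases h with
  | cons s r =>
  rename_i τ1
  cases r with
  | cons s' r' =>
  cases r'
  obtain ⟨hn1, d, t1, t2, t3, hf, rfl, h0, h1, h2, hu⟩ := s.toF hn
  obtain ⟨hn2, d', s1, s2, s3, hf', rfl, h0', h1', h2', hu'⟩ := s'.toF hn1
  have S1 := s'.congr hn1 hn (hu c (by omega) (by omega) (by omega)).symm
    (hu (c+1) (by omega) (by omega) (by omega)).symm
    (hu (c+2) (by omega) (by omega) (by omega)).symm
  have N1 := (S1.toF hn).1
  have S2 := s.congr hn N1 (by simp; omega) (by simp; omega) (by simp; omega)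
  refine RunB.cons S1 (RunB.cons S2 ?_)
  convert RunB.nil _ using 1
  funext y
  by_cases e1 : y = a ∨ y = a+1 ∨ y = a+2
  · simp only [e1, if_true]; rw [hu' y (by omega) (by omega) (by omega)]
  · simp only [e1, if_false]
    by_cases e2 : y = c ∨ y = c+1 ∨ y = c+2
    · simp [e2]
    · simp only [e2, if_false]; rw [hu' y (by omega) (by omega) (by omega), hu y (by omega) (by omega) (by omega)]

theorem RunB.nb {τ J J' τ'} (hn : NB τ) (h : RunB τ J J' τ') : NB τ' := by
  induction h with
  | nil => exact hn
  | cons s r ih => exact ih (s.toF hn).1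

theorem RunB.inv3 {τ p q r p' q' r' τ'} (h : RunB τ [p,q,r] [p',q',r'] τ') :
    ∃ τ1 τ2, StepB τ p p' τ1 ∧ StepB τ1 q q' τ2 ∧ StepB τ2 r r' τ' := by
  cases h with
  | cons s r =>
  cases r with
  | cons s' r' =>
  cases r' with
  | cons s'' r'' => cases r''; exact ⟨_, _, s, s', s''⟩

theorem RunB.mk1 {τ p p' τ1} (h : StepB τ p p' τ1) : RunB τ [p] [p'] τ1 := .cons h (.nil _)
theorem RunB.mk2 {τ p p' τ1 q q' τ2} (h : StepB τ p p' τ1) (h2 : StepB τ1 q q' τ2) :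
    RunB τ [p,q] [p',q'] τ2 := .cons h (.mk1 h2)

/-- commuting type 1. -/
theorem ckNB1 {τ b a c b1 a1 c1 b2 a2 c2 τ1 τ2} (hn : NB τ) (hab : a < b) (hbc : b < c)
    (r1 : RunB τ [b,a,c] [b1,a1,c1] τ1) (r2 : RunB τ [b,c,a] [b2,c2,a2] τ2) :
    CK3 b1 a1 c1 b2 c2 a2 ∧ τ1 = τ2 := by
  by_cases hc : c = a + 2
  · obtain rfl : b = a + 1 := by omega
    subst hc
    exact ckWin (a := a) (l1 := [1,0,2]) (l2 := [1,2,0]) hn ckAll1 (by simp) (by simp) r1 r2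
  · obtain ⟨σ1, σ2, A, B, C⟩ := r1.inv3
    obtain ⟨ρ1, ρ2, A', B', C'⟩ := r2.inv3
    obtain ⟨rfl, rfl⟩ := A.det A'
    have hn1 := (A.toF hn).1
    have := farComm hn1 (by omega) (RunB.mk2 B C)
    have e := this.det (RunB.mk2 B' C')
    simp at e
    obtain ⟨⟨rfl, rfl⟩, rfl⟩ := e
    have d1 := descNB hn (RunB.mk2 A B)
    have d2 := descNB hn (RunB.mk2 A B')
    refine ⟨?_, rfl⟩
    unfold CK3; omega

theorem ckNB2 {τ b a c b1 a1 c1 b2 a2 c2 τ1 τ2} (hn : NB τ) (hab : a < b) (hbc : b < c)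
    (r1 : RunB τ [a,c,b] [a1,c1,b1] τ1) (r2 : RunB τ [c,a,b] [c2,a2,b2] τ2) :
    CK3 a1 c1 b1 c2 a2 b2 ∧ τ1 = τ2 := by
  by_cases hc : c = a + 2
  · obtain rfl : b = a + 1 := by omega
    subst hc
    exact ckWin (a := a) (l1 := [0,2,1]) (l2 := [2,0,1]) hn ckAll2 (by simp) (by simp) r1 r2
  · obtain ⟨σ1, σ2, A, B, C⟩ := r1.inv3
    obtain ⟨ρ1, ρ2, A', B', C'⟩ := r2.inv3
    have := farComm hn (by omega) (RunB.mk2 A B)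
    have e := this.det (RunB.mk2 A' B')
    simp at e
    obtain ⟨⟨rfl, rfl⟩, rfl⟩ := e
    obtain ⟨rfl, rfl⟩ := C.det C'
    have d1 := descNB (A.toF hn).1 (RunB.mk2 B C)
    have d2 := descNB (A'.toF hn).1 (RunB.mk2 B' C')
    refine ⟨?_, rfl⟩
    unfold CK3; omega

theorem ckNB3 {τ a b1 a1 c1 b2 a2 c2 τ1 τ2} (hn : NB τ)
    (r1 : RunB τ [a,a+1,a] [a1,c1,b1] τ1) (r2 : RunB τ [a+1,a,a+1] [c2,a2,b2] τ2) :
    CK3 a1 c1 b1 c2 a2 b2 ∧ τ1 = τ2 :=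
  ckWin (a := a) (l1 := [0,1,0]) (l2 := [1,0,1]) hn ckAll3 (by simp) (by simp) r1 r2

theorem ckNB {τ p q r p' q' r' x y z x' y' z' τ1 τ2} (hn : NB τ) (h : CK3 p q r p' q' r')
    (r1 : RunB τ [p,q,r] [x,y,z] τ1) (r2 : RunB τ [p',q',r'] [x',y',z'] τ2) :
    CK3 x y z x' y' z' ∧ τ1 = τ2 := by
  have sy : ∀ {A B : Prop}, A ∧ τ2 = τ1 → (A → B) → B ∧ τ1 = τ2 := fun h f => ⟨f h.1, h.2.symm⟩
  rcases h with ⟨rfl, h | h, rfl, rfl, rfl⟩ | ⟨h | h, rfl, rfl, rfl⟩ | ⟨h | h, rfl, rfl, rfl⟩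
  · subst h; exact ckNB3 hn r1 r2
  · subst h; exact sy (ckNB3 hn r2 r1) CK3.symm
  · exact ckNB1 hn h.1 h.2 r1 r2
  · exact sy (ckNB1 hn h.1 h.2 r2 r1) CK3.symm
  · exact ckNB2 hn h.1 h.2 r1 r2
  · exact sy (ckNB2 hn h.1 h.2 r2 r1) CK3.symm

/-! ### Decomposition of rows with blanks -/

def upR (t : Tile) : Bool := match t with | .vert => true | .cross => true | .nw => true | _ => false
def loR (t : Tile) : Bool := match t with | .vert => true | .cross => true | .se => true | _ => false

def R0 (β : ℕ) (τ : ℕ → Tile) (y : ℕ) : Tile :=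
  if y < β then τ y else if y = β then .se else if upR (τ y) then .cross else .horiz

def R1 (β : ℕ) (τ : ℕ → Tile) (y : ℕ) : Tile :=
  if β < y then τ y else if y = β then .nw else if loR (τ y) then .cross else .horiz

def FB (β : ℕ) (τ : ℕ → Tile) : Prop := τ β = .blank ∧ ∀ y, y < β → τ y ≠ .blank

theorem passT_cases {a b x y} (h : passT a b = some (x, y)) :
    (a = .blank ∧ b = .vert ∧ x = .vert ∧ y = .blank) ∨
    (a = .horiz ∧ b = .cross ∧ x = .cross ∧ y = .horiz) ∨
    (a = .se ∧ b = .cross ∧ x = .vert ∧ y = .se) ∨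
    (a = .vert ∧ b = .vert ∧ x = .vert ∧ y = .vert) ∨
    (a = .cross ∧ b = .cross ∧ x = .cross ∧ y = .cross) ∨
    (a = .nw ∧ b = .vert ∧ x = .cross ∧ y = .nw) := by
  cases a <;> cases b <;> simp [passT] at h <;> obtain ⟨rfl, rfl⟩ := h <;> simp

theorem halfT_cases {a b x} (h : halfT a b = some x) :
    b = .nw ∧ ((a = .horiz ∧ x = .nw) ∨ (a = .se ∧ x = .vert)) := by
  cases a <;> cases b <;> simp_all [halfT]

theorem srcT_cases {a x} (h : srcT a = some x) :
    (a = .vert ∧ x = .nw) ∨ (a = .se ∧ x = .horiz) := by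
  cases a <;> simp_all [srcT]



theorem StepB.decomp {τ j j' τ' β} (h : StepB τ j j' τ') (hb : FB β τ) :
    ∃ β' j1, FB β' τ' ∧ StepB (R0 β τ) j j1 (R0 β' τ') ∧ StepB (R1 β τ) j1 j' (R1 β' τ') := by
  obtain ⟨hb0, hb1⟩ := hb
  cases h with
  | pass a b h hj ht =>
    subst hj
    rcases lt_trichotomy β j' with hl | rfl | hl
    · refine ⟨β, j', ⟨by rw [ht]; simp [hl.ne, hb0]; omega, fun y hy => ?_⟩, ?_, ?_⟩
      · rw [ht, if_neg (by omega), if_neg (by omega)]; exact hb1 y hy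
      · refine StepB.pass (if upR a then .cross else .horiz) (if upR b then .cross else .horiz) ?_ rfl ?_
        · simp only [R0, show ¬ j' < β by omega, show j' ≠ β by omega, show ¬ j'+1 < β by omega,
            show j'+1 ≠ β by omega, if_false]
          rcases passT_cases h with ⟨e1,e2,rfl,rfl⟩|⟨e1,e2,rfl,rfl⟩|⟨e1,e2,rfl,rfl⟩|⟨e1,e2,rfl,rfl⟩|⟨e1,e2,rfl,rfl⟩|⟨e1,e2,rfl,rfl⟩ <;> rw [e1,e2] <;> rfl
        · intro y; simp only [R0, ht]
          split_ifs <;> first | rfl | omega | simp_all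
      · refine StepB.pass a b ?_ rfl ?_
        · simp only [R1, show β < j' by omega, show β < j'+1 by omega, if_true]; exact h
        · intro y; simp only [R1, ht]
          split_ifs <;> first | rfl | omega | simp_all
    · rcases passT_cases h with ⟨e1,e2,rfl,rfl⟩|⟨e1,e2,rfl,rfl⟩|⟨e1,e2,rfl,rfl⟩|⟨e1,e2,rfl,rfl⟩|⟨e1,e2,rfl,rfl⟩|⟨e1,e2,rfl,rfl⟩ <;> (try (rw [hb0] at e1; cases e1; done))
      refine ⟨β+1, β, ⟨by rw [ht]; simp, fun y hy => ?_⟩, ?_, ?_⟩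
      · rw [ht]; split_ifs
        · simp
        · omega
        · exact hb1 y (by omega)
      · refine StepB.pass .vert .se ?_ rfl ?_
        · simp [R0, e2, upR, passT]
        · intro y; simp only [R0, ht]
          split_ifs <;> first | rfl | omega | simp_all
      · refine StepB.pass .cross .nw ?_ rfl ?_
        · simp [R1, e2, passT]
        · intro y; simp only [R1, ht]
          split_ifs <;> first | rfl | omega | simp_all [loR]
    · have hl2 : j' + 1 < β := by
        by_contra hc
        obtain rfl : β = j'+1 := by omega
        rcases passT_cases h with ⟨e1,e2,rfl,rfl⟩|⟨e1,e2,rfl,rfl⟩|⟨e1,e2,rfl,rfl⟩|⟨e1,e2,rfl,rfl⟩|⟨e1,e2,rfl,rfl⟩|⟨e1,e2,rfl,rfl⟩ <;> (rw [hb0] at e2; cases e2; done)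
      refine ⟨β, j', ⟨by rw [ht]; simp [hl.ne', hb0]; omega, fun y hy => ?_⟩, ?_, ?_⟩
      · rw [ht]
        have := passT_nb h (hb1 _ hl)
        split_ifs
        · exact this.1
        · exact this.2
        · exact hb1 y hy
      · refine StepB.pass a b ?_ rfl ?_
        · simp only [R0, show j' < β by omega, show j'+1 < β by omega, if_true]; exact h
        · intro y; simp only [R0, ht]
          split_ifs <;> first | rfl | omega | simp_all
      · refine StepB.pass (if loR a then .cross else .horiz) (if loR b then .cross else .horiz) ?_ rfl ?_
        · have := hb1 _ hl
          simp only [R1, show ¬ β < j' by omega, show j' ≠ β by omega, show ¬ β < j'+1 by omega,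
            show j'+1 ≠ β by omega, if_false]
          rcases passT_cases h with ⟨e1,e2,rfl,rfl⟩|⟨e1,e2,rfl,rfl⟩|⟨e1,e2,rfl,rfl⟩|⟨e1,e2,rfl,rfl⟩|⟨e1,e2,rfl,rfl⟩|⟨e1,e2,rfl,rfl⟩ <;> first | (exact absurd e1 this) | (rw [e1,e2]; rfl)
        · intro y; simp only [R1, ht]
          split_ifs <;> first | rfl | omega | simp_all
  | jump t1 t3 h hj hbl h3 ht =>
    obtain ⟨e2, e1⟩ := halfT_cases h
    have hβj : β ≠ j := by rintro rfl; rw [hb0] at e1; simp at e1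
    have hβj1 : β ≠ j + 1 := by rintro rfl; rw [hb0] at e2; simp at e2
    have hβ3 : β ≠ j' + 1 := by
      rintro rfl; rw [hb0] at h3; simp [srcT] at h3
    have ht1 : t1 ≠ .blank := halfT_nb h
    have ht3 : t3 ≠ .blank := srcT_nb h3
    rcases lt_or_gt_of_ne hβj with hl | hl
    · refine ⟨β, j, ⟨?_, fun y hy => ?_⟩, ?_, ?_⟩
      · rw [ht, if_neg (by omega), if_neg (by omega), if_neg (by omega), if_neg (by omega)]; exact hb0
      · rw [ht, if_neg (by omega), if_neg (by omega), if_neg (by omega), if_neg (by omega)]; exact hb1 y hy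
      · refine StepB.pass .cross .horiz ?_ rfl ?_
        · simp only [R0, show ¬ j < β by omega, show j ≠ β by omega, show ¬ j+1 < β by omega,
            show j+1 ≠ β by omega, if_false, e2]
          rcases e1 with ⟨e1, -⟩ | ⟨e1, -⟩ <;> rw [e1] <;> rfl
        · intro y; simp only [R0, ht]
          by_cases c1 : y < β
          · simp only [c1, if_true, if_neg (show y ≠ j by omega), if_neg (show y ≠ j+1 by omega), if_neg (show y ≠ j' by omega), if_neg (show y ≠ j'+1 by omega)]
          by_cases c2 : y = β
          · subst c2; simp only [c1, if_false, if_true, if_neg (show y ≠ j by omega), if_neg (show y ≠ j+1 by omega)]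
          simp only [c1, c2, if_false]
          by_cases c3 : y = j
          · simp only [c3, if_true]; rcases e1 with ⟨-, rfl⟩ | ⟨-, rfl⟩ <;> rfl
          simp only [c3, if_false]
          by_cases c4 : y = j' + 1
          · simp only [c4, if_true, if_neg (show j'+1 ≠ j+1 by omega)]
            rcases srcT_cases h3 with ⟨e, rfl⟩ | ⟨e, rfl⟩ <;> rw [e] <;> rfl
          simp only [c4, if_false]
          by_cases c5 : y = j'
          · subst c5; simp only [if_true]
            by_cases c6 : y = j + 1
            · simp [c6, upR]
            · rw [if_neg c6, hbl y (by omega) le_rfl]; rfl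
          simp only [c5, if_false]
          by_cases c6 : y = j + 1
          · simp [c6, upR]
          · simp [c6]
      · refine StepB.jump t1 t3 ?_ hj ?_ ?_ ?_
        · simp only [R1, show β < j by omega, show β < j+1 by omega, if_true]; exact h
        · intro y h1 h2; simp only [R1, show β < y by omega, if_true]; exact hbl y h1 h2
        · simp only [R1, show β < j'+1 by omega, if_true]; exact h3
        · intro y; simp only [R1, ht]
          split_ifs <;> first | rfl | omega
    · by_cases hj2 : j' = j + 1
      · subst hj2
        refine ⟨β, j+1, ⟨?_, fun y hy => ?_⟩, ?_, ?_⟩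
        · rw [ht, if_neg (by omega), if_neg (by omega), if_neg (by omega), if_neg (by omega)]; exact hb0
        · rw [ht]; split_ifs <;> first | assumption | exact hb1 y hy | simp
        · refine StepB.jump t1 t3 ?_ le_rfl (fun y _ _ => by omega) ?_ ?_
          · simp only [R0, show j < β by omega, show j+1 < β by omega, if_true]; exact h
          · simp only [R0, show j+1+1 < β by omega, if_true]; exact h3
          · intro y; simp only [R0, ht]
            split_ifs <;> first | rfl | omega
        · refine StepB.pass .cross .horiz ?_ rfl ?_
          · simp only [R1, show ¬ β < j+1 by omega, show j+1 ≠ β by omega, show ¬ β < j+1+1 by omega,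
              show j+1+1 ≠ β by omega, if_false, e2]
            rcases srcT_cases h3 with ⟨e, -⟩ | ⟨e, -⟩ <;> rw [e] <;> rfl
          · intro y; simp only [R1, ht]
            by_cases c1 : β < y
            · simp only [c1, if_true, if_neg (show y ≠ j by omega), if_neg (show y ≠ j+1 by omega), if_neg (show y ≠ j+1+1 by omega)]
            by_cases c2 : y = β
            · subst c2; simp only [c1, if_false, if_true, if_neg (show y ≠ j+1+1 by omega), if_neg (show y ≠ j+1 by omega)]
            simp only [c1, c2, if_false]
            by_cases c3 : y = j
            · subst c3; simp only [if_true, if_neg (show y ≠ y+1 by omega), if_neg (show y ≠ y+1+1 by omega)]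
              rcases e1 with ⟨e, rfl⟩ | ⟨e, rfl⟩ <;> rw [e] <;> rfl
            by_cases c4 : y = j + 1 + 1
            · subst c4; simp [show j + 1 + 1 ≠ j by omega]
              rcases srcT_cases h3 with ⟨e, rfl⟩ | ⟨e, rfl⟩ <;> rfl
            by_cases c5 : y = j + 1
            · subst c5; simp; rfl
            simp only [c3, c4, c5, if_false]
      · have hb2 : τ (j+2) = .blank := hbl _ (by omega) (by omega)
        obtain rfl : β = j + 2 := by
          rcases lt_trichotomy β (j+2) with q | q | q
          · omega
          · exact q
          · exact absurd hb2 (hb1 _ q)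
        refine ⟨j+1, j+1, ⟨?_, fun y hy => ?_⟩, ?_, ?_⟩
        · rw [ht, if_neg (by omega), if_neg (by omega), if_neg (by omega), if_pos rfl]
        · rw [ht]; split_ifs <;> first | assumption | omega | exact hb1 y (by omega)
        · refine StepB.jump t1 .horiz ?_ le_rfl (fun y _ _ => by omega) ?_ ?_
          · simp only [R0, show j < j+2 by omega, show j+1 < j+2 by omega, if_true]; exact h
          · simp [R0, srcT]
          · intro y; simp only [R0, ht]
            by_cases c3 : y = j
            · subst c3; simp
            by_cases c4 : y = j + 1 + 1
            · subst c4; simp; split_ifs <;> first | omega | simp_all [upR]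
            by_cases c5 : y = j + 1
            · subst c5; simp
            simp only [c3, c4, c5, if_false, show y ≠ j+2 from c4]
            by_cases c6 : y < j + 1
            · simp only [c6, if_true, show y < j+2 by omega, if_neg (show y ≠ j' by omega), if_neg (show y ≠ j'+1 by omega)]
            simp only [c6, if_false, show ¬ y < j+2 by omega]
            by_cases c7 : y = j' + 1
            · subst c7; simp only [if_true]
              rcases srcT_cases h3 with ⟨e, rfl⟩ | ⟨e, rfl⟩ <;> rw [e] <;> rfl
            by_cases c8 : y = j'
            · subst c8; simp only [c7, if_false, if_true]; rw [hbl y (by omega) le_rfl]; rfl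
            simp only [c7, c8, if_false]
        · refine StepB.jump .nw t3 ?_ (by omega) ?_ ?_ ?_
          · simp [R1, e2, loR, halfT]
          · intro y h1 h2
            simp only [R1, show j+2 < y by omega, if_true]
            exact hbl y (by omega) h2
          · simp only [R1, show j+2 < j'+1 by omega, if_true]; exact h3
          · intro y; simp only [R1, ht]
            by_cases c3 : y = j
            · subst c3; simp only [show ¬ y + 1 < y by omega, show ¬ y + 2 < y by omega, if_false, if_true, show y ≠ y+1 by omega, show y ≠ y+2 by omega, show y ≠ j' by omega, show y ≠ j'+1 by omega, show y ≠ y+1+1 by omega]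
              rcases e1 with ⟨e, rfl⟩ | ⟨e, rfl⟩ <;> rw [e] <;> rfl
            by_cases c5 : y = j + 1
            · subst c5; simp
            by_cases c4 : y = j + 1 + 1
            · subst c4; simp [show j+1+1 ≠ j by omega]
              split_ifs <;> first | rfl | omega
            simp only [c3, c4, c5, if_false, show y ≠ j+2 from c4]
            by_cases c6 : y < j + 1
            · simp only [show ¬ j+1 < y by omega, show ¬ j + 2 < y by omega, if_false, if_neg (show y ≠ j' by omega), if_neg (show y ≠ j'+1 by omega)]
            simp only [show j+1 < y by omega, show j + 2 < y by omega, if_true]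

theorem RunB.decomp {τ J J' τ' β} (h : RunB τ J J' τ') (hb : FB β τ) :
    ∃ β' J1, FB β' τ' ∧ RunB (R0 β τ) J J1 (R0 β' τ') ∧ RunB (R1 β τ) J1 J' (R1 β' τ') := by
  induction h generalizing β with
  | nil => exact ⟨β, [], hb, .nil _, .nil _⟩
  | cons s r ih =>
    obtain ⟨b1, j1, f1, s1, s2⟩ := s.decomp hb
    obtain ⟨b2, J1, f2, r1, r2⟩ := ih f1
    exact ⟨b2, j1 :: J1, f2, .cons s1 r1, .cons s2 r2⟩

theorem R0_nb {β τ} (h : FB β τ) : NB (R0 β τ) := by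
  intro y; unfold R0; split_ifs <;> first | exact h.2 y (by assumption) | simp

theorem R01_inj {β1 τ1 β2 τ2} (h1 : FB β1 τ1) (h2 : FB β2 τ2) (e0 : R0 β1 τ1 = R0 β2 τ2)
    (e1 : R1 β1 τ1 = R1 β2 τ2) : τ1 = τ2 := by
  have key : ∀ {β1 τ1 β2 τ2}, R1 β1 τ1 = R1 β2 τ2 → ¬ β1 < β2 := by
    intro β1 τ1 β2 τ2 e hl
    have := congrFun e β1
    simp only [R1, lt_irrefl, if_false, if_true, show ¬ β2 < β1 by omega, show β1 ≠ β2 by omega] at this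
    split_ifs at this
  obtain rfl : β1 = β2 := by
    have := key e1
    have := key e1.symm
    omega
  funext y
  rcases lt_trichotomy y β1 with q | q | q
  · have := congrFun e0 y
    simpa only [R0, q, if_true] using this
  · rw [q, h1.1, h2.1]
  · have := congrFun e1 y
    simpa only [R1, q, if_true] using this

theorem exFB {τ : ℕ → Tile} (h : ¬ NB τ) : ∃ β, FB β τ := by
  classical
  have h' : ∃ y, τ y = .blank := by
    by_contra hc; exact h (fun y hy => hc ⟨y, hy⟩)
  exact ⟨Nat.find h', Nat.find_spec h', fun y hy => Nat.find_min h' hy⟩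

theorem R1_sub {β τ} {S : Finset ℕ} (hS : ∀ y, τ y = .blank → y ∈ S) :
    ∀ y, R1 β τ y = .blank → y ∈ S.erase β := by
  intro y hy
  unfold R1 at hy
  split_ifs at hy with h1
  exact Finset.mem_erase.2 ⟨by omega, hS y hy⟩

theorem ckRun (S : Finset ℕ) {τ p q r p' q' r' x y z x' y' z' τ1 τ2}
    (hS : ∀ y, τ y = .blank → y ∈ S) (h : CK3 p q r p' q' r')
    (r1 : RunB τ [p,q,r] [x,y,z] τ1) (r2 : RunB τ [p',q',r'] [x',y',z'] τ2) :
    CK3 x y z x' y' z' ∧ τ1 = τ2 := by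
  induction hn : S.card generalizing S τ p q r p' q' r' τ1 τ2 with
  | zero =>
    rw [Finset.card_eq_zero] at hn
    subst hn
    exact ckNB (fun y hy => by simpa using hS y hy) h r1 r2
  | succ m ih =>
    by_cases hnb : NB τ
    · exact ckNB hnb h r1 r2
    obtain ⟨β, hβ⟩ := exFB hnb
    obtain ⟨b1, J1, f1, A1, A2⟩ := r1.decomp hβ
    obtain ⟨b2, J2, f2, B1, B2⟩ := r2.decomp hβ
    have l1 := A1.length
    have l2 := B1.length
    rcases J1 with _ | ⟨u1, _ | ⟨v1, _ | ⟨w1, _ | _⟩⟩⟩ <;> simp at l1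
    rcases J2 with _ | ⟨u2, _ | ⟨v2, _ | ⟨w2, _ | _⟩⟩⟩ <;> simp at l2
    obtain ⟨c, e0⟩ := ckNB (R0_nb hβ) h A1 B1
    obtain ⟨c2, e1⟩ := ih (S.erase β) (R1_sub hS) c A2 B2
      (by rw [Finset.card_erase_of_mem (hS _ hβ.1)]; omega)
    exact ⟨c2, R01_inj f1 f2 e0 e1⟩

theorem descRun (S : Finset ℕ) {τ x y x' y' τ'} (hS : ∀ y, τ y = .blank → y ∈ S)
    (h : RunB τ [x, y] [x', y'] τ') :
    (x < y → x' < y') ∧ (y < x → y' < x') := by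
  induction hn : S.card generalizing S τ x y τ' with
  | zero =>
    rw [Finset.card_eq_zero] at hn
    subst hn
    exact descNB (fun y hy => by simpa using hS y hy) h
  | succ m ih =>
    by_cases hnb : NB τ
    · exact descNB hnb h
    obtain ⟨β, hβ⟩ := exFB hnb
    obtain ⟨b1, J1, f1, A1, A2⟩ := h.decomp hβ
    have l1 := A1.length
    rcases J1 with _ | ⟨u1, _ | ⟨v1, _ | _⟩⟩ <;> simp at l1
    have d1 := descNB (R0_nb hβ) A1
    have d2 := ih (S.erase β) (R1_sub hS) A2
      (by rw [Finset.card_erase_of_mem (hS _ hβ.1)]; omega)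
    exact ⟨fun h => d2.1 (d1.1 h), fun h => d2.2 (d1.2 h)⟩



/-! ### States, valid words, inversion statistics -/

/-- exchange the values at `j`, `j+1`. -/
def sw (j : ℕ) (s : ℕ → ℕ) (y : ℕ) : ℕ :=
  if y = j then s (j+1) else if y = j + 1 then s j else s y

def Valid (n : ℕ) : (ℕ → ℕ) → List ℕ → Prop
  | _, [] => True
  | s, j :: J => 1 ≤ j ∧ j + 1 ≤ n ∧ s (j+1) < s j ∧ Valid n (sw j s) J

def endS : (ℕ → ℕ) → List ℕ → (ℕ → ℕ)
  | s, [] => s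
  | s, j :: J => endS (sw j s) J

theorem valid_append {n s A B} : Valid n s (A ++ B) ↔ Valid n s A ∧ Valid n (endS s A) B := by
  induction A generalizing s with
  | nil => simp [Valid, endS]
  | cons a A ih => simp [Valid, endS, ih, and_assoc]

theorem endS_append {s A B} : endS s (A ++ B) = endS (endS s A) B := by
  induction A generalizing s with
  | nil => simp [endS]
  | cons a A ih => simp [endS, ih]

theorem sw_comm {a c s} (h : a + 2 ≤ c ∨ c + 2 ≤ a) : sw a (sw c s) = sw c (sw a s) := by
  funext y; unfold sw
  split_ifs <;> first | rfl | omega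

theorem sw_braid {a s} : sw a (sw (a+1) (sw a s)) = sw (a+1) (sw a (sw (a+1) s)) := by
  funext y; unfold sw
  split_ifs <;> first | rfl | omega | simp_all

theorem validCK {n s p q r p' q' r'} (h : CK3 p q r p' q' r') (hv : Valid n s [p,q,r]) :
    Valid n s [p',q',r'] ∧ endS s [p',q',r'] = endS s [p,q,r] := by
  have far : ∀ {s : ℕ → ℕ} {a c}, (a + 2 ≤ c ∨ c + 2 ≤ a) → (sw a s) c = s c ∧ (sw a s) (c+1) = s (c+1) := by
    intro s a c h; unfold sw
    constructor
    · rw [if_neg (by omega), if_neg (by omega)]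
    · rw [if_neg (by omega), if_neg (by omega)]
  simp only [Valid, and_true] at hv
  obtain ⟨p1, pn, dp, q1, qn, dq, r1, rn, dr⟩ := hv
  simp only [Valid, endS, and_true]
  have n1 : ∀ x : ℕ, x + 1 + 1 ≠ x := by intro x; omega
  have n2 : ∀ x : ℕ, x ≠ x + 1 + 1 := by intro x; omega
  rcases h with ⟨e0, h | h, e1, e2, e3⟩ | ⟨h, e1, e2, e3⟩ | ⟨h, e1, e2, e3⟩ <;> rw [e1, e2, e3] <;>
    clear e1 e2 e3
  · subst h e0
    refine ⟨⟨by omega, by omega, ?_, by omega, by omega, ?_, by omega, by omega, ?_⟩, sw_braid.symm⟩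
    all_goals simp [sw, n1, n2] at *
    all_goals omega
  · subst h e0
    refine ⟨⟨by omega, by omega, ?_, by omega, by omega, ?_, by omega, by omega, ?_⟩, sw_braid⟩
    all_goals simp [sw, n1, n2] at *
    all_goals omega
  · have hf : q + 2 ≤ r ∨ r + 2 ≤ q := by omega
    have f1 := far (s := sw p s) hf
    have f2 := far (s := sw p s) hf.symm
    exact ⟨⟨p1, pn, dp, r1, rn, by omega, q1, qn, by omega⟩, sw_comm hf⟩
  · have hf : p + 2 ≤ q ∨ q + 2 ≤ p := by omega
    have f1 := far (s := s) hf
    have f2 := far (s := s) hf.symm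
    exact ⟨⟨q1, qn, by omega, p1, pn, by omega, r1, rn, by rw [sw_comm hf]; exact dr⟩,
      by rw [sw_comm hf]⟩

theorem valid_ne {n s p q} (hv : Valid n s [p,q]) : p ≠ q := by
  rintro rfl
  simp [Valid, sw] at hv; omega

theorem ck_exists {n s p q r} (hv : Valid n s [p,q,r]) :
    (p < q ∧ q < r) ∨ (r < q ∧ q < p) ∨ ∃ p' q' r', CK3 p q r p' q' r' := by
  have h1 : p ≠ q := by
    refine valid_ne (n := n) (s := s) ?_
    have : [p,q,r] = [p,q] ++ [r] := rfl
    rw [this, valid_append] at hv; exact hv.1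
  have h2 : q ≠ r := by
    refine valid_ne (n := n) (s := sw p s) ?_
    exact hv.2.2.2
  by_cases h : p = r
  · subst h
    by_cases hq : q = p + 1 ∨ p = q + 1
    · exact Or.inr (Or.inr ⟨_, _, _, Or.inl ⟨rfl, hq, rfl, rfl, rfl⟩⟩)
    · exfalso
      simp only [Valid, and_true] at hv
      obtain ⟨_, _, dp, _, _, _, _, _, dr⟩ := hv
      unfold sw at dr
      simp only [if_neg (show p ≠ q by omega), if_neg (show p ≠ q+1 by omega),
        if_neg (show p+1 ≠ q by omega), if_neg (show p+1 ≠ q+1 by omega), if_true,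
        if_neg (show p+1 ≠ p by omega)] at dr
      omega
  · rcases lt_or_gt_of_ne h1 with a | a <;> rcases lt_or_gt_of_ne h2 with b | b
    · exact Or.inl ⟨a, b⟩
    · refine Or.inr (Or.inr ?_)
      rcases lt_or_gt_of_ne h with c | c
      · exact ⟨q, p, r, by unfold CK3; omega⟩
      · exact ⟨p, r, q, by unfold CK3; omega⟩
    · refine Or.inr (Or.inr ?_)
      rcases lt_or_gt_of_ne h with c | c
      · exact ⟨p, r, q, by unfold CK3; omega⟩
      · exact ⟨q, p, r, by unfold CK3; omega⟩
    · exact Or.inr (Or.inl ⟨b, a⟩)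

/-- One Coxeter–Knuth move on words. -/
def CKw (J K : List ℕ) : Prop := ∃ A B p q r p' q' r', CK3 p q r p' q' r' ∧
  J = A ++ [p,q,r] ++ B ∧ K = A ++ [p',q',r'] ++ B

theorem CKw.symm {J K} (h : CKw J K) : CKw K J := by
  obtain ⟨A, B, p, q, r, p', q', r', h, rfl, rfl⟩ := h
  exact ⟨A, B, _, _, _, _, _, _, h.symm, rfl, rfl⟩

theorem CKw.valid {n s J K} (h : CKw J K) (hv : Valid n s J) :
    Valid n s K ∧ endS s K = endS s J := by
  obtain ⟨A, B, p, q, r, p', q', r', h, rfl, rfl⟩ := h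
  rw [valid_append, valid_append] at hv
  have := validCK h hv.1.2
  rw [valid_append, valid_append, endS_append, endS_append, endS_append, endS_append, endS_append, this.2]
  refine ⟨⟨⟨hv.1.1, this.1⟩, ?_⟩, rfl⟩
  have h3 := hv.2
  rwa [endS_append] at h3

def CKE : List ℕ → List ℕ → Prop := Relation.ReflTransGen CKw

theorem CKE.valid {n s J K} (h : CKE J K) (hv : Valid n s J) :
    Valid n s K ∧ endS s K = endS s J := by
  induction h with
  | refl => exact ⟨hv, rfl⟩
  | tail _ h ih =>
    have := h.valid ih.1
    exact ⟨this.1, this.2.trans ih.2⟩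

theorem CKw.length {J K} (h : CKw J K) : K.length = J.length := by
  obtain ⟨A, B, p, q, r, p', q', r', h, rfl, rfl⟩ := h
  simp

theorem CKE.length {J K} (h : CKE J K) : K.length = J.length := by
  induction h with
  | refl => rfl
  | tail _ h ih => rw [h.length, ih]

theorem CKE.symm {J K} (h : CKE J K) : CKE K J := by
  induction h with
  | refl => exact .refl
  | tail _ h ih => exact .head h.symm ih

theorem CKE.trans {J K L} (h : CKE J K) (h2 : CKE K L) : CKE J L := Relation.ReflTransGen.trans h h2
theorem CKE.rfl' (J) : CKE J J := Relation.ReflTransGen.refl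

theorem CKE.ctx {J K} (A B) (h : CKE J K) : CKE (A ++ J ++ B) (A ++ K ++ B) := by
  induction h with
  | refl => exact .refl
  | tail _ h ih =>
    refine .tail ih ?_
    obtain ⟨A', B', p, q, r, p', q', r', h, rfl, rfl⟩ := h
    exact ⟨A ++ A', B' ++ B, p, q, r, p', q', r', h, by simp, by simp⟩

theorem CKE.left {J K} (A) (h : CKE J K) : CKE (A ++ J) (A ++ K) := by
  simpa using h.ctx A []
theorem CKE.right {J K} (B) (h : CKE J K) : CKE (J ++ B) (K ++ B) := by
  simpa using h.ctx [] B
theorem CKE.of3 {p q r p' q' r'} (h : CK3 p q r p' q' r') : CKE [p,q,r] [p',q',r'] :=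
  .single ⟨[], [], _, _, _, _, _, _, h, rfl, rfl⟩

/-! ### Inversion statistics -/

def cst (n : ℕ) (s : ℕ → ℕ) (y : ℕ) : ℕ :=
  ∑ z ∈ Finset.Icc 1 n, if z < y ∧ s y < s z then 1 else 0
def dst (n : ℕ) (s : ℕ → ℕ) (y : ℕ) : ℕ :=
  ∑ z ∈ Finset.Icc 1 n, if y < z ∧ s z < s y then 1 else 0

theorem sum_two {n j} (h1 : 1 ≤ j) (h2 : j + 1 ≤ n) (f : ℕ → ℕ) :
    ∑ z ∈ Finset.Icc 1 n, f z = (∑ z ∈ (Finset.Icc 1 n).filter (fun z => z ≠ j ∧ z ≠ j+1), f z)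
      + f j + f (j+1) := by
  rw [← Finset.sum_filter_add_sum_filter_not (Finset.Icc 1 n) (fun z => z ≠ j ∧ z ≠ j+1) f, add_assoc]
  congr 1
  have : (Finset.Icc 1 n).filter (fun z => ¬ (z ≠ j ∧ z ≠ j+1)) = {j, j+1} := by
    ext z; simp; omega
  rw [this, Finset.sum_pair (by omega)]

theorem sum_rest {n j} (f g : ℕ → ℕ) (h : ∀ z, z ≠ j → z ≠ j+1 → f z = g z) :
    ∑ z ∈ (Finset.Icc 1 n).filter (fun z => z ≠ j ∧ z ≠ j+1), f z =
    ∑ z ∈ (Finset.Icc 1 n).filter (fun z => z ≠ j ∧ z ≠ j+1), g z := by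
  apply Finset.sum_congr rfl
  intro z hz; simp at hz; exact h z hz.2.1 hz.2.2

theorem cst_sw {n s j} (h1 : 1 ≤ j) (h2 : j + 1 ≤ n) (hd : s (j+1) < s j) :
    cst n (sw j s) j + 1 = cst n s (j+1) ∧ cst n (sw j s) (j+1) = cst n s j ∧
    ∀ y, y ≠ j → y ≠ j+1 → cst n (sw j s) y = cst n s y := by
  refine ⟨?_, ?_, fun y hy hy' => ?_⟩
  all_goals unfold cst
  all_goals rw [sum_two h1 h2, sum_two h1 h2]
  · rw [sum_rest _ (fun z => if z < j + 1 ∧ s (j+1) < s z then 1 else 0)]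
    · simp [sw, hd]
    · intro z hz hz'; simp only [sw, if_neg hz, if_neg hz', if_true]
      congr 1; simp; omega
  · rw [sum_rest _ (fun z => if z < j ∧ s j < s z then 1 else 0)]
    · simp [sw]; omega
    · intro z hz hz'; simp only [sw, if_neg hz, if_neg hz', if_true, if_neg (show j+1 ≠ j by omega)]
      congr 1; simp; omega
  · rw [sum_rest _ (fun z => if z < y ∧ s y < s z then 1 else 0)]
    · simp [sw, hy, hy']
      have : (j < y ↔ j + 1 < y) := by omega
      simp only [this]; omega
    · intro z hz hz'; simp only [sw, if_neg hz, if_neg hz', if_neg hy, if_neg hy']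

theorem dst_sw {n s j} (h1 : 1 ≤ j) (h2 : j + 1 ≤ n) (hd : s (j+1) < s j) :
    dst n (sw j s) (j+1) + 1 = dst n s j ∧ dst n (sw j s) j = dst n s (j+1) ∧
    ∀ y, y ≠ j → y ≠ j+1 → dst n (sw j s) y = dst n s y := by
  refine ⟨?_, ?_, fun y hy hy' => ?_⟩
  all_goals unfold dst
  all_goals rw [sum_two h1 h2, sum_two h1 h2]
  · rw [sum_rest _ (fun z => if j < z ∧ s z < s j then 1 else 0)]
    · simp [sw, hd]
    · intro z hz hz'; simp only [sw, if_neg hz, if_neg hz', if_true, if_neg (show j+1 ≠ j by omega)]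
      congr 1; simp; omega
  · rw [sum_rest _ (fun z => if j + 1 < z ∧ s z < s (j+1) then 1 else 0)]
    · simp [sw]; omega
    · intro z hz hz'; simp only [sw, if_neg hz, if_neg hz', if_true]
      congr 1; simp; omega
  · rw [sum_rest _ (fun z => if y < z ∧ s z < s y then 1 else 0)]
    · simp [sw, hy, hy']
      have : (y ≤ j ↔ y < j) := by omega
      have h5 : (y < j + 1 ↔ y < j) := by omega
      simp only [this, h5]; omega
    · intro z hz hz'; simp only [sw, if_neg hz, if_neg hz', if_neg hy, if_neg hy']

def PhiC (n i : ℕ) (s : ℕ → ℕ) : ℕ := ∑ y ∈ Finset.Icc 1 n, min i (cst n s y)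
def PhiD (n i : ℕ) (s : ℕ → ℕ) : ℕ := ∑ y ∈ Finset.Icc 1 n, min i (dst n s y)
def PsiC (n i m : ℕ) (s : ℕ → ℕ) : ℕ :=
  ∑ y ∈ Finset.Icc 1 n, min (if y ≤ m then i else i + 1) (cst n s y)
def PsiD (n i m : ℕ) (s : ℕ → ℕ) : ℕ :=
  ∑ y ∈ Finset.Icc 1 n, min (if m ≤ y then i else i + 1) (dst n s y)

theorem PsiC_step {n i m s j} (h1 : 1 ≤ j) (h2 : j + 1 ≤ n) (hd : s (j+1) < s j) (hm : m ≤ j) :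
    PsiC n i (j+1) (sw j s) + 1 ≤ PsiC n i m s := by
  obtain ⟨a, b, c⟩ := cst_sw h1 h2 hd
  unfold PsiC
  rw [sum_two h1 h2, sum_two h1 h2]
  have hr : ∑ z ∈ (Finset.Icc 1 n).filter (fun z => z ≠ j ∧ z ≠ j+1),
      min (if z ≤ j+1 then i else i + 1) (cst n (sw j s) z) ≤
      ∑ z ∈ (Finset.Icc 1 n).filter (fun z => z ≠ j ∧ z ≠ j+1),
      min (if z ≤ m then i else i + 1) (cst n s z) := by
    apply Finset.sum_le_sum
    intro z hz; simp at hz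
    rw [c z hz.2.1 hz.2.2]
    split_ifs <;> omega
  rw [b, ← a]
  simp only [if_pos (show j ≤ j+1 by omega), if_neg (show ¬ j+1 ≤ m by omega), le_refl, if_true]
  split_ifs <;> omega

theorem PsiD_step {n i m s j} (h1 : 1 ≤ j) (h2 : j + 1 ≤ n) (hd : s (j+1) < s j) (hm : j + 1 ≤ m) :
    PsiD n i j (sw j s) + 1 ≤ PsiD n i m s := by
  obtain ⟨a, b, c⟩ := dst_sw h1 h2 hd
  unfold PsiD
  rw [sum_two h1 h2, sum_two h1 h2]
  have hr : ∑ z ∈ (Finset.Icc 1 n).filter (fun z => z ≠ j ∧ z ≠ j+1),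
      min (if j ≤ z then i else i + 1) (dst n (sw j s) z) ≤
      ∑ z ∈ (Finset.Icc 1 n).filter (fun z => z ≠ j ∧ z ≠ j+1),
      min (if m ≤ z then i else i + 1) (dst n s z) := by
    apply Finset.sum_le_sum
    intro z hz; simp at hz
    rw [c z hz.2.1 hz.2.2]
    split_ifs <;> omega
  rw [b, ← a]
  simp only [if_pos (show j ≤ j+1 by omega), if_neg (show ¬ m ≤ j by omega), le_refl, if_true]
  split_ifs <;> omega

theorem PhiC_step {n i s j} (h1 : 1 ≤ j) (h2 : j + 1 ≤ n) (hd : s (j+1) < s j) :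
    PhiC n i (sw j s) ≤ PhiC n i s := by
  obtain ⟨a, b, c⟩ := cst_sw h1 h2 hd
  unfold PhiC
  rw [sum_two h1 h2, sum_two h1 h2, sum_rest _ (fun z => min i (cst n s z))]
  · rw [b, ← a]; omega
  · intro z h h'; simp only [c z h h']

theorem PhiD_step {n i s j} (h1 : 1 ≤ j) (h2 : j + 1 ≤ n) (hd : s (j+1) < s j) :
    PhiD n i (sw j s) ≤ PhiD n i s := by
  obtain ⟨a, b, c⟩ := dst_sw h1 h2 hd
  unfold PhiD
  rw [sum_two h1 h2, sum_two h1 h2, sum_rest _ (fun z => min i (dst n s z))]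
  · rw [b, ← a]; omega
  · intro z h h'; simp only [c z h h']

theorem PhiC_mono {n i s J} (hv : Valid n s J) : PhiC n i (endS s J) ≤ PhiC n i s := by
  induction J generalizing s with
  | nil => exact le_rfl
  | cons j J ih =>
    obtain ⟨a, b, c, d⟩ := hv
    exact (ih d).trans (PhiC_step a b c)

theorem PhiD_mono {n i s J} (hv : Valid n s J) : PhiD n i (endS s J) ≤ PhiD n i s := by
  induction J generalizing s with
  | nil => exact le_rfl
  | cons j J ih =>
    obtain ⟨a, b, c, d⟩ := hv
    exact (ih d).trans (PhiD_step a b c)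

theorem PsiC_run {n i m s J} (hv : Valid n s J) (hJ : J.Pairwise (· < ·)) (hm : ∀ j ∈ J, m ≤ j) :
    ∃ m', PsiC n i m' (endS s J) + J.length ≤ PsiC n i m s := by
  induction J generalizing s m with
  | nil => exact ⟨m, le_rfl⟩
  | cons j J ih =>
    obtain ⟨a, b, c, d⟩ := hv
    rw [List.pairwise_cons] at hJ
    obtain ⟨m', h⟩ := ih (m := j+1) d hJ.2 (fun k hk => hJ.1 k hk)
    have := PsiC_step (i := i) a b c (hm j (by simp))
    exact ⟨m', by simp [endS]; omega⟩

theorem PsiD_run {n i m s J} (hv : Valid n s J) (hJ : J.Pairwise (· > ·)) (hm : ∀ j ∈ J, j + 1 ≤ m) :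
    ∃ m', PsiD n i m' (endS s J) + J.length ≤ PsiD n i m s := by
  induction J generalizing s m with
  | nil => exact ⟨m, le_rfl⟩
  | cons j J ih =>
    obtain ⟨a, b, c, d⟩ := hv
    rw [List.pairwise_cons] at hJ
    obtain ⟨m', h⟩ := ih (m := j) d hJ.2 (fun k hk => hJ.1 k hk)
    have := PsiD_step (i := i) a b c (hm j (by simp))
    exact ⟨m', by simp [endS]; omega⟩

theorem PhiC_run {n i s J} (hv : Valid n s J) (hJ : J.Pairwise (· < ·)) :
    PhiC n i (endS s J) + J.length ≤ PhiC n (i+1) s := by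
  obtain ⟨m', h⟩ := PsiC_run (i := i) (m := 0) hv hJ (by simp)
  have h1 : PsiC n i 0 s ≤ PhiC n (i+1) s := by
    apply Finset.sum_le_sum; intro y _; split_ifs <;> omega
  have h2 : PhiC n i (endS s J) ≤ PsiC n i m' (endS s J) := by
    apply Finset.sum_le_sum; intro y _; split_ifs <;> omega
  omega

theorem PhiD_run {n i s J} (hv : Valid n s J) (hJ : J.Pairwise (· > ·)) :
    PhiD n i (endS s J) + J.length ≤ PhiD n (i+1) s := by
  obtain ⟨m', h⟩ := PsiD_run (i := i) (m := n+1) hv hJ (by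
    intro j hj
    clear hJ
    induction J generalizing s with
    | nil => simp at hj
    | cons k J ih =>
      obtain ⟨a, b, c, d⟩ := hv
      simp at hj
      rcases hj with rfl | hj
      · omega
      · exact ih d hj)
  have h1 : PsiD n i (n+1) s ≤ PhiD n (i+1) s := by
    apply Finset.sum_le_sum; intro y _; split_ifs <;> omega
  have h2 : PhiD n i (endS s J) ≤ PsiD n i m' (endS s J) := by
    apply Finset.sum_le_sum; intro y _; split_ifs <;> omega
  omega

/-- `J` is a concatenation of `i` words each satisfying a pairwise relation. -/
def Runs (R : ℕ → ℕ → Prop) (Ls : List (List ℕ)) : Prop := ∀ l ∈ Ls, l.Pairwise R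

theorem PhiC_runs {n s} {Ls : List (List ℕ)} (hv : Valid n s Ls.flatten) (h : Runs (· < ·) Ls) :
    Ls.flatten.length ≤ PhiC n Ls.length s := by
  induction Ls generalizing s with
  | nil => simp
  | cons l Ls ih =>
    simp only [List.flatten_cons, valid_append] at hv
    have := ih hv.2 (fun l hl => h l (by simp [hl]))
    have := PhiC_run (i := Ls.length) hv.1 (h l (by simp))
    simp only [List.flatten_cons, List.length_append, List.length_cons]
    omega

theorem PhiD_runs {n s} {Ls : List (List ℕ)} (hv : Valid n s Ls.flatten) (h : Runs (· > ·) Ls) :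
    Ls.flatten.length ≤ PhiD n Ls.length s := by
  induction Ls generalizing s with
  | nil => simp
  | cons l Ls ih =>
    simp only [List.flatten_cons, valid_append] at hv
    have := ih hv.2 (fun l hl => h l (by simp [hl]))
    have := PhiD_run (i := Ls.length) hv.1 (h l (by simp))
    simp only [List.flatten_cons, List.length_append, List.length_cons]
    omega

theorem cst_total {n s J} (hv : Valid n s J) :
    ∑ y ∈ Finset.Icc 1 n, cst n s y = ∑ y ∈ Finset.Icc 1 n, cst n (endS s J) y + J.length := by
  induction J generalizing s with
  | nil => simp [endS]
  | cons j J ih =>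
    obtain ⟨h1, h2, c, d⟩ := hv
    simp only [endS, List.length_cons]
    rw [← add_assoc, ← ih d, sum_two h1 h2, sum_two h1 h2]
    obtain ⟨a, b, c⟩ := cst_sw h1 h2 c
    rw [sum_rest (fun z => cst n s z) (fun z => cst n (sw j s) z) (fun z h h' => (c z h h').symm)]
    omega



/-! ### Flows through several rows -/

inductive Flow : List (ℕ → Tile) → List ℕ → List ℕ → Prop
  | nil (J) : Flow [] J J
  | cons {τ rows J J1 K τe} : RunB τ J J1 τe → Flow rows J1 K → Flow (τ :: rows) J K

def FinB (τ : ℕ → Tile) : Prop := ∃ S : Finset ℕ, ∀ y, τ y = .blank → y ∈ S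

theorem StepB.finB {τ j j' τ'} (h : StepB τ j j' τ') (hf : FinB τ) : FinB τ' := by
  obtain ⟨S, hS⟩ := hf
  refine ⟨insert j (insert (j+1) (insert j' (insert (j'+1) S))), fun y hy => ?_⟩
  by_cases h1 : y = j ∨ y = j + 1 ∨ y = j' ∨ y = j' + 1
  · simp; tauto
  · push Not at h1
    have : τ y = .blank := by
      cases h with
      | pass a b h hj ht =>
        rw [ht, if_neg h1.1, if_neg h1.2.1] at hy; exact hy
      | jump a b h hj hb h3 ht =>
        rw [ht, if_neg h1.1, if_neg h1.2.2.2, if_neg h1.2.2.1, if_neg h1.2.1] at hy; exact hy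
    simp [hS y this]

theorem RunB.finB {τ J J' τ'} (h : RunB τ J J' τ') (hf : FinB τ) : FinB τ' := by
  induction h with
  | nil => exact hf
  | cons s r ih => exact ih (s.finB hf)

/-- strictness of consecutive letters is transported. -/
def SD (J K : List ℕ) : Prop := K.length = J.length ∧ ∀ i, i + 1 < J.length →
  (J.getD i 0 < J.getD (i+1) 0 → K.getD i 0 < K.getD (i+1) 0) ∧
  (J.getD (i+1) 0 < J.getD i 0 → K.getD (i+1) 0 < K.getD i 0)

theorem list_split2 {J : List ℕ} {i} (h : i + 1 < J.length) :
    ∃ A x y B, J = A ++ ([x, y] ++ B) ∧ A.length = i ∧ J.getD i 0 = x ∧ J.getD (i+1) 0 = y := by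
  refine ⟨J.take i, J[i], J[i+1], J.drop (i+2), ?_, by simp; omega, ?_, ?_⟩
  · conv_lhs => rw [← List.take_append_drop i J, List.drop_eq_getElem_cons (by omega),
      List.drop_eq_getElem_cons h]
    simp
  · rw [List.getD_eq_getElem _ _ (by omega)]
  · rw [List.getD_eq_getElem _ _ h]

theorem list_split3 {J : List ℕ} {i} (h : i + 2 < J.length) :
    ∃ A x y z B, J = A ++ [x, y, z] ++ B ∧ A.length = i := by
  refine ⟨J.take i, J[i], J[i+1], J[i+2], J.drop (i+3), ?_, by simp; omega⟩
  conv_lhs => rw [← List.take_append_drop i J, List.drop_eq_getElem_cons (by omega),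
      List.drop_eq_getElem_cons (by omega), List.drop_eq_getElem_cons h]
  simp

theorem getD_mid {A B : List ℕ} {x y i} (h : A.length = i) :
    (A ++ ([x, y] ++ B)).getD i 0 = x ∧ (A ++ ([x, y] ++ B)).getD (i+1) 0 = y := by
  subst h
  constructor
  · simp
  · rw [List.getD_append_right _ _ _ _ (by omega)]; simp

theorem RunB.sd {τ J K τe} (h : RunB τ J K τe) (hf : FinB τ) : SD J K := by
  refine ⟨h.length, fun i hi => ?_⟩
  obtain ⟨A, x, y, B, rfl, hA, e1, e2⟩ := list_split2 hi
  obtain ⟨A', K1, τ1, rfl, hA', h1⟩ := h.split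
  obtain ⟨L, B', τ2, rfl, hL, h2⟩ := h1.split
  have l1 := hL.length
  rcases L with _ | ⟨u1, _ | ⟨v1, _ | _⟩⟩ <;> simp at l1
  obtain ⟨S, hS⟩ := hA'.finB hf
  have := descRun S hS hL
  obtain ⟨f1, f2⟩ := getD_mid (A := A') (x := u1) (y := v1) (B := B') (i := i) (by rw [hA'.length, hA])
  rw [e1, e2, f1, f2]
  exact this

theorem SD.trans {J K L} (h1 : SD J K) (h2 : SD K L) : SD J L := by
  refine ⟨h2.1.trans h1.1, fun i hi => ?_⟩
  have a := h1.2 i hi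
  have b := h2.2 i (by rw [h1.1]; exact hi)
  exact ⟨fun h => b.1 (a.1 h), fun h => b.2 (a.2 h)⟩

theorem Flow.sd {rows J K} (h : Flow rows J K) (hf : ∀ τ ∈ rows, FinB τ) : SD J K := by
  induction h with
  | nil => exact ⟨rfl, fun i _ => ⟨id, id⟩⟩
  | cons r f ih =>
    exact (r.sd (hf _ (by simp))).trans (ih (fun τ hτ => hf τ (by simp [hτ])))

theorem Flow.det {rows J K K2} (h : Flow rows J K) (h2 : Flow rows J K2) : K = K2 := by
  induction h with
  | nil => cases h2; rfl
  | cons r f ih =>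
    cases h2 with
    | cons r' f' =>
      obtain ⟨rfl, -⟩ := r.det r'
      exact ih f'

theorem RunB.ck {τ A p q r B p' q' r' K K2 τe τe2} (hf : FinB τ) (hc : CK3 p q r p' q' r')
    (h1 : RunB τ (A ++ [p,q,r] ++ B) K τe) (h2 : RunB τ (A ++ [p',q',r'] ++ B) K2 τe2) :
    ∃ A' x y z x' y' z' B', A'.length = A.length ∧ CK3 x y z x' y' z' ∧
      K = A' ++ [x,y,z] ++ B' ∧ K2 = A' ++ [x',y',z'] ++ B' := by
  obtain ⟨X, B1, t1, rfl, a1, b1⟩ := h1.split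
  obtain ⟨A1, L1, u1, rfl, d1, c1⟩ := a1.split
  obtain ⟨X, B2, t2, rfl, a2, b2⟩ := h2.split
  obtain ⟨A2, L2, u2, rfl, d2, c2⟩ := a2.split
  obtain ⟨rfl, rfl⟩ := d1.det d2
  have l1 := c1.length
  have l2 := c2.length
  rcases L1 with _ | ⟨x1, _ | ⟨v1, _ | ⟨w1, _ | _⟩⟩⟩ <;> simp at l1
  rcases L2 with _ | ⟨x2, _ | ⟨v2, _ | ⟨w2, _ | _⟩⟩⟩ <;> simp at l2
  obtain ⟨S, hS⟩ := d1.finB hf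
  obtain ⟨hc', rfl⟩ := ckRun S hS hc c1 c2
  obtain ⟨rfl, -⟩ := b1.det b2
  exact ⟨A1, _, _, _, _, _, _, B1, d1.length, hc', rfl, rfl⟩

theorem Flow.ck {rows J J2 A p q r B p' q' r' K K2} (hf : ∀ τ ∈ rows, FinB τ) (hc : CK3 p q r p' q' r')
    (h1 : Flow rows J K) (h2 : Flow rows J2 K2) (e1 : J = A ++ [p,q,r] ++ B)
    (e2 : J2 = A ++ [p',q',r'] ++ B) :
    ∃ A' x y z x' y' z' B', A'.length = A.length ∧ CK3 x y z x' y' z' ∧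
      K = A' ++ [x,y,z] ++ B' ∧ K2 = A' ++ [x',y',z'] ++ B' := by
  induction h1 generalizing A p q r B p' q' r' J2 with
  | nil => cases h2; exact ⟨A, p, q, r, p', q', r', B, rfl, hc, e1, e2⟩
  | cons r f ih =>
    subst e1 e2
    cases h2 with
    | cons r' f' =>
      obtain ⟨A', x, y, z, x', y', z', B', hl, hc', rfl, rfl⟩ := RunB.ck (hf _ (by simp)) hc r r'
      obtain ⟨A2, x, y, z, x', y', z', B', hl2, rest⟩ :=
        ih (fun τ hτ => hf τ (by simp [hτ])) hc' f' rfl rfl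
      exact ⟨A2, x, y, z, x', y', z', B', by omega, rest⟩

theorem pullCK {n s rows J K K2} (hf : ∀ τ ∈ rows, FinB τ)
    (hex : ∀ J, Valid n s J → ∃ K, Flow rows J K) (hv : Valid n s J) (h : Flow rows J K)
    (hc : CKw K K2) : ∃ J2, CKw J J2 ∧ Flow rows J2 K2 := by
  obtain ⟨A, B, p, q, r, p', q', r', hc, rfl, rfl⟩ := hc
  have sd := h.sd hf
  have hl := sd.1
  simp at hl
  obtain ⟨A1, x, y, z, B1, rfl, hA⟩ := list_split3 (J := J) (i := A.length) (by omega)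
  have hv3 : Valid n (endS s A1) [x,y,z] := by
    rw [valid_append, valid_append] at hv; exact hv.1.2
  have d1 := sd.2 A.length (by simp; omega)
  have d2 := sd.2 (A.length+1) (by simp; omega)
  have g1 := getD_mid (A := A1) (x := x) (y := y) (B := z :: B1) hA
  have g2 := getD_mid (A := A1 ++ [x]) (x := y) (y := z) (B := B1) (i := A.length + 1) (by simp [hA])
  have g3 := getD_mid (A := A) (x := p) (y := q) (B := r :: B) rfl
  have g4 := getD_mid (A := A ++ [p]) (x := q) (y := r) (B := B) (i := A.length + 1) (by simp)
  simp only [List.append_assoc, List.cons_append, List.nil_append] at d1 d2 g1 g2 g3 g4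
  rw [g1.1, g1.2, g3.1, g3.2] at d1
  rw [g2.1, g2.2, g4.1, g4.2] at d2
  have hex3 : ∃ x' y' z', CK3 x y z x' y' z' := by
    rcases ck_exists hv3 with h | h | h
    · exfalso; have := d1.1 h.1; have := d2.1 h.2; unfold CK3 at hc; omega
    · exfalso; have := d1.2 h.2; have := d2.2 h.1; unfold CK3 at hc; omega
    · exact h
  obtain ⟨x', y', z', hx⟩ := hex3
  have hck : CKw (A1 ++ [x,y,z] ++ B1) (A1 ++ [x',y',z'] ++ B1) :=
    ⟨A1, B1, _, _, _, _, _, _, hx, rfl, rfl⟩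
  obtain ⟨K2, hK2⟩ := hex _ (hck.valid hv).1
  refine ⟨_, hck, ?_⟩
  obtain ⟨A2, u, v, w, u', v', w', B2, hl2, hc2, e1, rfl⟩ := Flow.ck hf hx h hK2 rfl rfl
  rw [List.append_assoc, List.append_assoc] at e1
  obtain ⟨rfl, e1⟩ := List.append_inj e1 (by omega)
  simp at e1
  obtain ⟨rfl, rfl, rfl, rfl⟩ := e1
  obtain ⟨rfl, rfl, rfl⟩ := hc.det hc2
  exact hK2

theorem pullCKE {n s rows J K K2} (hf : ∀ τ ∈ rows, FinB τ)
    (hex : ∀ J, Valid n s J → ∃ K, Flow rows J K) (hv : Valid n s J) (h : Flow rows J K)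
    (hc : CKE K K2) : ∃ J2, Valid n s J2 ∧ Flow rows J2 K2 := by
  induction hc with
  | refl => exact ⟨J, hv, h⟩
  | tail _ hc ih =>
    obtain ⟨J1, v1, f1⟩ := ih
    obtain ⟨J2, c2, f2⟩ := pullCK hf hex v1 f1 hc
    exact ⟨J2, (c2.valid v1).1, f2⟩

/-- reversed transport -/
theorem SD.rev {n s J K} (h : SD J K) (hv : Valid n s J) : SD K J := by
  refine ⟨h.1.symm, fun i hi => ?_⟩
  rw [h.1] at hi
  have hne : J.getD i 0 ≠ J.getD (i+1) 0 := by
    obtain ⟨A, x, y, B, rfl, hA, e1, e2⟩ := list_split2 hi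
    rw [e1, e2]
    rw [valid_append, valid_append] at hv
    exact valid_ne hv.2.1
  have := h.2 i hi
  constructor
  · intro h'; rcases lt_or_gt_of_ne hne with q | q
    · exact q
    · have := this.2 q; omega
  · intro h'; rcases lt_or_gt_of_ne hne with q | q
    · have := this.1 q; omega
    · exact q

theorem SD.split {K1 K2 J} (h : SD (K1 ++ K2) J) :
    ∃ J1 J2, J = J1 ++ J2 ∧ SD K1 J1 ∧ SD K2 J2 := by
  have hl := h.1
  simp at hl
  refine ⟨J.take K1.length, J.drop K1.length, by simp, ⟨by simp; omega, fun i hi => ?_⟩,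
    ⟨by simp; omega, fun i hi => ?_⟩⟩
  · have := h.2 i (by simp; omega)
    rw [List.getD_append _ _ _ _ (by omega), List.getD_append _ _ _ _ (by omega)] at this
    have e : ∀ k, k < K1.length → (J.take K1.length).getD k 0 = J.getD k 0 := by
      intro k hk; simp [List.getD_eq_getElem?_getD, List.getElem?_take, hk]
    rw [e _ (by omega), e _ (by omega)]; exact this
  · have := h.2 (K1.length + i) (by simp; omega)
    rw [List.getD_append_right _ _ _ _ (by omega), List.getD_append_right _ _ _ _ (by omega)] at this
    simp only [Nat.add_sub_cancel_left, add_assoc] at this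
    simp only [List.getD_eq_getElem?_getD, List.getElem?_drop] at *
    exact this

theorem SD.pw_lt {K J} (h : SD K J) (hp : K.Pairwise (· < ·)) : J.Pairwise (· < ·) := by
  rw [← List.isChain_iff_pairwise] at *
  rw [List.isChain_iff_getElem] at *
  intro i hi
  have hl := h.1
  have := (h.2 i (by omega)).1
  rw [List.getD_eq_getElem _ _ (by omega), List.getD_eq_getElem _ _ (by omega),
    List.getD_eq_getElem _ _ (by omega), List.getD_eq_getElem _ _ (by omega)] at this
  exact this (hp i (by omega))

theorem SD.pw_gt {K J} (h : SD K J) (hp : K.Pairwise (· > ·)) : J.Pairwise (· > ·) := by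
  rw [← List.isChain_iff_pairwise] at *
  rw [List.isChain_iff_getElem] at *
  intro i hi
  have hl := h.1
  have := (h.2 i (by omega)).2
  rw [List.getD_eq_getElem _ _ (by omega), List.getD_eq_getElem _ _ (by omega),
    List.getD_eq_getElem _ _ (by omega), List.getD_eq_getElem _ _ (by omega)] at this
  exact this (hp i (by omega))

theorem SD.runs {Ls J} {R : ℕ → ℕ → Prop}
    (hR : ∀ {K J}, SD K J → K.Pairwise R → J.Pairwise R) (h : SD (List.flatten Ls) J)
    (hp : Runs R Ls) : ∃ Ls', J = List.flatten Ls' ∧ Ls'.length = Ls.length ∧ Runs R Ls' := by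
  induction Ls generalizing J with
  | nil =>
    have := h.1; simp at this
    exact ⟨[], by simp [this], rfl, by simp [Runs]⟩
  | cons l Ls ih =>
    rw [List.flatten_cons] at h
    obtain ⟨J1, J2, rfl, h1, h2⟩ := h.split
    obtain ⟨Ls', rfl, e, r⟩ := ih h2 (fun l hl => hp l (by simp [hl]))
    refine ⟨J1 :: Ls', by simp, by simp [e], ?_⟩
    intro l' hl'
    simp at hl'
    rcases hl' with rfl | hl'
    · exact hR h1 (hp l (by simp))
    · exact r l' hl'

theorem boundC {n s rows J K X Ls} (hf : ∀ τ ∈ rows, FinB τ)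
    (hex : ∀ J, Valid n s J → ∃ K, Flow rows J K) (hv : Valid n s J) (h : Flow rows J K)
    (hc : CKE K (X ++ List.flatten Ls)) (hr : Runs (· < ·) Ls) :
    Ls.flatten.length ≤ PhiC n Ls.length s := by
  obtain ⟨J2, v2, f2⟩ := pullCKE hf hex hv h hc
  obtain ⟨J3, J4, rfl, h3, h4⟩ := ((f2.sd hf).rev v2).split
  obtain ⟨Ls', rfl, e, r⟩ := h4.runs (fun h => h.pw_lt) hr
  rw [valid_append] at v2
  have := PhiC_runs v2.2 r
  rw [h4.1, e] at this
  exact this.trans (PhiC_mono v2.1)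

theorem boundD {n s rows J K X Ls} (hf : ∀ τ ∈ rows, FinB τ)
    (hex : ∀ J, Valid n s J → ∃ K, Flow rows J K) (hv : Valid n s J) (h : Flow rows J K)
    (hc : CKE K (List.flatten Ls ++ X)) (hr : Runs (· > ·) Ls) :
    Ls.flatten.length ≤ PhiD n Ls.length s := by
  obtain ⟨J2, v2, f2⟩ := pullCKE hf hex hv h hc
  obtain ⟨J3, J4, rfl, h3, h4⟩ := ((f2.sd hf).rev v2).split
  obtain ⟨Ls', rfl, e, r⟩ := h3.runs (fun h => h.pw_gt) hr
  rw [valid_append] at v2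
  have := PhiD_runs v2.1 r
  rw [h3.1, e] at this
  exact this

/-! ### The vexillary inequality -/

def colN (n : ℕ) (s : ℕ → ℕ) (C : ℕ) : ℕ := ((Finset.Icc 1 n).filter (fun y => C ≤ cst n s y)).card
def cocolN (n : ℕ) (s : ℕ → ℕ) (R : ℕ) : ℕ := ((Finset.Icc 1 n).filter (fun y => R ≤ dst n s y)).card

def Bad (n : ℕ) (s : ℕ → ℕ) : Prop := ∃ a b c d, 1 ≤ a ∧ a < b ∧ b < c ∧ c < d ∧ d ≤ n ∧
  s b < s a ∧ s a < s d ∧ s d < s c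

theorem cst_card {n s y} : cst n s y = ((Finset.Icc 1 n).filter (fun z => z < y ∧ s y < s z)).card := by
  unfold cst; rw [Finset.card_filter]
theorem dst_card {n s y} : dst n s y = ((Finset.Icc 1 n).filter (fun z => y < z ∧ s z < s y)).card := by
  unfold dst; rw [Finset.card_filter]

theorem vex_col {n s M R C} (hM : ∀ y, 1 ≤ y → y ≤ n → s y ≤ M)
    (hinj : ∀ y z, 1 ≤ y → y ≤ n → 1 ≤ z → z ≤ n → y ≠ z → s y = s z → s y = M)
    (hb : ¬ Bad n s) (hC : 1 ≤ C) (h : C ≤ cocolN n s R) : R ≤ colN n s C := by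
  classical
  set S := (Finset.Icc 1 n).filter (fun y => R ≤ dst n s y) with hS
  have hne : S.Nonempty := by
    rw [← Finset.card_pos]; change C ≤ S.card at h; omega
  obtain ⟨a, haS, ha⟩ := Finset.exists_min_image S s hne
  set i := S.max' hne with hi
  have hiS : i ∈ S := Finset.max'_mem S hne
  have himax : ∀ y ∈ S, y ≤ i := fun y hy => Finset.le_max' S y hy
  have ha' := haS
  have hi' := hiS
  rw [hS, Finset.mem_filter, Finset.mem_Icc] at ha' hi'
  set Y := (Finset.Icc 1 n).filter (fun z => i < z ∧ s z < s a) with hY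
  have hYR : R ≤ Y.card := by
    rw [dst_card] at ha' hi'
    by_cases hai : s a = s i
    · rw [hY, hai]; exact hi'.2
    have hlt : s a < s i := lt_of_le_of_ne (ha i hiS) hai
    have hani : a ≠ i := by rintro e; rw [e] at hai; exact hai rfl
    have hal : a < i := lt_of_le_of_ne (himax a haS) hani
    by_cases hw : ∃ w, 1 ≤ w ∧ w ≤ n ∧ a < w ∧ s w < s a ∧ w ≤ i
    · obtain ⟨w, w1, wn, aw, sw, wi⟩ := hw
      have wi' : w < i := lt_of_le_of_ne wi (by rintro rfl; omega)
      refine hi'.2.trans (Finset.card_le_card ?_)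
      intro z hz
      simp only [Finset.mem_filter, Finset.mem_Icc, hY] at *
      refine ⟨hz.1, hz.2.1, ?_⟩
      by_contra hc
      have : s a ≠ s z := by
        intro e
        have := hinj a z (by omega) (by omega) (by omega) (by omega) (by omega) e
        have := hM i (by omega) (by omega)
        omega
      exact hb ⟨a, w, i, z, by omega, aw, wi', hz.2.1, by omega, sw, by omega, hz.2.2⟩
    · push Not at hw
      refine ha'.2.trans (Finset.card_le_card ?_)
      intro z hz
      simp only [Finset.mem_filter, Finset.mem_Icc, hY] at *
      exact ⟨hz.1, hw z hz.1.1 hz.1.2 hz.2.1 hz.2.2, hz.2.2⟩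
  refine hYR.trans (Finset.card_le_card ?_)
  intro z hz
  simp only [Finset.mem_filter, Finset.mem_Icc, hY] at hz ⊢
  refine ⟨hz.1, h.trans ?_⟩
  rw [cst_card]
  refine Finset.card_le_card ?_
  intro y hy
  have h1 := himax y hy
  have h2 := ha y hy
  simp only [Finset.mem_filter, Finset.mem_Icc, hS] at hy ⊢
  exact ⟨hy.1, by omega, by omega⟩

theorem min_sum (i a : ℕ) : min i a = ∑ t ∈ Finset.range i, if t + 1 ≤ a then 1 else 0 := by
  induction i with
  | zero => simp
  | succ i ih => rw [Finset.sum_range_succ, ← ih]; split_ifs <;> omega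

theorem PhiC_cols {n i s} : PhiC n i s = ∑ t ∈ Finset.range i, colN n s (t+1) := by
  unfold PhiC colN
  simp_rw [min_sum i, Finset.card_filter]
  rw [Finset.sum_comm]

theorem PhiD_cols {n i s} : PhiD n i s = ∑ t ∈ Finset.range i, cocolN n s (t+1) := by
  unfold PhiD cocolN
  simp_rw [min_sum i, Finset.card_filter]
  rw [Finset.sum_comm]

theorem cst_le {n s y} : cst n s y ≤ n := by
  rw [cst_card]; exact (Finset.card_filter_le _ _).trans (by simp)

theorem sum_cst {n s} : ∑ y ∈ Finset.Icc 1 n, cst n s y = ∑ t ∈ Finset.range n, colN n s (t+1) := by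
  rw [← PhiC_cols]; unfold PhiC
  exact Finset.sum_congr rfl fun y _ => (min_eq_right cst_le).symm

theorem colN_anti {n s C D} (h : C ≤ D) : colN n s D ≤ colN n s C := by
  unfold colN
  refine Finset.card_le_card fun y hy => ?_
  simp only [Finset.mem_filter] at *
  exact ⟨hy.1, by omega⟩

theorem cocolN_le {n s R} : cocolN n s R ≤ n := by
  unfold cocolN; exact (Finset.card_filter_le _ _).trans (by simp)

theorem PhiD_le {n s M j} (hM : ∀ y, 1 ≤ y → y ≤ n → s y ≤ M)
    (hinj : ∀ y z, 1 ≤ y → y ≤ n → 1 ≤ z → z ≤ n → y ≠ z → s y = s z → s y = M)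
    (hb : ¬ Bad n s) : PhiD n j s ≤ ∑ t ∈ Finset.range n, min j (colN n s (t+1)) := by
  rw [PhiD_cols]
  simp_rw [min_sum j]
  rw [Finset.sum_comm]
  apply Finset.sum_le_sum
  intro R _
  have e : cocolN n s (R+1) = min n (cocolN n s (R+1)) := (min_eq_right cocolN_le).symm
  rw [e, min_sum n]
  apply Finset.sum_le_sum
  intro C _
  split_ifs with h1 h2
  · rfl
  · exact absurd (vex_col hM hinj hb (by omega) h1) h2
  all_goals omega

theorem partition_eq {N : ℕ} {κ l : ℕ → ℕ} (hκ : ∀ c d, c ≤ d → κ d ≤ κ c)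
    (h1 : ∀ i, i ≤ N → ∑ c ∈ Finset.range i, κ c ≤ ∑ c ∈ Finset.range i, l c)
    (h2 : ∀ j, ∑ c ∈ Finset.range N, min j (κ c) ≤ ∑ c ∈ Finset.range N, min j (l c))
    (h3 : ∑ c ∈ Finset.range N, κ c = ∑ c ∈ Finset.range N, l c) :
    ∀ c, c < N → κ c = l c := by
  intro c
  induction c using Nat.strong_induction_on with
  | _ c ih =>
    intro hc
    by_contra hne
    have e : ∑ d ∈ Finset.range c, κ d = ∑ d ∈ Finset.range c, l d :=
      Finset.sum_congr rfl fun d hd => ih d (Finset.mem_range.1 hd) (by simp at hd; omega)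
    have hlt : κ c < l c := by
      have := h1 (c+1) (by omega)
      rw [Finset.sum_range_succ, Finset.sum_range_succ] at this
      omega
    have h := h2 (κ c)
    rw [← Finset.sum_range_add_sum_Ico (fun d => min (κ c) (κ d)) hc.le, ← Finset.sum_range_add_sum_Ico (fun d => min (κ c) (l d)) hc.le] at h
    rw [← Finset.sum_range_add_sum_Ico κ hc.le, ← Finset.sum_range_add_sum_Ico l hc.le] at h3
    have a1 : ∑ d ∈ Finset.range c, min (κ c) (κ d) = ∑ d ∈ Finset.range c, min (κ c) (l d) :=
      Finset.sum_congr rfl fun d hd => by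
        rw [ih d (Finset.mem_range.1 hd) (by simp at hd; omega)]
    have a2 : ∑ d ∈ Finset.Ico c N, min (κ c) (κ d) = ∑ d ∈ Finset.Ico c N, κ d :=
      Finset.sum_congr rfl fun d hd => min_eq_right (hκ _ _ (Finset.mem_Ico.1 hd).1)
    have a3 : ∑ d ∈ Finset.Ico c N, min (κ c) (l d) < ∑ d ∈ Finset.Ico c N, l d :=
      Finset.sum_lt_sum (fun d _ => min_le_right _ _) ⟨c, by simp [hc], by omega⟩
    omega



/-! ### Edelman-Greene insertion and Coxeter-Knuth moves -/

theorem CKE.cons {J K} (a) (h : CKE J K) : CKE (a :: J) (a :: K) := h.left [a]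

theorem mvL {b x : ℕ} {D : List ℕ} (h : (b :: D).Pairwise (· < ·)) (hx : x < b) :
    CKE (b :: (D ++ [x])) (b :: x :: D) := by
  induction D generalizing b with
  | nil => exact CKE.rfl' _
  | cons d D ih =>
    have hb : b < d := by simp at h; exact h.1.1
    have := ih (b := d) (by simp at h ⊢; exact h.2) (by omega)
    refine (this.cons b).trans ?_
    exact (CKE.of3 (p := b) (q := d) (r := x) (p' := b) (q' := x) (r' := d)
      (by unfold CK3; omega)).right D

theorem mvC {x c : ℕ} {A : List ℕ} (h : A.Pairwise (· < ·)) (ha : ∀ a ∈ A, a < x) (hx : x < c) :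
    CKE (A ++ [c, x]) (c :: (A ++ [x])) := by
  induction A with
  | nil => exact CKE.rfl' _
  | cons a A ih =>
    have := ih (by simp at h; exact h.2) (fun a h => ha a (by simp [h]))
    refine (this.cons a).trans ?_
    cases A with
    | nil =>
      have := ha a (by simp)
      exact CKE.of3 (by unfold CK3; omega)
    | cons b A =>
      have h1 : a < b := by simp at h; exact h.1.1
      have h2 := ha b (by simp)
      exact (CKE.of3 (p := a) (q := c) (r := b) (p' := c) (q' := a) (r' := b)
        (by unfold CK3; omega)).right (A ++ [x])

/-- The outcome of a non-terminal column insertion. -/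
inductive ColStep (x : ℕ) : List ℕ → List ℕ → ℕ → Prop
  | rep (A B y) (ha : ∀ a ∈ A, a < x) (hx : x < y) : ColStep x (A ++ y :: B) (A ++ x :: B) y
  | spec (A B) : ColStep x (A ++ x :: (x+1) :: B) (A ++ x :: (x+1) :: B) (x+1)

theorem ColStep.cke {x C C' y} (h : ColStep x C C' y) (hs : C.Pairwise (· < ·)) :
    CKE (C ++ [x]) (y :: C') := by
  cases h with
  | rep A B y ha hx =>
    rw [List.pairwise_append] at hs
    have h1 := (mvL hs.2.1 hx).left A
    have h2 := (mvC hs.1 ha hx).right B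
    simp only [List.append_assoc, List.cons_append, List.nil_append] at h1 h2 ⊢
    exact h1.trans h2
  | spec A B =>
    rw [List.pairwise_append] at hs
    obtain ⟨hA, hB, hAB⟩ := hs
    have h1 := (mvL (b := x+1) (x := x) (D := B) (by rw [List.pairwise_cons] at hB; exact hB.2) (by omega)).left (A ++ [x])
    have h2 := (CKE.of3 (p := x) (q := x+1) (r := x) (p' := x+1) (q' := x) (r' := x+1)
      (by unfold CK3; omega)).ctx A B
    have h3 := (mvC (c := x+1) hA (fun a ha => hAB a ha x (by simp)) (by omega)).right ((x+1) :: B)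
    simp only [List.append_assoc, List.cons_append, List.nil_append] at h1 h2 h3 ⊢
    exact (h1.trans h2).trans h3

theorem all_split {C : List ℕ} {x : ℕ} (hs : C.Pairwise (· < ·)) :
    (∀ c ∈ C, c < x) ∨ ∃ A y B, C = A ++ y :: B ∧ (∀ a ∈ A, a < x) ∧ x ≤ y := by
  induction C with
  | nil => left; simp
  | cons c C ih =>
    by_cases h : c < x
    · rcases ih (by simp at hs; exact hs.2) with h1 | ⟨A, y, B, rfl, h1, h2⟩
      · left; simpa [h] using h1
      · right; exact ⟨c :: A, y, B, rfl, by simpa [h] using h1, h2⟩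
    · right; exact ⟨[], c, C, rfl, by simp, by omega⟩

theorem junk1 {n s x A} (h : Valid n s (A ++ [x] ++ [x])) : False := by
  rw [List.append_assoc, valid_append] at h
  exact valid_ne h.2 rfl

theorem junk2 {n s x A b B} (hs : (A ++ x :: b :: B).Pairwise (· < ·)) (hb : b ≠ x + 1)
    (h : Valid n s (A ++ x :: b :: B ++ [x])) : False := by
  rw [List.pairwise_append] at hs
  obtain ⟨hA, hB, hAB⟩ := hs
  rw [List.pairwise_cons] at hB
  have hxb := hB.1 b (by simp)
  have h1 := (mvL (b := b) (x := x) (D := B) hB.2 hxb).left (A ++ [x])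
  simp only [List.append_assoc, List.cons_append, List.nil_append] at h1 h
  have h2 := (h1.valid h).1
  rw [valid_append] at h2
  obtain ⟨-, -, -, h3⟩ := h2
  obtain ⟨a1, a2, a3, a4, a5, a6, a7⟩ := h3
  have : b ≠ x := by omega
  have : b + 1 ≠ x := by omega
  have : x ≠ b := by omega
  have : x ≠ b + 1 := by omega
  have : x + 1 ≠ b := by omega
  have : x + 1 ≠ b + 1 := by omega
  simp only [sw] at a6 a7
  simp_all
  omega

theorem colIns_spec {n s x C} (hs : C.Pairwise (· < ·)) (h : Valid n s (C ++ [x])) :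
    ((∀ c ∈ C, c < x) ∧ colIns x C = (C ++ [x], none)) ∨
    ∃ C' y, colIns x C = (C', some y) ∧ ColStep x C C' y := by
  rcases all_split (x := x) hs with h1 | ⟨A, y, B, rfl, h1, h2⟩
  · left
    refine ⟨h1, ?_⟩
    unfold colIns
    rw [if_pos (by simpa using h1)]
  right
  have nall : ¬ ((A ++ y :: B).all (fun c => decide (c < x)) = true) := by
    simp; intro _ h; omega
  have hs' := hs
  rw [List.pairwise_append, List.pairwise_cons] at hs'
  obtain ⟨hA, ⟨hyB, hB⟩, hAB⟩ := hs'
  have hxA : x ∉ A := fun h => by have := h1 x h; omega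
  rcases Nat.lt_or_ge x y with hlt | hge
  · -- ordinary replacement
    have nin : ¬ (x ∈ A ++ y :: B ∧ x + 1 ∈ A ++ y :: B) := by
      rintro ⟨hx, -⟩
      simp at hx
      rcases hx with hx | hx | hx
      · exact hxA hx
      · omega
      · have := hyB x hx; omega
    refine ⟨A ++ x :: B, y, ?_, ColStep.rep A B y h1 hlt⟩
    unfold colIns
    rw [if_neg nall, if_neg nin]
    have hf : (A ++ y :: B).find? (fun c => decide (x < c)) = some y := by
      rw [List.find?_append]
      have : A.find? (fun c => decide (x < c)) = none := by
        rw [List.find?_eq_none]; intro a ha; have := h1 a ha; simp; omega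
      rw [this]; simp [hlt]
    rw [hf]
    simp only [List.map_append, List.map_cons, if_true]
    congr 1
    congr 1
    · conv_rhs => rw [← List.map_id A]
      apply List.map_congr_left
      intro a ha; have := hAB a ha y (by simp); rw [if_neg (by omega)]; rfl
    · congr 1
      conv_rhs => rw [← List.map_id B]
      apply List.map_congr_left
      intro a ha; have := hyB a ha; rw [if_neg (by omega)]; rfl
  · obtain rfl : x = y := by omega
    rcases B with _ | ⟨b, B⟩
    · exact (junk1 h).elim
    by_cases hb : b = x + 1
    · subst hb
      refine ⟨_, x+1, ?_, ColStep.spec A B⟩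
      unfold colIns
      rw [if_neg nall, if_pos (by simp)]
    · exact (junk2 hs hb h).elim

theorem ColStep.pos {x C C' y} (h : ColStep x C C' y) (hs : C.Pairwise (· < ·)) :
    C'.Pairwise (· < ·) ∧ C'.length = C.length ∧ ∃ k, k < C.length ∧ C.getD k 0 = y ∧ x < y ∧
      (∀ i, i < k → C.getD i 0 ≤ x) ∧ (∀ i, i ≠ k → C'.getD i 0 = C.getD i 0) ∧
      ((C'.getD k 0 = x ∧ ∀ i, i < k → C.getD i 0 < x) ∨
       (C' = C ∧ y = x + 1 ∧ 1 ≤ k ∧ C.getD (k-1) 0 = x)) := by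
  have gm : ∀ (A B : List ℕ) (z : ℕ) , (A ++ z :: B).getD A.length 0 = z := by intros; simp
  have gl : ∀ (A B : List ℕ) (i : ℕ), i < A.length → (A ++ B).getD i 0 ∈ A := by
    intro A B i hi; rw [List.getD_append _ _ _ _ hi, List.getD_eq_getElem _ _ hi]; simp
  cases h with
  | rep A B y ha hx =>
    have hs' := hs
    rw [List.pairwise_append, List.pairwise_cons] at hs'
    obtain ⟨hA, ⟨hyB, hB⟩, hAB⟩ := hs'
    refine ⟨?_, by simp, A.length, by simp, gm _ _ _, hx, fun i hi => (ha _ (gl _ _ _ hi)).le, ?_,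
      Or.inl ⟨gm _ _ _, fun i hi => ha _ (gl _ _ _ hi)⟩⟩
    · rw [List.pairwise_append, List.pairwise_cons]
      refine ⟨hA, ⟨fun b hb => hx.trans (hyB b hb), hB⟩, fun a h1 b h2 => ?_⟩
      simp at h2
      rcases h2 with rfl | h2
      · exact ha a h1
      · exact hAB a h1 b (by simp [h2])
    · intro i hi
      rcases Nat.lt_or_ge i A.length with h | h
      · rw [List.getD_append _ _ _ _ h, List.getD_append _ _ _ _ h]
      · rw [List.getD_append_right _ _ _ _ h, List.getD_append_right _ _ _ _ h]
        obtain ⟨t, ht⟩ : ∃ t, i - A.length = t + 1 := ⟨i - A.length - 1, by omega⟩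
        rw [ht]; simp
  | spec A B =>
    have e : A ++ x :: (x+1) :: B = (A ++ [x]) ++ (x+1) :: B := by simp
    refine ⟨hs, rfl, A.length + 1, by simp, ?_, by omega, ?_, fun i _ => rfl, Or.inr ⟨rfl, rfl, by omega, gm _ _ _⟩⟩
    · rw [e]; have := gm (A ++ [x]) B (x+1); simpa using this
    · intro i hi
      rcases Nat.lt_or_ge i A.length with h | h
      · rw [List.pairwise_append] at hs
        exact (hs.2.2 _ (gl A (x :: (x+1) :: B) i h) x (by simp)).le
      · obtain rfl : i = A.length := by omega
        rw [gm]

def Adj (C D : List ℕ) : Prop := D.length ≤ C.length ∧ ∀ i, i < D.length → C.getD i 0 < D.getD i 0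

theorem pw_getD {C : List ℕ} (hs : C.Pairwise (· < ·)) {i j} (h : i < j) (hj : j < C.length) :
    C.getD i 0 < C.getD j 0 := by
  rw [List.getD_eq_getElem _ _ (by omega), List.getD_eq_getElem _ _ hj]
  exact List.pairwise_iff_getElem.1 hs i j (by omega) hj h

theorem getD_snoc {C : List ℕ} {x i} (h : i < C.length) : (C ++ [x]).getD i 0 = C.getD i 0 := by
  rw [List.getD_append _ _ _ _ h]

theorem getD_snoc' {C : List ℕ} {x} : (C ++ [x]).getD C.length 0 = x := by simp

/-- `NewCol y D D'`: the column `D'` is obtained from `D` by inserting `y`. -/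
def NewCol (y : ℕ) (D D' : List ℕ) : Prop :=
  ((∀ c ∈ D, c < y) ∧ D' = D ++ [y]) ∨ ∃ z, ColStep y D D' z

theorem adj_step {x C C' y D D'} (hC : C.Pairwise (· < ·)) (hD : D.Pairwise (· < ·))
    (h : Adj C D) (hc : ColStep x C C' y) (hd : NewCol y D D') : Adj C' D' := by
  obtain ⟨-, hl, k, hk, e1, hxy, h1, h2, h3⟩ := hc.pos hC
  have hle : ∀ i, i < C.length → C'.getD i 0 ≤ C.getD i 0 := by
    intro i _
    by_cases hik : i = k
    · subst hik
      rcases h3 with h3 | h3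
      · rw [h3.1, e1]; omega
      · rw [h3.1]
    · rw [h2 i hik]
  -- position claim
  have key : ∀ k', k' ≤ D.length → (∀ i, i < k' → D.getD i 0 < y) → k' < C.length ∧ C'.getD k' 0 < y := by
    intro k' hk' hb
    have hkk : k' ≤ k := by
      by_contra hc
      have := hb k (by omega)
      have := h.2 k (by omega)
      omega
    refine ⟨by omega, ?_⟩
    rcases Nat.lt_or_ge k' k with hlt | hge
    · rw [h2 k' (by omega), ← e1]; exact pw_getD hC hlt hk
    · obtain rfl : k' = k := by omega
      rcases h3 with h3 | ⟨-, h4, h5, h6⟩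
      · rw [h3.1]; exact hxy
      · have := hb (k'-1) (by omega)
        have := h.2 (k'-1) (by omega)
        omega
  rcases hd with ⟨ha, rfl⟩ | ⟨z, hd⟩
  · have hg : ∀ i, i < D.length → D.getD i 0 < y := by
      intro i hi; rw [List.getD_eq_getElem _ _ hi]; exact ha _ (by simp)
    obtain ⟨g1, g2⟩ := key D.length le_rfl hg
    refine ⟨by simp; omega, fun i hi => ?_⟩
    simp at hi
    rcases Nat.lt_or_ge i D.length with hlt | hge
    · rw [getD_snoc hlt]; have := h.2 i hlt; have := hle i (by omega); omega
    · obtain rfl : i = D.length := by omega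
      rw [getD_snoc']; exact g2
  · obtain ⟨-, hl', k', hk', e1', hxy', h1', h2', h3'⟩ := hd.pos hD
    refine ⟨by have := h.1; omega, fun i hi => ?_⟩
    rw [hl'] at hi
    have b1 := h.2 i hi
    have b2 := hle i (by have := h.1; omega)
    by_cases hik : i = k'
    · subst hik
      rcases h3' with h3' | h3'
      · rw [h3'.1]; exact (key i hi.le h3'.2).2
      · rw [h3'.1]; omega
    · rw [h2' i hik]; omega

theorem adj_end {x C D} (h : Adj C D) : Adj (C ++ [x]) D := by
  refine ⟨by have := h.1; simp; omega, fun i hi => ?_⟩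
  rw [getD_snoc (by have := h.1; omega)]; exact h.2 i hi

theorem adj_trans {C D E} (h1 : Adj C D) (h2 : Adj D E) : Adj C E :=
  ⟨h2.1.trans h1.1, fun i hi => (h1.2 i (lt_of_lt_of_le hi h2.1)).trans (h2.2 i hi)⟩

def Good : List (List ℕ) → Prop
  | [] => True
  | C :: P => C.Pairwise (· < ·) ∧ C ≠ [] ∧ Adj C (P.headD []) ∧ Good P

def colread (P : List (List ℕ)) : List ℕ := P.reverse.flatten

theorem colread_cons {C P} : colread (C :: P) = colread P ++ C := by simp [colread]

theorem adj_nil {C} : Adj C [] := ⟨by simp, by simp⟩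

theorem ColStep.ne {x C C' y} (h : ColStep x C C' y) : C' ≠ [] ∧ C ≠ [] := by
  cases h <;> simp

/-- Main insertion lemma. -/
theorem eg_spec {n s P x} (hg : Good P) (hv : Valid n s (colread P ++ [x])) :
    Good (egInsert P x).1 ∧ CKE (colread P ++ [x]) (colread (egInsert P x).1) ∧
    (egInsert P x).2 ≤ P.length ∧
    (∀ c, (((egInsert P x).1).getD c []).length =
      (P.getD c []).length + if c = (egInsert P x).2 then 1 else 0) ∧
    (egInsert P x).1.length = max P.length ((egInsert P x).2 + 1) ∧
    NewCol x (P.headD []) ((egInsert P x).1.headD []) := by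
  induction P generalizing x s with
  | nil =>
    refine ⟨by simp [egInsert, Good, adj_nil], CKE.rfl' _, by simp [egInsert], ?_, by simp [egInsert], Or.inl (by simp [egInsert])⟩
    intro c
    rcases c with _ | c <;> simp [egInsert]
  | cons C P ih =>
    obtain ⟨g1, g2, g3, g4⟩ := hg
    rw [colread_cons] at hv ⊢
    have hv2 := hv
    rw [List.append_assoc, valid_append] at hv2
    rcases colIns_spec g1 hv2.2 with ⟨ha, e⟩ | ⟨C', y, e, hst⟩
    · have e2 : egInsert (C :: P) x = ((C ++ [x]) :: P, 0) := by
        unfold egInsert; rw [e]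
      rw [e2]
      refine ⟨⟨?_, by simp, adj_end g3, g4⟩, ?_, by simp, ?_, by simp, Or.inl ⟨by simpa using ha, by simp⟩⟩
      · rw [List.pairwise_append]; exact ⟨g1, by simp, by simpa using ha⟩
      · rw [colread_cons, List.append_assoc]; exact CKE.rfl' _
      · intro c; rcases c with _ | c <;> simp
    · have e2 : egInsert (C :: P) x = (C' :: (egInsert P y).1, (egInsert P y).2 + 1) := by
        rw [egInsert]; rw [e]
      have c1 : CKE (colread P ++ C ++ [x]) (colread P ++ [y] ++ C') := by
        have := (hst.cke g1).left (colread P)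
        simpa using this
      have v1 := (c1.valid hv).1
      rw [valid_append] at v1
      obtain ⟨i1, i2, i3, i4, i5, i6⟩ := ih g4 v1.1
      rw [e2]
      have hD : (P.headD []).Pairwise (· < ·) := by
        cases P with
        | nil => simp
        | cons D P => exact g4.1
      refine ⟨⟨(hst.pos g1).1, hst.ne.1, adj_step g1 hD g3 hst i6, i1⟩, ?_, by simpa using i3, ?_, ?_, Or.inr ⟨y, by simpa using hst⟩⟩
      · rw [colread_cons]; exact c1.trans (i2.right C')
      · intro c
        rcases c with _ | c
        · simp [(hst.pos g1).2.1]
        · simpa using i4 c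
      · simp [i5]



theorem egStep_snd {P Q : List (List ℕ)} {ra : ℕ × ℕ} (h : (egInsert P ra.2).2 ≤ Q.length) (c : ℕ) :
    ((egStep (P, Q) ra).2).getD c [] =
      Q.getD c [] ++ if c = (egInsert P ra.2).2 then [ra.1] else [] := by
  unfold egStep
  simp only
  generalize (egInsert P ra.2).2 = m at *
  split_ifs with h1 h2 h2
  · subst h2
    simp [List.getD_eq_getElem?_getD, List.getElem?_set, h1]
  · simp [List.getD_eq_getElem?_getD, List.getElem?_set, Ne.symm h2]
  · obtain rfl : m = Q.length := by omega
    subst h2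
    simp
  · obtain rfl : m = Q.length := by omega
    rcases Nat.lt_or_ge c Q.length with h3 | h3
    · rw [List.getD_append _ _ _ _ h3]; simp
    · rw [List.getD_append_right _ _ _ _ h3]
      have : c - Q.length ≠ 0 := by omega
      obtain ⟨t, ht⟩ := Nat.exists_eq_succ_of_ne_zero this
      rw [ht]; simp [List.getD_eq_getElem?_getD, List.getElem?_eq_none h3]

def EG (L : List (ℕ × ℕ)) : List (List ℕ) × List (List ℕ) := L.foldl egStep ([], [])

theorem EG_snoc {L a} : EG (L ++ [a]) = egStep (EG L) a := by simp [EG]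

theorem EG_spec {n s L} (hv : Valid n s (L.map Prod.snd)) :
    Good (EG L).1 ∧ CKE (L.map Prod.snd) (colread (EG L).1) ∧ (EG L).2.length = (EG L).1.length ∧
    (∀ c, ((EG L).2.getD c []).length = ((EG L).1.getD c []).length) ∧
    (∀ c, List.Sublist ((EG L).2.getD c []) (L.map Prod.fst)) := by
  induction L using List.reverseRecOn with
  | nil => exact ⟨trivial, CKE.rfl' _, rfl, fun c => by simp [EG], fun c => by simp [EG]⟩
  | append_singleton L a ih =>
    have hv' := hv
    rw [List.map_append, valid_append] at hv
    obtain ⟨i1, i2, i3, i4, i5⟩ := ih hv.1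
    have c1 : CKE ((L ++ [a]).map Prod.snd) (colread (EG L).1 ++ [a.2]) := by
      simpa using i2.right [a.2]
    obtain ⟨j1, j2, j3, j4, j5, -⟩ := eg_spec i1 (c1.valid hv').1
    rw [EG_snoc]
    have e : EG L = ((EG L).1, (EG L).2) := rfl
    have e1 : (egStep (EG L) a).1 = (egInsert (EG L).1 a.2).1 := rfl
    have q := egStep_snd (P := (EG L).1) (Q := (EG L).2) (ra := a) (by rw [i3]; exact j3)
    rw [← e] at q
    refine ⟨by rw [e1]; exact j1, by rw [e1]; exact c1.trans j2, ?_, ?_, ?_⟩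
    · rw [e1, j5]
      unfold egStep; simp only
      split_ifs with h
      · rw [List.length_set]; omega
      · simp; omega
    · intro c
      rw [q, e1, j4, List.length_append, i4]
      split_ifs <;> rfl
    · intro c
      rw [q, List.map_append]
      apply List.Sublist.append (i5 c)
      split_ifs <;> simp

theorem EG_filter {n s k L1 L2} (hv : Valid n s ((L1 ++ L2).map Prod.snd)) (h1 : ∀ p ∈ L1, p.1 ≤ k)
    (h2 : ∀ p ∈ L2, k < p.1) (c : ℕ) :
    (((EG (L1 ++ L2)).2.getD c []).filter (fun r => decide (r ≤ k))).length =
      ((EG L1).1.getD c []).length := by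
  induction L2 using List.reverseRecOn with
  | nil =>
    rw [List.append_nil] at *
    obtain ⟨i1, i2, i3, i4, i5⟩ := EG_spec hv
    rw [← i4, List.filter_eq_self.2]
    intro r hr
    have := (i5 c).subset hr
    simp only [List.mem_map] at this
    obtain ⟨p, hp, rfl⟩ := this
    simpa using h1 p hp
  | append_singleton L2 a ih =>
    rw [← List.append_assoc] at *
    have hv' := hv
    rw [List.map_append, valid_append] at hv
    have ih := ih hv.1 (fun p hp => h2 p (by simp [hp]))
    obtain ⟨i1, i2, i3, i4, i5⟩ := EG_spec hv.1
    have c1 : CKE ((L1 ++ L2 ++ [a]).map Prod.snd) (colread (EG (L1 ++ L2)).1 ++ [a.2]) := by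
      simpa using i2.right [a.2]
    obtain ⟨j1, j2, j3, j4, j5, -⟩ := eg_spec i1 (c1.valid hv').1
    have q := egStep_snd (P := (EG (L1 ++ L2)).1) (Q := (EG (L1 ++ L2)).2) (ra := a) (by rw [i3]; exact j3)
    rw [EG_snoc]
    rw [show EG (L1 ++ L2) = ((EG (L1 ++ L2)).1, (EG (L1 ++ L2)).2) from rfl, q, List.filter_append, List.length_append, ih]
    have := h2 a (by simp)
    split_ifs
    · simp; omega
    · simp

/-! ### Decreasing runs -/

def GoodR (R : List (List ℕ)) : Prop :=
  R.Pairwise (fun D C => Adj C D) ∧ ∀ C ∈ R, C.Pairwise (· < ·)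

theorem Good.all {P} (h : Good P) : P.Pairwise Adj ∧ (∀ C ∈ P, C.Pairwise (· < ·)) ∧ (∀ C ∈ P, C ≠ []) := by
  induction P with
  | nil => simp
  | cons C P ih =>
    obtain ⟨h1, h2, h3, h4⟩ := h
    obtain ⟨i1, i2, i3⟩ := ih h4
    refine ⟨List.pairwise_cons.2 ⟨?_, i1⟩, by simp; exact ⟨h1, i2⟩, by
      intro D hD; simp at hD; rcases hD with rfl | hD
      · exact h2
      · exact i3 D hD⟩
    cases P with
    | nil => simp
    | cons D P =>
      simp at h3
      intro E hE
      simp at hE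
      rcases hE with rfl | hE
      · exact h3
      · exact adj_trans h3 ((List.pairwise_cons.1 i1).1 E hE)

theorem Good.goodR {P} (h : Good P) : GoodR P.reverse := by
  obtain ⟨h1, h2, -⟩ := h.all
  exact ⟨by rw [List.pairwise_reverse]; exact h1, by simpa using h2⟩

theorem mvRun {b : ℕ} {D h : List ℕ} (hD : (b :: D).Pairwise (· < ·)) (hh : h.Pairwise (· > ·))
    (hb : ∀ x ∈ h, x < b) : CKE (b :: (D ++ h)) (b :: (h ++ D)) := by
  induction h generalizing b with
  | nil => simpa using CKE.rfl' _
  | cons x h ih =>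
    have hx := hb x (by simp)
    have h1 := (mvL hD hx).right h
    rw [List.pairwise_cons] at hh hD
    have h2 := (ih (b := x) (List.pairwise_cons.2 ⟨fun d hd => hx.trans (hD.1 d hd), hD.2⟩) hh.2 hh.1).cons b
    simp only [List.append_assoc, List.cons_append, List.nil_append] at h1 h2 ⊢
    exact h1.trans h2

theorem getD_tail {C : List ℕ} {i} : C.tail.getD i 0 = C.getD (i+1) 0 := by
  cases C <;> simp

theorem peel {R} (h : GoodR R) : GoodR (R.map List.tail) ∧
    CKE R.flatten (R.filterMap List.head? ++ (R.map List.tail).flatten) ∧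
    (R.filterMap List.head?).Pairwise (· > ·) ∧
    (R.filterMap List.head?).length + ((R.map List.tail).map List.length).sum = (R.map List.length).sum := by
  obtain ⟨h1, h2⟩ := h
  refine ⟨⟨?_, ?_⟩, ?_⟩
  · rw [List.pairwise_map]
    refine h1.imp ?_
    rintro D C ⟨a, b⟩
    refine ⟨by simp; omega, fun i hi => ?_⟩
    rw [getD_tail, getD_tail]
    simp at hi
    exact b _ (by omega)
  · intro C hC
    simp at hC
    obtain ⟨D, hD, rfl⟩ := hC
    exact (h2 D hD).tail
  induction R with
  | nil => exact ⟨CKE.rfl' _, by simp, by simp⟩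
  | cons C R ih =>
    rw [List.pairwise_cons] at h1
    obtain ⟨i1, i2, i3⟩ := ih h1.2 (fun C hC => h2 C (by simp [hC]))
    cases C with
    | nil =>
      have e : ([] :: R).filterMap List.head? = R.filterMap List.head? := by
        rw [List.filterMap_cons]; rfl
      rw [e]
      rw [List.map_map] at i3
      simpa using ⟨i1, i2, i3⟩
    | cons b D =>
      have hb : ∀ x ∈ R.filterMap List.head?, x < b := by
        intro x hx
        rw [List.mem_filterMap] at hx
        obtain ⟨C, hC, hx⟩ := hx
        have := (h1.1 C hC).2 0 (by simp)
        cases C with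
        | nil => simp at hx
        | cons y C => simp at hx this; omega
      have hs := h2 (b :: D) (by simp)
      have c1 := (i1.left D).cons b
      have c2 := (mvRun hs i2 hb).right (R.map List.tail).flatten
      simp only [List.append_assoc, List.cons_append, List.nil_append, List.flatten_cons,
        List.filterMap_cons, List.head?_cons, List.map_cons, List.tail_cons] at c1 c2 ⊢
      refine ⟨c1.trans c2, List.pairwise_cons.2 ⟨hb, i2⟩, ?_⟩
      simp only [List.length_cons, List.sum_cons]
      omega

theorem peels {R} (h : GoodR R) (j : ℕ) : ∃ (Ls : List (List ℕ)) (X : List ℕ), Ls.length = j ∧ Runs (· > ·) Ls ∧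
    CKE R.flatten (Ls.flatten ++ X) ∧ Ls.flatten.length = (R.map (fun C => min j C.length)).sum := by
  induction j generalizing R with
  | zero => exact ⟨[], R.flatten, rfl, by simp [Runs], CKE.rfl' _, by simp⟩
  | succ j ih =>
    obtain ⟨p1, p2, p3, p4⟩ := peel h
    obtain ⟨Ls, X, e1, e2, e3, e4⟩ := ih p1
    refine ⟨R.filterMap List.head? :: Ls, X, by simp [e1], ?_, ?_, ?_⟩
    · intro l hl; simp at hl; rcases hl with rfl | hl
      · exact p3
      · exact e2 l hl
    · have := e3.left (R.filterMap List.head?)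
      simpa using p2.trans this
    · rw [List.flatten_cons, List.length_append, e4]
      clear p1 p2 p3 p4 e1 e2 e3 e4 ih h
      induction R with
      | nil => simp
      | cons C R ih =>
        cases C with
        | nil =>
          have e : ([] :: R).filterMap List.head? = R.filterMap List.head? := by
            rw [List.filterMap_cons]; rfl
          rw [e]
          simpa using ih
        | cons a C =>
          simp only [List.filterMap_cons, List.head?_cons, List.length_cons, List.map_cons,
            List.tail_cons, List.sum_cons] at *
          omega

theorem sum_getD (P : List (List ℕ)) (f : List ℕ → ℕ) (hf : f [] = 0) (N : ℕ) (hN : P.length ≤ N) :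
    ∑ c ∈ Finset.range N, f (P.getD c []) = (P.map f).sum := by
  induction P generalizing N with
  | nil => simp [hf]
  | cons C P ih =>
    obtain ⟨N, rfl⟩ : ∃ m, N = m + 1 := ⟨N - 1, by simp at hN; omega⟩
    rw [Finset.sum_range_succ']
    simp only [List.getD_cons_succ, List.getD_cons_zero, List.map_cons, List.sum_cons]
    rw [ih N (by simpa using hN)]; omega

theorem sum_take (P : List (List ℕ)) (i : ℕ) :
    ∑ c ∈ Finset.range i, (P.getD c []).length = ((P.take i).map List.length).sum := by
  induction P generalizing i with
  | nil => simp
  | cons C P ih =>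
    cases i with
    | zero => simp
    | succ i =>
      rw [Finset.sum_range_succ']
      simp only [List.getD_cons_succ, List.getD_cons_zero, List.take_succ_cons, List.map_cons, List.sum_cons]
      rw [ih i]; omega

theorem PhiC_le_i {n i j s} (h : i ≤ j) : PhiC n i s ≤ PhiC n j s := by
  unfold PhiC; apply Finset.sum_le_sum; intro y _; omega

/-- The shape of the insertion tableau. -/
theorem shape_eq {n s M rows J K P} (hf : ∀ τ ∈ rows, FinB τ)
    (hex : ∀ J, Valid n s J → ∃ K, Flow rows J K) (hv : Valid n s J) (h : Flow rows J K)
    (hend : ∀ y, 1 ≤ y → y ≤ n → cst n (endS s J) y = 0)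
    (hM : ∀ y, 1 ≤ y → y ≤ n → s y ≤ M)
    (hinj : ∀ y z, 1 ≤ y → y ≤ n → 1 ≤ z → z ≤ n → y ≠ z → s y = s z → s y = M)
    (hb : ¬ Bad n s) (hP : Good P) (hc : CKE K (colread P)) (c : ℕ) :
    (P.getD c []).length = colN n s (c+1) := by
  set N := max (max n P.length) (c+1) with hN
  have colz : ∀ t, n ≤ t → colN n s (t+1) = 0 := by
    intro t ht
    unfold colN
    rw [Finset.card_eq_zero, Finset.filter_eq_empty_iff]
    intro y _ hy
    have := cst_le (n := n) (s := s) (y := y)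
    omega
  have ext : ∀ f : ℕ → ℕ, (∀ t, n ≤ t → f t = 0) → ∑ t ∈ Finset.range N, f t = ∑ t ∈ Finset.range n, f t := by
    intro f hf
    symm
    apply Finset.sum_subset
    · intro x; simp; omega
    · intro x _ hx; simp at hx; exact hf x hx
  obtain ⟨ha, -, -⟩ := hP.all
  refine partition_eq (N := N) (κ := fun c => (P.getD c []).length) (l := fun c => colN n s (c+1)) ?_ ?_ ?_ ?_ c (by omega)
  · intro c d hcd
    rcases Nat.lt_or_ge d P.length with hd | hd
    · rcases Nat.eq_or_lt_of_le hcd with rfl | hlt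
      · rfl
      rw [List.getD_eq_getElem _ _ hd, List.getD_eq_getElem _ _ (by omega)]
      exact (List.pairwise_iff_getElem.1 ha c d (by omega) hd hlt).1
    · rw [List.getD_eq_default _ _ hd]; simp
  · intro i _
    rw [sum_take, ← PhiC_cols]
    have e : colread P = (P.drop i).reverse.flatten ++ List.flatten (P.take i).reverse := by
      rw [← List.flatten_append, ← List.reverse_append, List.take_append_drop]; rfl
    rw [e] at hc
    have := boundC hf hex hv h hc (by
      intro l hl
      simp only [List.mem_reverse] at hl
      exact hP.all.2.1 l (List.mem_of_mem_take hl))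
    refine le_trans ?_ (this.trans (PhiC_le_i (by simp)))
    rw [List.length_flatten, List.map_reverse, List.sum_reverse]
  · intro j
    obtain ⟨Ls, X, e1, e2, e3, e4⟩ := peels hP.goodR j
    have := boundD hf hex hv h (hc.trans e3) e2
    rw [e4, e1] at this
    rw [ext (fun c => min j (colN n s (c+1))) (by intro t ht; simp [colz t ht])]
    rw [sum_getD P (fun C => min j C.length) (by simp) N (by omega)]
    refine le_trans (le_of_eq ?_) (this.trans (PhiD_le hM hinj hb))
    rw [List.map_reverse, List.sum_reverse]
  · rw [ext (fun c => colN n s (c+1)) colz, ← sum_cst, cst_total hv, sum_getD P List.length rfl N (by omega)]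
    rw [Finset.sum_eq_zero (fun y hy => by simp at hy; exact hend y hy.1 hy.2), zero_add]
    have l1 := hc.length
    have l2 := (h.sd hf).1
    rw [← l2, ← l1]
    simp [colread, List.length_flatten, List.sum_reverse]



/-! ### Labelled rows -/

/-- Local rule: `u` top label, `l` bottom label, `w` left label, `e` right label;
`M` stands for no pipe. -/
def Loc (M : ℕ) : Tile → ℕ → ℕ → ℕ → ℕ → Prop
  | .blank, u, l, w, e => u = M ∧ l = M ∧ w = M ∧ e = M
  | .vert, u, l, w, e => u = l ∧ u < M ∧ w = M ∧ e = M
  | .horiz, u, l, w, e => u = M ∧ l = M ∧ w = e ∧ w < M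
  | .cross, u, l, w, e => u = l ∧ w = e ∧ e < M ∧ u < e
  | .se, u, l, w, e => u = M ∧ w = M ∧ l = e ∧ l < M
  | .nw, u, l, w, e => u = w ∧ u < M ∧ l = M ∧ e = M
  | .bump, _, _, _, _ => False

def Row (n : ℕ) (U : ℕ → ℕ) (τ : ℕ → Tile) (L : ℕ → ℕ) (k : ℕ) : Prop :=
  ∃ h : ℕ → ℕ, h 0 = n + 1 ∧ h n = k ∧
    ∀ y, 1 ≤ y → y ≤ n → Loc (n+1) (τ y) (U y) (L y) (h (y-1)) (h y)

def upd2 (τ : ℕ → Tile) (j : ℕ) (a b : Tile) : ℕ → Tile :=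
  fun y => if y = j then a else if y = j + 1 then b else τ y

theorem row_upd {n : ℕ} {U : ℕ → ℕ} {τ : ℕ → Tile} {L : ℕ → ℕ} {k : ℕ} {h U' L' : ℕ → ℕ} {t1 t2 : Tile} {x j : ℕ} (h1 : 1 ≤ j) (h2 : j + 1 ≤ n)
    (hh : h 0 = n + 1 ∧ h n = k ∧ ∀ y, 1 ≤ y → y ≤ n → Loc (n+1) (τ y) (U y) (L y) (h (y-1)) (h y))
    (hU : ∀ y, y ≠ j → y ≠ j+1 → U' y = U y) (hL : ∀ y, y ≠ j → y ≠ j+1 → L' y = L y)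
    (a1 : Loc (n+1) t1 (U' j) (L' j) (h (j-1)) x) (a2 : Loc (n+1) t2 (U' (j+1)) (L' (j+1)) x (h (j+1))) :
    Row n U' (upd2 τ j t1 t2) L' k := by
  refine ⟨fun y => if y = j then x else h y, ?_, ?_, ?_⟩
  · simp only; rw [if_neg (by omega)]; exact hh.1
  · simp only; rw [if_neg (by omega)]; exact hh.2.1
  · intro y y1 y2
    simp only [upd2]
    by_cases e1 : y = j
    · subst e1; rw [if_pos rfl, if_pos rfl, if_neg (by omega)]; exact a1
    by_cases e2 : y = j + 1
    · subst e2
      rw [if_neg e1, if_pos rfl, if_neg e1, if_pos (by omega)]; exact a2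
    rw [if_neg e1, if_neg e2, if_neg e1, if_neg (by omega), hU y e1 e2, hL y e1 e2]
    exact hh.2.2 y y1 y2

theorem sw_self {j s} : sw j s j = s (j+1) := by simp [sw]
theorem sw_succ {j s} : sw j s (j+1) = s j := by simp [sw]
theorem sw_ne {j s y} (h1 : y ≠ j) (h2 : y ≠ j+1) : sw j s y = s y := by simp [sw, h1, h2]

theorem loc_pass {M a b t1 t2 u1 l1 w m u2 l2 e} (h : passT a b = some (t1, t2))
    (h1 : Loc M a u1 l1 w m) (h2 : Loc M b u2 l2 m e) (hu : u2 < u1) :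
    l2 < l1 ∧ ∃ x, Loc M t1 u2 l2 w x ∧ Loc M t2 u1 l1 x e := by
  cases a <;> cases b <;> simp [passT] at h <;> obtain ⟨rfl, rfl⟩ := h <;> simp only [Loc] at h1 h2 ⊢
  · exact ⟨by omega, M, by omega, by omega⟩
  · exact ⟨by omega, M, by omega, by omega⟩
  · exact ⟨by omega, m, by omega, by omega⟩
  · exact ⟨by omega, M, by omega, by omega⟩
  · exact ⟨by omega, w, by omega, by omega⟩
  · exact ⟨by omega, m, by omega, by omega⟩

theorem loc_half {M a b t1 u1 l1 w m u2 l2 e} (h : halfT a b = some t1)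
    (h1 : Loc M a u1 l1 w m) (h2 : Loc M b u2 l2 m e) (hu : u2 < u1) :
    Loc M t1 u2 l1 w M ∧ Loc M .blank u1 l2 M e := by
  cases a <;> cases b <;> simp [halfT] at h <;> subst h <;> simp only [Loc, and_true, true_and] at h1 h2 ⊢ <;> omega

theorem loc_src {M b t3 u1 l1 w m u2 l2 e} (h : srcT b = some t3)
    (h1 : Loc M .blank u1 l1 w m) (h2 : Loc M b u2 l2 m e) :
    l2 < l1 ∧ ∃ x, Loc M .se u1 l2 w x ∧ Loc M t3 u2 l1 x e := by
  cases b <;> simp [srcT] at h <;> subst h <;> simp only [Loc] at h1 h2 ⊢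
  · exact ⟨by omega, l2, by omega, by omega⟩
  · exact ⟨by omega, l2, by omega, by omega⟩

theorem loc_or {M a b u1 l1 w m u2 l2 e}
    (h1 : Loc M a u1 l1 w m) (h2 : Loc M b u2 l2 m e) (hu : u2 < u1) :
    (∃ t, passT a b = some t) ∨ (∃ t, halfT a b = some t) := by
  cases a <;> cases b <;> simp only [Loc, passT, halfT] at * <;>
    first
      | exact Or.inl ⟨_, rfl⟩
      | exact Or.inr ⟨_, rfl⟩
      | (exfalso; omega)

theorem row_pass {n U τ L k j t1 t2} (hr : Row n U τ L k) (h1 : 1 ≤ j) (h2 : j + 1 ≤ n)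
    (hu : U (j+1) < U j) (hp : passT (τ j) (τ (j+1)) = some (t1, t2)) :
    Row n (sw j U) (upd2 τ j t1 t2) (sw j L) k ∧ L (j+1) < L j := by
  obtain ⟨h, hh⟩ := hr
  obtain ⟨a, x, b, c⟩ := loc_pass hp (hh.2.2 j h1 (by omega)) (hh.2.2 (j+1) (by omega) h2) hu
  refine ⟨row_upd h1 h2 hh (fun y => sw_ne) (fun y => sw_ne) (x := x) ?_ ?_, a⟩
  · rw [sw_self, sw_self]; exact b
  · rw [sw_succ, sw_succ]; exact c

theorem row_half {n U τ L k j t1} (hr : Row n U τ L k) (h1 : 1 ≤ j) (h2 : j + 1 ≤ n)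
    (hu : U (j+1) < U j) (hp : halfT (τ j) (τ (j+1)) = some t1) :
    Row n (sw j U) (upd2 τ j t1 .blank) L k := by
  obtain ⟨h, hh⟩ := hr
  obtain ⟨b, c⟩ := loc_half hp (hh.2.2 j h1 (by omega)) (hh.2.2 (j+1) (by omega) h2) hu
  refine row_upd h1 h2 hh (fun y => sw_ne) (fun y _ _ => rfl) (x := n+1) ?_ ?_
  · rw [sw_self]; exact b
  · rw [sw_succ]; exact c

theorem row_src {n U τ L k j t3} (hr : Row n U τ L k) (h1 : 1 ≤ j) (h2 : j + 1 ≤ n)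
    (hb : τ j = .blank) (hp : srcT (τ (j+1)) = some t3) :
    Row n U (upd2 τ j .se t3) (sw j L) k ∧ L (j+1) < L j := by
  obtain ⟨h, hh⟩ := hr
  have q := hh.2.2 j h1 (by omega)
  rw [hb] at q
  obtain ⟨a, x, b, c⟩ := loc_src hp q (hh.2.2 (j+1) (by omega) h2)
  refine ⟨row_upd h1 h2 hh (fun y _ _ => rfl) (fun y => sw_ne) (x := x) ?_ ?_, a⟩
  · rw [sw_self]; exact b
  · rw [sw_succ]; exact c

theorem row_or {n U τ L k j} (hr : Row n U τ L k) (h1 : 1 ≤ j) (h2 : j + 1 ≤ n)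
    (hu : U (j+1) < U j) :
    (∃ t, passT (τ j) (τ (j+1)) = some t) ∨ (∃ t, halfT (τ j) (τ (j+1)) = some t) := by
  obtain ⟨h, hh⟩ := hr
  exact loc_or (hh.2.2 j h1 (by omega)) (hh.2.2 (j+1) (by omega) h2) hu

theorem row_next {n U τ L k j} (hr : Row n U τ L k) (hk : k ≤ n) (h1 : 1 ≤ j) (h2 : j ≤ n)
    (hb : τ j = .blank) : ∃ j' t, j ≤ j' ∧ j' + 1 ≤ n ∧ (∀ y, j ≤ y → y ≤ j' → τ y = .blank) ∧
      srcT (τ (j'+1)) = some t := by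
  obtain ⟨h, hh⟩ := hr
  obtain ⟨m, hm⟩ : ∃ m, m = n - j := ⟨_, rfl⟩
  induction m generalizing j with
  | zero =>
    obtain rfl : j = n := by omega
    have := hh.2.2 j h1 h2
    rw [hb] at this; simp only [Loc] at this
    omega
  | succ m ih =>
    have q := hh.2.2 j h1 h2
    rw [hb] at q; simp only [Loc] at q
    have q2 := hh.2.2 (j+1) (by omega) (by omega)
    rw [Nat.add_sub_cancel, q.2.2.2] at q2
    by_cases hb2 : τ (j+1) = .blank
    · obtain ⟨j', t, a, b, c, d⟩ := ih (j := j+1) (by omega) (by omega) hb2 (by omega)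
      refine ⟨j', t, by omega, b, fun y y1 y2 => ?_, d⟩
      rcases Nat.eq_or_lt_of_le y1 with rfl | y1
      · exact hb
      · exact c y y1 y2
    · have : ∃ t, srcT (τ (j+1)) = some t := by
        revert q2 hb2
        cases τ (j+1) <;> simp only [Loc, srcT] <;> intro q2 hb2 <;>
          first
            | exact ⟨_, rfl⟩
            | (exfalso; omega)
            | exact absurd trivial hb2
            | exact absurd rfl hb2
      obtain ⟨t, ht⟩ := this
      exact ⟨j, t, le_rfl, by omega, fun y y1 y2 => by rw [show y = j by omega]; exact hb, ht⟩

theorem row_step {n U τ L k j} (hr : Row n U τ L k) (hk : k ≤ n) (h1 : 1 ≤ j) (h2 : j + 1 ≤ n)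
    (hu : U (j+1) < U j) :
    ∃ j' τ', StepB τ j j' τ' ∧ Row n (sw j U) τ' (sw j' L) k ∧ L (j'+1) < L j' ∧ 1 ≤ j' ∧ j' + 1 ≤ n := by
  rcases row_or hr h1 h2 hu with ⟨⟨t1, t2⟩, ht⟩ | ⟨t1, ht⟩
  · obtain ⟨a, b⟩ := row_pass hr h1 h2 hu ht
    exact ⟨j, _, StepB.pass t1 t2 ht rfl (fun y => rfl), a, b, h1, h2⟩
  · have a := row_half hr h1 h2 hu ht
    obtain ⟨j', t3, b1, b2, b3, b4⟩ := row_next (j := j+1) a hk (by omega) h2 (by simp [upd2])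
    have b5 : srcT (τ (j'+1)) = some t3 := by
      simpa [upd2, show j' + 1 ≠ j by omega, show j' ≠ j by omega] using b4
    obtain ⟨c1, c2⟩ := row_src a (by omega) b2 (b3 j' b1 le_rfl) b4
    refine ⟨j', _, StepB.jump t1 t3 ht b1 ?_ b5 ?_, c1, c2, by omega, b2⟩
    · intro y y1 y2
      have := b3 y (by omega) y2
      simpa [upd2, show y ≠ j by omega, show y ≠ j+1 by omega] using this
    · intro y
      simp only [upd2]
      split_ifs <;> first | rfl | omega

/-- label facts for a row -/
theorem Row.finB' {n U τ L k} (hr : Row n U τ L k) (ho : ∀ y, ¬ (1 ≤ y ∧ y ≤ n) → τ y ≠ .blank) : FinB τ := by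
  refine ⟨Finset.Icc 1 n, fun y hy => ?_⟩
  by_contra hc
  exact ho y (by simpa using hc) hy

theorem row_run {n U τ L k J} (hr : Row n U τ L k) (hk : k ≤ n) (hv : Valid n U J) :
    ∃ J' τ', RunB τ J J' τ' ∧ Row n (endS U J) τ' (endS L J') k ∧ Valid n L J' := by
  induction J generalizing U τ L with
  | nil => exact ⟨[], τ, RunB.nil _, hr, trivial⟩
  | cons j J ih =>
    obtain ⟨v1, v2, v3, v4⟩ := hv
    obtain ⟨j', τ', a, b, c, d, e⟩ := row_step hr hk v1 v2 v3
    obtain ⟨J', τ'', f, g, i⟩ := ih b v4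
    exact ⟨j' :: J', τ'', RunB.cons a f, g, d, e, c, i⟩

/-! ### Labelled grids -/

structure LG (n : ℕ) (T : ℕ → ℕ → Tile) (V : ℕ → ℕ → ℕ) : Prop where
  pos : 1 ≤ n
  top : ∀ y, 1 ≤ y → y ≤ n → V 0 y = n + 1
  row : ∀ k, 1 ≤ k → k ≤ n → Row n (V (k-1)) (T k) (V k) k
  out : ∀ i j, ¬ (1 ≤ i ∧ i ≤ n ∧ 1 ≤ j ∧ j ≤ n) → T i j ≠ .blank

/-- the rows `k+1, …, k+m` of the grid -/
def rowsOf (T : ℕ → ℕ → Tile) (k m : ℕ) : List (ℕ → Tile) := (List.range' (k+1) m).map T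

theorem LG.flow {n T V} (hg : LG n T V) {k m J} (hk : k + m ≤ n) (hv : Valid n (V k) J) :
    ∃ K, Flow (rowsOf T k m) J K ∧ Valid n (V (k+m)) K := by
  induction m generalizing k J with
  | zero => exact ⟨J, Flow.nil _, hv⟩
  | succ m ih =>
    obtain ⟨J', τ', a, b, c⟩ := row_run (hg.row (k+1) (by omega) (by omega)) (by omega) hv
    obtain ⟨K, d, e⟩ := ih (k := k+1) (by omega) c
    refine ⟨K, ?_, by rw [show k + (m+1) = k + 1 + m by omega]; exact e⟩
    unfold rowsOf
    rw [List.range'_succ, List.map_cons]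
    exact Flow.cons a d

theorem LG.finB {n T V} (hg : LG n T V) {k m} : ∀ τ ∈ rowsOf T k m, FinB τ := by
  intro τ hτ
  simp only [rowsOf, List.mem_map] at hτ
  obtain ⟨i, -, rfl⟩ := hτ
  refine ⟨Finset.Icc 1 n, fun y hy => ?_⟩
  by_contra hc
  simp only [Finset.mem_Icc] at hc
  exact hg.out i y (by omega) hy



/-! ### Counting labels -/

theorem Icc_succ_sum (n : ℕ) (f : ℕ → ℕ) :
    ∑ z ∈ Finset.Icc 1 (n+1), f z = ∑ z ∈ Finset.Icc 1 n, f z + f (n+1) := by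
  rw [Finset.sum_Icc_succ_top (by omega)]

theorem loc_balance {M t u l w e} (h : Loc M t u l w e) (f : ℕ → ℕ) (hf : f M = 0) :
    f l + f w = f u + f e := by
  cases t <;> simp only [Loc] at h
  · obtain ⟨rfl, rfl, rfl, rfl⟩ := h; rfl
  · obtain ⟨rfl, -, rfl, rfl⟩ := h; rfl
  · obtain ⟨rfl, rfl, rfl, -⟩ := h; omega
  · obtain ⟨rfl, rfl, rfl, -⟩ := h; omega
  · obtain ⟨rfl, -, rfl, rfl⟩ := h; omega
  · obtain ⟨rfl, rfl, -, -⟩ := h; rfl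

theorem row_balance {n k : ℕ} {U L h : ℕ → ℕ} {τ : ℕ → Tile} (hh : h 0 = n + 1 ∧ h n = k ∧ ∀ y, 1 ≤ y → y ≤ n → Loc (n+1) (τ y) (U y) (L y) (h (y-1)) (h y))
    (f : ℕ → ℕ) (hf : f (n+1) = 0) (y : ℕ) (hy : y ≤ n) :
    ∑ z ∈ Finset.Icc 1 y, f (L z) = ∑ z ∈ Finset.Icc 1 y, f (U z) + f (h y) := by
  induction y with
  | zero => simp [hh.1, hf]
  | succ y ih =>
    rw [Icc_succ_sum, Icc_succ_sum, ih (by omega)]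
    have := loc_balance (hh.2.2 (y+1) (by omega) hy) f hf
    rw [Nat.add_sub_cancel] at this
    omega

theorem LG.balance {n T V} (hg : LG n T V) (f : ℕ → ℕ) (hf : f (n+1) = 0) (k : ℕ) (hk : k ≤ n) :
    ∑ z ∈ Finset.Icc 1 n, f (V k z) = ∑ i ∈ Finset.Icc 1 k, f i := by
  induction k with
  | zero =>
    simp only [Finset.Icc_self, zero_lt_one, Finset.Icc_eq_empty_of_lt, Finset.sum_empty]
    apply Finset.sum_eq_zero
    intro z hz; simp at hz; rw [hg.top z hz.1 hz.2, hf]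
  | succ k ih =>
    obtain ⟨h, hh⟩ := hg.row (k+1) (by omega) hk
    have := row_balance hh f hf n le_rfl
    rw [hh.2.1, Nat.add_sub_cancel, ih (by omega)] at this
    rw [this, Icc_succ_sum]

theorem LG.label_count {n T V} (hg : LG n T V) {k} (hk : k ≤ n) {l} (hl : l ≤ n) :
    ((Finset.Icc 1 n).filter (fun z => V k z = l)).card = if 1 ≤ l ∧ l ≤ k then 1 else 0 := by
  have := hg.balance (fun x => if x = l then 1 else 0) (by simp; omega) k hk
  rw [Finset.card_filter, this, Finset.sum_ite_eq']
  simp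

theorem LG.label_le {n T V} (hg : LG n T V) {k} (hk : k ≤ n) {y} (h1 : 1 ≤ y) (h2 : y ≤ n) :
    (1 ≤ V k y ∧ V k y ≤ k) ∨ V k y = n + 1 := by
  have hle : V k y ≤ n + 1 := by
    rcases Nat.eq_zero_or_pos k with rfl | hk0
    · rw [hg.top y h1 h2]
    · obtain ⟨h, hh⟩ := hg.row k hk0 hk
      have := hh.2.2 y h1 h2
      revert this
      cases T k y <;> simp only [Loc] <;> intro q <;> first | omega | exact q.elim
  by_contra hc
  push Not at hc
  have := hg.label_count hk (l := V k y) (by omega)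
  rw [if_neg (by omega), Finset.card_eq_zero, Finset.filter_eq_empty_iff] at this
  exact this (by simp; omega) rfl

theorem LG.label_inj {n T V} (hg : LG n T V) {k} (hk : k ≤ n) {y z} (h1 : 1 ≤ y) (h2 : y ≤ n)
    (h3 : 1 ≤ z) (h4 : z ≤ n) (hne : y ≠ z) (he : V k y = V k z) : V k y = n + 1 := by
  by_contra hc
  have hl := hg.label_le hk h1 h2
  have := hg.label_count hk (l := V k y) (by omega)
  rw [if_pos (by omega), Finset.card_eq_one] at this
  obtain ⟨a, ha⟩ := this
  have m1 : y ∈ ({a} : Finset ℕ) := by rw [← ha]; simp; omega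
  have m2 : z ∈ ({a} : Finset ℕ) := by rw [← ha]; simp; omega
  simp at m1 m2; omega

theorem LG.label_ex {n T V} (hg : LG n T V) {k} (hk : k ≤ n) {l} (h1 : 1 ≤ l) (h2 : l ≤ k) :
    ∃ y, 1 ≤ y ∧ y ≤ n ∧ V k y = l := by
  have := hg.label_count hk (l := l) (by omega)
  rw [if_pos ⟨h1, h2⟩] at this
  obtain ⟨a, ha⟩ := Finset.card_eq_one.1 this
  have m1 : a ∈ (Finset.Icc 1 n).filter (fun z => V k z = l) := by rw [ha]; simp
  simp at m1; exact ⟨a, m1.1.1, m1.1.2, m1.2⟩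

/-! ### Following pipes in a row -/

section carry
variable {n k : ℕ} {U L h : ℕ → ℕ} {τ : ℕ → Tile}

theorem carryL (hh : h 0 = n + 1 ∧ h n = k ∧ ∀ y, 1 ≤ y → y ≤ n → Loc (n+1) (τ y) (U y) (L y) (h (y-1)) (h y))
    {y : ℕ} (hy : y ≤ n) (hr : h y < n + 1) :
    ∃ y', 1 ≤ y' ∧ y' ≤ y ∧ L y' = h y ∧ U y' = n + 1 ∧
      ∀ z, y' < z → z ≤ y → L z = U z ∧ (U z < h y ∨ U z = n + 1) := by
  induction y with
  | zero => have := hh.1; omega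
  | succ y ih =>
    have q := hh.2.2 (y+1) (by omega) hy
    rw [Nat.add_sub_cancel] at q
    have key : (L (y+1) = h (y+1) ∧ U (y+1) = n + 1) ∨
        (h y = h (y+1) ∧ L (y+1) = U (y+1) ∧ (U (y+1) < h (y+1) ∨ U (y+1) = n + 1)) := by
      revert q
      cases τ (y+1) <;> simp only [Loc] <;> intro q <;> first | omega | exact q.elim
    rcases key with ⟨a, b⟩ | ⟨a, b, c⟩
    · exact ⟨y+1, by omega, le_rfl, a, b, fun z z1 z2 => by omega⟩
    · obtain ⟨y', b1, b2, b3, b4, b5⟩ := ih (by omega) (by omega)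
      refine ⟨y', b1, by omega, by omega, b4, fun z z1 z2 => ?_⟩
      rcases Nat.eq_or_lt_of_le z2 with rfl | z2
      · exact ⟨b, c⟩
      · rw [← a]; exact b5 z z1 (by omega)

theorem carryU (hh : h 0 = n + 1 ∧ h n = k ∧ ∀ y, 1 ≤ y → y ≤ n → Loc (n+1) (τ y) (U y) (L y) (h (y-1)) (h y))
    {y : ℕ} (h1 : 1 ≤ y) (hy : y ≤ n) (hr : U y < n + 1) :
    ∃ y', 1 ≤ y' ∧ y' ≤ y ∧ L y' = U y ∧ (y' = y ∨ (y' < y ∧ U y' = n + 1 ∧ L y = n + 1 ∧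
      ∀ z, y' < z → z < y → L z = U z ∧ (U z < U y ∨ U z = n + 1))) := by
  have q := hh.2.2 y h1 hy
  have key : L y = U y ∨ (h (y-1) = U y ∧ L y = n + 1) := by
    revert q
    cases τ y <;> simp only [Loc] <;> intro q <;> first | omega | exact q.elim
  rcases key with a | ⟨a, b⟩
  · exact ⟨y, h1, le_rfl, a, Or.inl rfl⟩
  · obtain ⟨y', b1, b2, b3, b4, b5⟩ := carryL hh (y := y-1) (by omega) (by omega)
    refine ⟨y', b1, by omega, by omega, Or.inr ⟨by omega, b4, b, fun z z1 z2 => ?_⟩⟩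
    rw [← a]; exact b5 z z1 (by omega)

theorem carryR (hh : h 0 = n + 1 ∧ h n = k ∧ ∀ y, 1 ≤ y → y ≤ n → Loc (n+1) (τ y) (U y) (L y) (h (y-1)) (h y))
    {y : ℕ} (hy : y ≤ n) (hr : h y < n + 1) :
    (h y = k ∧ ∀ z, y < z → z ≤ n → (τ z = .horiz ∨ τ z = .cross)) ∨
    ∃ y2, y < y2 ∧ y2 ≤ n ∧ τ y2 = .nw ∧ U y2 = h y ∧ L y2 = n + 1 ∧
      ∀ z, y < z → z < y2 → L z = U z ∧ (U z < h y ∨ U z = n + 1) := by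
  obtain ⟨m, hm⟩ : ∃ m, m = n - y := ⟨_, rfl⟩
  induction m generalizing y with
  | zero =>
    obtain rfl : y = n := by omega
    left; exact ⟨hh.2.1, fun z z1 z2 => by omega⟩
  | succ m ih =>
    have q := hh.2.2 (y+1) (by omega) (by omega)
    rw [Nat.add_sub_cancel] at q
    have key : (τ (y+1) = .nw ∧ U (y+1) = h y ∧ L (y+1) = n + 1) ∨
        ((τ (y+1) = .horiz ∨ τ (y+1) = .cross) ∧ h y = h (y+1) ∧ L (y+1) = U (y+1) ∧ (U (y+1) < h y ∨ U (y+1) = n + 1)) := by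
      revert q
      cases τ (y+1) <;> simp only [Loc, reduceCtorEq, false_and, true_and, or_false, false_or, or_true, and_true] <;> intro q <;> first | omega | exact q.elim
    rcases key with ⟨a, b, c⟩ | ⟨a, b, c⟩
    · right; exact ⟨y+1, by omega, by omega, a, b, c, fun z z1 z2 => by omega⟩
    · rcases ih (y := y+1) (by omega) (by omega) (by omega) with ⟨d1, d2⟩ | ⟨y2, d1, d2, d3, d4, d5, d6⟩
      · left
        refine ⟨by omega, fun z z1 z2 => ?_⟩
        rcases Nat.eq_or_lt_of_le z1 with rfl | z1
        · exact a
        · exact d2 z z1 z2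
      · right
        refine ⟨y2, by omega, d2, d3, by omega, d5, fun z z1 z2 => ?_⟩
        rcases Nat.eq_or_lt_of_le z1 with rfl | z1
        · exact c
        · rw [b]; exact d6 z z1 z2

end carry

/-- inversions between real labels persist -/
theorem inv_persist {n k U τ L} (hr : Row n U τ L k) {a b} (h1 : 1 ≤ a) (h2 : a < b) (h3 : b ≤ n)
    (h4 : U b < U a) (h5 : U a < n + 1) :
    ∃ a' b', 1 ≤ a' ∧ a' < b' ∧ b' ≤ b ∧ L a' = U a ∧ L b' = U b := by
  obtain ⟨h, hh⟩ := hr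
  obtain ⟨a', a1, a2, a3, a4⟩ := carryU hh h1 (by omega) h5
  obtain ⟨b', b1, b2, b3, b4⟩ := carryU hh (y := b) (by omega) h3 (by omega)
  refine ⟨a', b', a1, ?_, b2, a3, b3⟩
  rcases b4 with rfl | ⟨b4, b5, b6, b7⟩
  · omega
  · by_contra hc
    rcases Nat.lt_or_ge b' a with h | h
    · have := b7 a h h2; omega
    · have : a = b' := by omega
      subst this; omega

theorem bad_row {n k U τ L} (hr : Row n U τ L k) (hk : k ≤ n)
    (hU : ∀ y, 1 ≤ y → y ≤ n → U y < k ∨ U y = n + 1) (hbad : Bad n U) : Bad n L := by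
  obtain ⟨a, b, c, d, h1, h2, h3, h4, h5, h6, h7, h8⟩ := hbad
  have ha := hU a h1 (by omega)
  have hb := hU b (by omega) (by omega)
  have hcU := hU c (by omega) (by omega)
  have hd := hU d (by omega) (by omega)
  obtain ⟨a', b', p1, p2, p3, p4, p5⟩ := inv_persist hr h1 h2 (by omega) h6 (by omega)
  obtain ⟨h, hh⟩ := hr
  obtain ⟨d', d1, d2, d3, d4⟩ := carryU hh (y := d) (by omega) h5 (by omega)
  rcases Nat.lt_or_ge c d' with hcd | hcd
  · by_cases hLc : U d < L c
    · exact ⟨a', b', c, d', p1, p2, by omega, hcd, by omega, by omega, by omega, by omega⟩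
    · have q := hh.2.2 c (by omega) (by omega)
      have key : U c = n + 1 ∧ h c = L c ∧ L c < n + 1 := by
        revert q
        cases τ c <;> simp only [Loc] <;> intro q <;> first | omega | exact q.elim
      rcases carryR hh (y := c) (by omega) (by omega) with ⟨e1, -⟩ | ⟨y2, e1, e2, e3, e4, e5, e6⟩
      · omega
      · rcases lt_trichotomy d y2 with g | g | g
        · have := e6 d h4 g; omega
        · subst g
          rcases Nat.eq_or_lt_of_le d2 with rfl | g
          · omega
          · have := e6 d' hcd g; omega
        · refine ⟨a', b', y2, d', p1, p2, by omega, ?_, by omega, by omega, by omega, by omega⟩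
          by_contra hc
          rcases Nat.eq_or_lt_of_le (Nat.le_of_not_lt hc) with rfl | g2
          · omega
          · rcases d4 with rfl | ⟨-, -, -, d7⟩
            · omega
            · have := d7 y2 g2 g; omega
  · rcases d4 with rfl | ⟨d4, d5, d6, d7⟩
    · omega
    obtain ⟨y', e1, e2, e3, e4, e5⟩ := carryL hh (y := n) le_rfl (by rw [hh.2.1]; omega)
    rw [hh.2.1] at e3
    have hdy : d < y' := by
      by_contra hc
      rcases Nat.eq_or_lt_of_le (Nat.le_of_not_lt hc) with rfl | g
      · omega
      · have := e5 d g h5; omega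
    exact ⟨a', b', d, y', p1, p2, by omega, hdy, e2, by omega, by omega, by omega⟩

theorem LG.bad_mono {n T V} (hg : LG n T V) {i k} (hik : i ≤ k) (hk : k ≤ n) (h : Bad n (V i)) :
    Bad n (V k) := by
  induction k, hik using Nat.le_induction with
  | base => exact h
  | succ k hik ih =>
    refine bad_row (hg.row (k+1) (by omega) hk) hk ?_ (by simpa using ih (by omega))
    intro y h1 h2
    have := hg.label_le (k := k) (by omega) h1 h2
    simp; omega

theorem LG.inv_mono {n T V} (hg : LG n T V) {i k a b} (hik : i ≤ k) (hk : k ≤ n) (h1 : 1 ≤ a) (h2 : a < b) (h3 : b ≤ n)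
    (h4 : V i b < V i a) (h5 : V i a < n + 1) :
    ∃ a' b', 1 ≤ a' ∧ a' < b' ∧ b' ≤ b ∧ V k a' = V i a ∧ V k b' = V i b := by
  induction k, hik using Nat.le_induction with
  | base => exact ⟨a, b, h1, h2, le_rfl, rfl, rfl⟩
  | succ k hik ih =>
    obtain ⟨a', b', p1, p2, p3, p4, p5⟩ := ih (by omega)
    have hr := hg.row (k+1) (by omega) hk
    rw [Nat.add_sub_cancel] at hr
    obtain ⟨a'', b'', q1, q2, q3, q4, q5⟩ := inv_persist hr p1 p2 (by omega) (by omega) (by omega)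
    exact ⟨a'', b'', q1, q2, by omega, by omega, by omega⟩

theorem LG.cross_blank {n T V} (hg : LG n T V) {x y i j} (hx : 1 ≤ x) (hxi : x ≤ i) (hi : i ≤ n)
    (hy : 1 ≤ y) (hyj : y < j) (hj : j ≤ n) (hc : T x y = .cross) (hb : T i j = .blank) :
    Bad n (V i) := by
  obtain ⟨h, hh⟩ := hg.row x hx (by omega)
  have q := hh.2.2 y hy (by omega)
  rw [hc] at q; simp only [Loc] at q
  obtain ⟨y', b1, b2, b3, b4, b5⟩ := carryL hh (y := y-1) (by omega) (by omega)
  obtain ⟨a', b', p1, p2, p3, p4, p5⟩ := hg.inv_mono (a := y') (b := y) hxi hi b1 (by omega) (by omega) (by omega) (by omega)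
  obtain ⟨h', hh'⟩ := hg.row i (by omega) hi
  have q' := hh'.2.2 j (by omega) hj
  rw [hb] at q'; simp only [Loc] at q'
  obtain ⟨z, e1, e2, e3, e4, e5⟩ := carryL hh' (y := n) le_rfl (by rw [hh'.2.1]; omega)
  rw [hh'.2.1] at e3
  have hjz : j < z := by
    by_contra hc
    rcases Nat.eq_or_lt_of_le (Nat.le_of_not_lt hc) with rfl | g
    · omega
    · -- the tiles right of z carry a horizontal strand
      have hz := hh'.2.2 z e1 e2
      have : h' z = i := by
        revert hz
        cases T i z <;> simp only [Loc] <;> intro q <;> first | omega | exact q.elim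
      rcases carryR hh' (y := z) e2 (by omega) with ⟨-, f⟩ | ⟨y2, f1, f2, f3, f4, f5, f6⟩
      · have := f j g hj; rw [hb] at this; simp at this
      · have := e5 y2 f1 f2; omega
  have la := hg.label_le hi (y := a') p1 (by omega)
  have : V i a' ≠ i := by
    intro he
    have := hg.label_inj hi p1 (by omega) e1 e2 (by omega) (he.trans e3.symm)
    omega
  exact ⟨a', b', j, z, p1, p2, by omega, hjz, e2, by omega, by omega, by omega⟩

/-! ### Rank function -/

def rk (V : ℕ → ℕ → ℕ) (n x y : ℕ) : ℕ := ∑ z ∈ Finset.Icc 1 y, if V x z ≤ n then 1 else 0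

theorem rk_zero {V n x} : rk V n x 0 = 0 := by simp [rk]

theorem LG.rk_top {n T V} (hg : LG n T V) {y} (hy : y ≤ n) : rk V n 0 y = 0 := by
  unfold rk
  apply Finset.sum_eq_zero
  intro z hz; simp at hz
  rw [hg.top z hz.1 (by omega), if_neg (by omega)]

theorem LG.rk_row {n T V} (hg : LG n T V) {x y} (hx : x + 1 ≤ n) (h1 : 1 ≤ y) (hy : y ≤ n) :
    rk V n (x+1) y = rk V n x y + if hasE (T (x+1) y) then 1 else 0 := by
  obtain ⟨h, hh⟩ := hg.row (x+1) (by omega) hx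
  have := row_balance hh (fun v => if v ≤ n then 1 else 0) (by simp) y hy
  unfold rk
  rw [this, Nat.add_sub_cancel]
  congr 1
  have q := hh.2.2 y h1 hy
  revert q
  cases T (x+1) y <;> simp only [Loc, hasE] <;> intro q
  all_goals first | exact q.elim | (rw [if_pos (by omega)]; rfl) | (rw [if_neg (by omega)]; rfl)

theorem LG.rk_diag {n T V} (hg : LG n T V) {x y} (hx : x + 1 ≤ n) (hy : y + 1 ≤ n) (hc : T (x+1) (y+1) ≠ .cross) :
    rk V n (x+1) (y+1) + (if T (x+1) (y+1) = .blank then 1 else 0) = rk V n x y + 1 := by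
  rw [hg.rk_row hx (by omega) hy]
  unfold rk
  rw [Icc_succ_sum]
  obtain ⟨h, hh⟩ := hg.row (x+1) (by omega) hx
  have q := hh.2.2 (y+1) (by omega) hy
  rw [Nat.add_sub_cancel] at q
  revert q hc
  cases T (x+1) (y+1) <;> simp only [Loc, hasE] <;> intro hc q
  all_goals first
    | exact q.elim
    | exact absurd rfl hc
    | (rw [if_pos (by omega)]; simp; done)
    | (rw [if_neg (by omega)]; simp; done)

theorem LG.rk_total {n T V} (hg : LG n T V) {x} (hx : x ≤ n) : rk V n x n = x := by
  unfold rk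
  rw [hg.balance (fun v => if v ≤ n then 1 else 0) (by simp) x hx]
  rw [Finset.sum_congr rfl (g := fun _ => 1) (fun i hi => by simp at hi; rw [if_pos (by omega)])]
  simp

theorem rk_le {V n x y} : rk V n x y ≤ y := by
  unfold rk
  rw [← Finset.card_filter]
  exact (Finset.card_filter_le _ _).trans (by simp)

theorem LG.rk_le_row {n T V} (hg : LG n T V) {x y} (hx : x ≤ n) (hy : y ≤ n) : rk V n x y ≤ x := by
  conv_rhs => rw [← hg.rk_total hx]
  unfold rk
  apply Finset.sum_le_sum_of_subset
  intro z; simp; omega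

theorem LG.blank_box {n T V} (hg : LG n T V) {i j} (hi : 1 ≤ i) (hin : i ≤ n) (hj : 1 ≤ j) (hjn : j ≤ n) :
    i - rk V n i j ≤ colN n (V i) (j - rk V n i j) := by
  have e : i - rk V n i j = ((Finset.Icc 1 n).filter (fun z => j < z ∧ V i z ≤ n)).card := by
    have h1 := hg.rk_total hin
    have h2 : rk V n i n = rk V n i j + ((Finset.Icc 1 n).filter (fun z => j < z ∧ V i z ≤ n)).card := by
      unfold rk
      rw [← Finset.card_filter, ← Finset.card_filter, ← Finset.card_union_of_disjoint]
      · congr 1; ext z; simp; omega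
      · rw [Finset.disjoint_left]; intro z; simp; omega
    omega
  have e2 : j - rk V n i j = ((Finset.Icc 1 j).filter (fun z => ¬ V i z ≤ n)).card := by
    have := Finset.card_filter_add_card_filter_not (s := Finset.Icc 1 j) (fun z => V i z ≤ n)
    unfold rk
    rw [← Finset.card_filter]
    simp at this ⊢; omega
  rw [e]
  unfold colN
  apply Finset.card_le_card
  intro z hz
  simp only [Finset.mem_filter, Finset.mem_Icc] at hz ⊢
  refine ⟨hz.1, ?_⟩
  rw [e2, cst_card]
  apply Finset.card_le_card
  intro y hy
  simp only [Finset.mem_filter, Finset.mem_Icc] at hy ⊢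
  omega



/-! ### Labels of a bumpless pipe dream -/

def lLab (M : ℕ) : Tile → ℕ → ℕ → ℕ
  | .vert, u, _ => u
  | .cross, u, _ => u
  | .se, _, e => e
  | _, _, _ => M

def wLab (M : ℕ) : Tile → ℕ → ℕ → ℕ
  | .horiz, _, e => e
  | .cross, _, e => e
  | .nw, u, _ => u
  | _, _, _ => M

def hR (n : ℕ) (τ : ℕ → Tile) (U : ℕ → ℕ) (k : ℕ) : ℕ → ℕ
  | 0 => k
  | m + 1 => wLab (n+1) (τ (n-m)) (U (n-m)) (hR n τ U k m)

def Vl (g : Grid) : ℕ → ℕ → ℕ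
  | 0, _ => g.n + 1
  | k + 1, y => lLab (g.n+1) (g.tile (k+1) y) (Vl g k y)
      (hR g.n (g.tile (k+1)) (Vl g k) (k+1) (g.n-y))

def Hl (g : Grid) (k y : ℕ) : ℕ := hR g.n (g.tile k) (Vl g (k-1)) k (g.n-y)

/-- Local rule without the crossing condition. -/
def LocW (M : ℕ) : Tile → ℕ → ℕ → ℕ → ℕ → Prop
  | .blank, u, l, w, e => u = M ∧ l = M ∧ w = M ∧ e = M
  | .vert, u, l, w, e => u = l ∧ u < M ∧ w = M ∧ e = M
  | .horiz, u, l, w, e => u = M ∧ l = M ∧ w = e ∧ w < M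
  | .cross, u, l, w, e => u = l ∧ w = e ∧ e < M ∧ u < M
  | .se, u, l, w, e => u = M ∧ w = M ∧ l = e ∧ l < M
  | .nw, u, l, w, e => u = w ∧ u < M ∧ l = M ∧ e = M
  | .bump, _, _, _, _ => False

theorem locW_balance {M t u l w e} (h : LocW M t u l w e) (f : ℕ → ℕ) (hf : f M = 0) :
    f l + f w = f u + f e := by
  cases t <;> simp only [LocW] at h
  · obtain ⟨rfl, rfl, rfl, rfl⟩ := h; rfl
  · obtain ⟨rfl, -, rfl, rfl⟩ := h; rfl
  · obtain ⟨rfl, rfl, rfl, -⟩ := h; omega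
  · obtain ⟨rfl, rfl, rfl, -⟩ := h; omega
  · obtain ⟨rfl, -, rfl, rfl⟩ := h; omega
  · obtain ⟨rfl, rfl, -, -⟩ := h; rfl

theorem lab_loc {M t u e} (hb : t ≠ .bump) (hu : u ≤ M) (he : e ≤ M) (hN : u < M ↔ hasN t = true)
    (hE : e < M ↔ hasE t = true) :
    LocW M t u (lLab M t u e) (wLab M t u e) e ∧ lLab M t u e ≤ M ∧ wLab M t u e ≤ M ∧
    (lLab M t u e < M ↔ hasS t = true) ∧ (wLab M t u e < M ↔ hasW t = true) := by
  cases t <;> simp [hasN, hasE, hasS, hasW, LocW, lLab, wLab] at * <;> omega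


theorem lab_row_aux {g : Grid} (hB : IsBPD g) {k : ℕ} (hk : k + 1 ≤ g.n)
    (hU : ∀ y, 1 ≤ y → y ≤ g.n → Vl g k y ≤ g.n + 1 ∧ (Vl g k y < g.n + 1 ↔ hasN (g.tile (k+1) y) = true))
    (m : ℕ) (hm : m + 1 ≤ g.n) :
    hR g.n (g.tile (k+1)) (Vl g k) (k+1) m ≤ g.n + 1 ∧
    (hR g.n (g.tile (k+1)) (Vl g k) (k+1) m < g.n + 1 ↔ hasE (g.tile (k+1) (g.n - m)) = true) := by
  obtain ⟨b1, b2, b3, b4, b5, b6, b7, b8, b9, b10⟩ := hB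
  induction m with
  | zero =>
    simp only [hR]
    refine ⟨by omega, ?_⟩
    rw [Nat.sub_zero, b9 (k+1) (by omega) hk]; simp; omega
  | succ m ih =>
    obtain ⟨i1, i2⟩ := ih (by omega)
    obtain ⟨u1, u2⟩ := hU (g.n - m) (by omega) (by omega)
    obtain ⟨-, -, c3, -, c5⟩ := lab_loc (b3 (k+1) (g.n-m) ⟨by omega, hk, by omega, by omega⟩) u1 i1 u2 i2
    refine ⟨c3, ?_⟩
    simp only [hR]
    rw [c5, b5 (k+1) (g.n - (m+1)) (by omega) hk (by omega) (by omega), show g.n - (m+1) + 1 = g.n - m by omega]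

theorem lab_row {g : Grid} (hB : IsBPD g) {k : ℕ} (hk : k ≤ g.n) (y : ℕ) (h1 : 1 ≤ y) (h2 : y ≤ g.n) :
    Vl g k y ≤ g.n + 1 ∧ (k + 1 ≤ g.n → (Vl g k y < g.n + 1 ↔ hasN (g.tile (k+1) y) = true)) := by
  have hB' := hB
  obtain ⟨b1, b2, b3, b4, b5, b6, b7, b8, b9, b10⟩ := hB
  induction k generalizing y with
  | zero =>
    simp only [Vl]
    refine ⟨le_rfl, fun _ => ?_⟩
    rw [b6 y h1 h2]; simp
  | succ k ih =>
    have hU : ∀ y, 1 ≤ y → y ≤ g.n → Vl g k y ≤ g.n + 1 ∧ (Vl g k y < g.n + 1 ↔ hasN (g.tile (k+1) y) = true) :=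
      fun y y1 y2 => ⟨(ih (by omega) y y1 y2).1, (ih (by omega) y y1 y2).2 hk⟩
    obtain ⟨i1, i2⟩ := lab_row_aux hB' hk hU (g.n - y) (by omega)
    rw [show g.n - (g.n - y) = y by omega] at i2
    obtain ⟨-, c2, c3, c4, c5⟩ := lab_loc (b3 (k+1) y ⟨by omega, hk, by omega, by omega⟩) (hU y h1 h2).1 i1 (hU y h1 h2).2 i2
    simp only [Vl]
    refine ⟨c2, fun hk' => ?_⟩
    rw [c4, b4 (k+1) y (by omega) (by omega) h1 h2]

theorem lab_locW {g : Grid} (hB : IsBPD g) {k y : ℕ} (hk : k + 1 ≤ g.n) (h1 : 1 ≤ y) (h2 : y ≤ g.n) :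
    LocW (g.n+1) (g.tile (k+1) y) (Vl g k y) (Vl g (k+1) y) (Hl g (k+1) (y-1)) (Hl g (k+1) y) := by
  have hU : ∀ y, 1 ≤ y → y ≤ g.n → Vl g k y ≤ g.n + 1 ∧ (Vl g k y < g.n + 1 ↔ hasN (g.tile (k+1) y) = true) :=
      fun y y1 y2 => ⟨(lab_row hB (by omega) y y1 y2).1, (lab_row hB (by omega) y y1 y2).2 hk⟩
  obtain ⟨i1, i2⟩ := lab_row_aux hB hk hU (g.n - y) (by omega)
  rw [show g.n - (g.n - y) = y by omega] at i2
  obtain ⟨c1, -, -, -, -⟩ := lab_loc (hB.2.2.1 (k+1) y ⟨by omega, hk, by omega, by omega⟩) (hU y h1 h2).1 i1 (hU y h1 h2).2 i2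
  have e : Hl g (k+1) (y-1) = wLab (g.n+1) (g.tile (k+1) y) (Vl g k y) (Hl g (k+1) y) := by
    unfold Hl
    rw [show g.n - (y-1) = (g.n - y) + 1 by omega]
    simp only [hR, Nat.add_sub_cancel]
    rw [show g.n - (g.n - y) = y by omega]
  rw [e]; exact c1

theorem lab_H0 {g : Grid} (hB : IsBPD g) {k : ℕ} (hk : k + 1 ≤ g.n) : Hl g (k+1) 0 = g.n + 1 := by
  have q := lab_locW hB hk (y := 1) le_rfl hB.1
  have w := hB.2.2.2.2.2.2.2.1 (k+1) (by omega) hk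
  revert q w
  cases g.tile (k+1) 1 <;> simp [LocW, hasW] <;> omega

theorem lab_Hn {g : Grid} {k : ℕ} : Hl g k g.n = k := by simp [Hl, hR]

theorem lab_balance {g : Grid} (hB : IsBPD g) (f : ℕ → ℕ) (hf : f (g.n+1) = 0) (k : ℕ) (hk : k ≤ g.n) :
    ∑ z ∈ Finset.Icc 1 g.n, f (Vl g k z) = ∑ i ∈ Finset.Icc 1 k, f i := by
  induction k with
  | zero => simp [Vl, hf]
  | succ k ih =>
    have key : ∀ y ≤ g.n, ∑ z ∈ Finset.Icc 1 y, f (Vl g (k+1) z) = ∑ z ∈ Finset.Icc 1 y, f (Vl g k z) + f (Hl g (k+1) y) := by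
      intro y hy
      induction y with
      | zero => simp [lab_H0 hB hk, hf]
      | succ y ihy =>
        rw [Icc_succ_sum, Icc_succ_sum, ihy (by omega)]
        have := locW_balance (lab_locW hB hk (y := y+1) (by omega) hy) f hf
        rw [Nat.add_sub_cancel] at this
        omega
    rw [key g.n le_rfl, ih (by omega), lab_Hn, Icc_succ_sum]

theorem lab_inj {g : Grid} (hB : IsBPD g) {k y z : ℕ} (hk : k ≤ g.n) (h1 : 1 ≤ y) (h2 : y ≤ g.n) (h3 : 1 ≤ z) (h4 : z ≤ g.n)
    (he : Vl g k y = Vl g k z) (hr : Vl g k y < g.n + 1) : y = z := by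
  by_contra hne
  have := lab_balance hB (fun x => if x = Vl g k y then 1 else 0) (by simp; omega) k hk
  rw [Finset.sum_ite_eq', ← Finset.card_filter] at this
  have h2 : 1 < ((Finset.Icc 1 g.n).filter (fun x => Vl g k x = Vl g k y)).card := by
    rw [Finset.one_lt_card]
    exact ⟨y, by simp; omega, z, by simp; omega, hne⟩
  rw [this] at h2
  split_ifs at h2 <;> omega

theorem lab_lek {g : Grid} (hB : IsBPD g) {k y : ℕ} (hk : k ≤ g.n) (h1 : 1 ≤ y) (h2 : y ≤ g.n) (hr : Vl g k y < g.n + 1) : 1 ≤ Vl g k y ∧ Vl g k y ≤ k := by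
  by_contra hc
  have := lab_balance hB (fun x => if x = Vl g k y then 1 else 0) (by simp; omega) k hk
  rw [Finset.sum_ite_eq', ← Finset.card_filter, if_neg (by simp; omega), Finset.card_eq_zero, Finset.filter_eq_empty_iff] at this
  exact this (by simp; omega) rfl

/-- tracing agrees with labels -/
theorem trace_lab {g : Grid} (hB : IsBPD g) (f x y : ℕ) (hx : 1 ≤ x) (hx2 : x ≤ g.n) (hy : 1 ≤ y) (hy2 : y ≤ g.n) (hf : x + (g.n - y) < f) :
    (Vl g x y < g.n + 1 → traceAux g f x y .north = some (Vl g x y)) ∧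
    (Hl g x (y-1) < g.n + 1 → traceAux g f x y .east = some (Hl g x (y-1))) := by
  induction f generalizing x y with
  | zero => omega
  | succ f ih =>
    obtain ⟨x, rfl⟩ : ∃ x', x = x' + 1 := ⟨x-1, by omega⟩
    have q := lab_locW hB hx2 hy hy2
    have hN : Vl g x y < g.n + 1 → x + 1 > 1 ∧ traceAux g f x y .north = some (Vl g x y) := by
      intro h
      rcases Nat.eq_zero_or_pos x with rfl | hx0
      · simp [Vl] at h
      · exact ⟨by omega, (ih x y hx0 (by omega) hy hy2 (by omega)).1 h⟩
    have hE : y < g.n → Hl g (x+1) y < g.n + 1 → traceAux g f (x+1) (y+1) .east = some (Hl g (x+1) y) := by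
      intro h h'
      exact (ih (x+1) (y+1) hx hx2 (by omega) h (by omega)).2 h'
    have hE' : ¬ y < g.n → Hl g (x+1) y = x + 1 := by
      intro h; rw [show y = g.n by omega]; exact lab_Hn
    constructor
    · intro hr
      simp only [traceAux]
      revert q
      cases g.tile (x+1) y <;> simp only [LocW, outDir] <;> intro q
      · omega
      · rw [if_neg (by omega), Nat.add_sub_cancel, ← q.1]; exact (hN (by omega)).2
      · omega
      · split_ifs with hc
        · rw [q.2.2.1, hE' (by omega)]
        · rw [q.2.2.1]; exact hE (by omega) (by omega)
      · omega
      · have := hN (by omega)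
        rw [if_neg (by omega), Nat.add_sub_cancel, ← q.1]; exact this.2
      · exact q.elim
    · intro hr
      simp only [traceAux]
      revert q
      cases g.tile (x+1) y <;> simp only [LocW, outDir] <;> intro q
      · omega
      · omega
      · split_ifs with hc
        · rw [q.2.2.1, hE' (by omega)]
        · rw [q.2.2.1]; exact hE (by omega) (by omega)
      · omega
      · have := hN (by omega)
        rw [if_neg (by omega), Nat.add_sub_cancel, ← q.1]; exact this.2
      · split_ifs with hc
        · rw [q.2.1, hE' (by omega)]
        · rw [q.2.1]; exact hE (by omega) (by omega)
      · exact q.elim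

theorem lab_bottom_real {g : Grid} (hB : IsBPD g) {c : ℕ} (h1 : 1 ≤ c) (h2 : c ≤ g.n) : Vl g g.n c < g.n + 1 := by
  obtain ⟨k, hk⟩ : ∃ k, g.n = k + 1 := ⟨g.n - 1, by have := hB.1; omega⟩
  have q := lab_locW hB (k := k) (y := c) (by omega) h1 h2
  have w := hB.2.2.2.2.2.2.1 c h1 h2
  rw [← hk] at q
  revert q w
  cases g.tile g.n c <;> simp only [LocW, hasS] <;> intro q w <;> first | exact q.elim | omega | (exact absurd w (by simp))

theorem exit_lab {g : Grid} (hB : IsBPD g) {c : ℕ} (h1 : 1 ≤ c) (h2 : c ≤ g.n) : exitRow g c = some (Vl g g.n c) :=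
  (trace_lab hB (2 * g.n + 2) g.n c hB.1 le_rfl h1 h2 (by omega)).1 (lab_bottom_real hB h1 h2)

theorem path_next_north {g : Grid} {f x0 y0 d0 x y d} (hy0 : y0 ≤ g.n) (hf : x0 + (g.n - y0) < f)
    (h : (x, y, d) ∈ pathAux g f x0 y0 d0) (hd : outDir (g.tile x y) d = some .north) (hx : 1 < x) :
    (x-1, y, .north) ∈ pathAux g f x0 y0 d0 := by
  induction f generalizing x0 y0 d0 with
  | zero => omega
  | succ f ih =>
    simp only [pathAux, List.mem_cons] at h ⊢
    right
    rcases h with h | h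
    · simp only [Prod.mk.injEq] at h
      obtain ⟨rfl, rfl, rfl⟩ := h
      rw [hd]; simp only
      rw [if_neg (by omega)]
      obtain ⟨f', rfl⟩ : ∃ f', f = f' + 1 := ⟨f-1, by omega⟩
      simp [pathAux]
    · revert h
      cases outDir (g.tile x0 y0) d0 with
      | none => simp
      | some d' =>
        cases d' <;> simp only
        · split_ifs with hc
          · simp
          · intro h; exact ih hy0 (by omega) h
        · split_ifs with hc
          · simp
          · intro h; exact ih (by omega) (by omega) h

theorem path_next_east {g : Grid} {f x0 y0 d0 x y d} (hx0 : 1 ≤ x0) (hy0 : y0 ≤ g.n) (hf : x0 + (g.n - y0) < f)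
    (h : (x, y, d) ∈ pathAux g f x0 y0 d0) (hd : outDir (g.tile x y) d = some .east) (hx : y < g.n) :
    (x, y+1, .east) ∈ pathAux g f x0 y0 d0 := by
  induction f generalizing x0 y0 d0 with
  | zero => omega
  | succ f ih =>
    simp only [pathAux, List.mem_cons] at h ⊢
    right
    rcases h with h | h
    · simp only [Prod.mk.injEq] at h
      obtain ⟨rfl, rfl, rfl⟩ := h
      rw [hd]; simp only
      rw [if_neg (by omega)]
      obtain ⟨f', rfl⟩ : ∃ f', f = f' + 1 := ⟨f-1, by omega⟩
      simp [pathAux]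
    · revert h
      cases outDir (g.tile x0 y0) d0 with
      | none => simp
      | some d' =>
        cases d' <;> simp only
        · split_ifs with hc
          · simp
          · intro h; exact ih (by omega) hy0 (by omega) h
        · split_ifs with hc
          · simp
          · intro h; exact ih hx0 (by omega) (by omega) h

theorem path_lab {g : Grid} (hB : IsBPD g) (m x y : ℕ) (hx : 1 ≤ x) (hx2 : x ≤ g.n) (hy : 1 ≤ y) (hy2 : y ≤ g.n) (hm : (g.n - x) + y ≤ m) :
    (Vl g x y < g.n + 1 → ∃ c, 1 ≤ c ∧ c ≤ g.n ∧ Vl g g.n c = Vl g x y ∧ (x, y, .north) ∈ pipePath g c) ∧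
    (Hl g x (y-1) < g.n + 1 → ∃ c, 1 ≤ c ∧ c ≤ g.n ∧ Vl g g.n c = Hl g x (y-1) ∧ (x, y, .east) ∈ pipePath g c) := by
  induction m generalizing x y with
  | zero => omega
  | succ m ih =>
    constructor
    · intro hr
      rcases Nat.eq_or_lt_of_le hx2 with he | hlt
      · subst he
        exact ⟨y, hy, hy2, rfl, by simp [pipePath, pathAux]⟩
      · have q := lab_locW hB hlt hy hy2
        obtain ⟨i1, i2⟩ := ih (x+1) y (by omega) hlt hy hy2 (by omega)
        have key : (∃ c d, 1 ≤ c ∧ c ≤ g.n ∧ Vl g g.n c = Vl g x y ∧ (x+1, y, d) ∈ pipePath g c ∧ outDir (g.tile (x+1) y) d = some .north) := by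
          revert q
          cases hT : g.tile (x+1) y <;> simp only [LocW] <;> intro q
          · omega
          · obtain ⟨c, c1, c2, c3, c4⟩ := i1 (by omega)
            exact ⟨c, .north, c1, c2, by omega, c4, rfl⟩
          · omega
          · omega
          · obtain ⟨c, c1, c2, c3, c4⟩ := i2 (by omega)
            exact ⟨c, .east, c1, c2, by omega, c4, rfl⟩
          · obtain ⟨c, c1, c2, c3, c4⟩ := i1 (by omega)
            exact ⟨c, .north, c1, c2, by omega, c4, rfl⟩
          · exact q.elim
        obtain ⟨c, d, c1, c2, c3, c4, c5⟩ := key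
        exact ⟨c, c1, c2, c3, path_next_north c2 (by omega) c4 c5 (by omega)⟩
    · intro hr
      obtain ⟨x, rfl⟩ : ∃ x', x = x' + 1 := ⟨x-1, by omega⟩
      rcases Nat.eq_or_lt_of_le hy with he | hlt
      · subst he
        rw [lab_H0 hB hx2] at hr; omega
      · obtain ⟨y, rfl⟩ : ∃ y', y = y' + 1 := ⟨y-1, by omega⟩
        rw [Nat.add_sub_cancel] at hr ⊢
        have q := lab_locW hB hx2 (y := y) (by omega) (by omega)
        obtain ⟨i1, i2⟩ := ih (x+1) y (by omega) hx2 (by omega) (by omega) (by omega)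
        have key : (∃ c d, 1 ≤ c ∧ c ≤ g.n ∧ Vl g g.n c = Hl g (x+1) y ∧ (x+1, y, d) ∈ pipePath g c ∧ outDir (g.tile (x+1) y) d = some .east) := by
          revert q
          cases hT : g.tile (x+1) y <;> simp only [LocW] <;> intro q
          · omega
          · omega
          · obtain ⟨c, c1, c2, c3, c4⟩ := i2 (by omega)
            exact ⟨c, .east, c1, c2, by omega, c4, rfl⟩
          · obtain ⟨c, c1, c2, c3, c4⟩ := i1 (by omega)
            exact ⟨c, .north, c1, c2, by omega, c4, rfl⟩
          · omega
          · obtain ⟨c, c1, c2, c3, c4⟩ := i2 (by omega)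
            exact ⟨c, .east, c1, c2, by omega, c4, rfl⟩
          · exact q.elim
        obtain ⟨c, d, c1, c2, c3, c4, c5⟩ := key
        exact ⟨c, c1, c2, c3, path_next_east hB.1 c2 (by omega) c4 c5 (by omega)⟩

/-- follow the horizontal pipe to the right -/
theorem lab_right {g : Grid} (hB : IsBPD g) {k y : ℕ} (hk : k + 1 ≤ g.n) (hy : y ≤ g.n) (hr : Hl g (k+1) y < g.n + 1) :
    (Hl g (k+1) y = k + 1 ∧ ∀ z, y < z → z ≤ g.n → Vl g (k+1) z < g.n + 1 → g.tile (k+1) z = .cross ∧ Hl g (k+1) (z-1) = Hl g (k+1) y) ∨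
    ∃ y2, y < y2 ∧ y2 ≤ g.n ∧ Vl g k y2 = Hl g (k+1) y ∧ Vl g (k+1) y2 = g.n + 1 ∧
      ∀ z, y < z → z < y2 → Vl g (k+1) z < g.n + 1 → g.tile (k+1) z = .cross ∧ Hl g (k+1) (z-1) = Hl g (k+1) y := by
  obtain ⟨m, hm⟩ : ∃ m, m = g.n - y := ⟨_, rfl⟩
  induction m generalizing y with
  | zero =>
    obtain rfl : y = g.n := by omega
    left; exact ⟨lab_Hn, fun z z1 z2 => by omega⟩
  | succ m ih =>
    have q := lab_locW hB hk (y := y+1) (by omega) (by omega)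
    rw [Nat.add_sub_cancel] at q
    have key : (Vl g k (y+1) = Hl g (k+1) y ∧ Vl g (k+1) (y+1) = g.n + 1) ∨
        (Hl g (k+1) (y+1) = Hl g (k+1) y ∧ (Vl g (k+1) (y+1) < g.n + 1 → g.tile (k+1) (y+1) = .cross)) := by
      revert q
      cases g.tile (k+1) (y+1) <;> simp [LocW] <;> omega
    rcases key with ⟨a, b⟩ | ⟨a, b⟩
    · right; exact ⟨y+1, by omega, by omega, a, b, fun z z1 z2 => by omega⟩
    · rcases ih (y := y+1) (by omega) (by omega) (by omega) with ⟨d1, d2⟩ | ⟨y2, d1, d2, d4, d5, d6⟩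
      · left
        refine ⟨by omega, fun z z1 z2 z3 => ?_⟩
        rcases Nat.eq_or_lt_of_le z1 with rfl | z1
        · exact ⟨b z3, rfl⟩
        · rw [← a]; exact d2 z z1 z2 z3
      · right
        refine ⟨y2, by omega, d2, by omega, d5, fun z z1 z2 z3 => ?_⟩
        rcases Nat.eq_or_lt_of_le z1 with rfl | z1
        · exact ⟨b z3, rfl⟩
        · rw [← a]; exact d6 z z1 z2 z3

/-- an inversion in the wrong order forces a crossing above -/
theorem lab_cross_above {g : Grid} (hB : IsBPD g) {k a b : ℕ} (hk : k ≤ g.n) (h1 : 1 ≤ a) (h2 : a < b) (h3 : b ≤ g.n)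
    (h4 : Vl g k b < Vl g k a) (h5 : Vl g k a < g.n + 1) :
    ∃ x z, 1 ≤ x ∧ x ≤ k ∧ 1 ≤ z ∧ z ≤ g.n ∧ g.tile x z = .cross ∧ Vl g x z = Vl g k b ∧ Hl g x (z-1) = Vl g k a := by
  induction k generalizing a b with
  | zero => simp [Vl] at h5
  | succ k ih =>
    have up : ∀ c, 1 ≤ c → c ≤ g.n → Vl g (k+1) c < g.n + 1 →
        (Vl g k c = Vl g (k+1) c ∨ Hl g (k+1) c = Vl g (k+1) c) := by
      intro c c1 c2 c3
      have q := lab_locW hB hk c1 c2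
      revert q
      cases g.tile (k+1) c <;> simp [LocW] <;> omega
    -- up for b
    have ub : Vl g (k+1) b ≠ k + 1 → ∃ b', b ≤ b' ∧ b' ≤ g.n ∧ Vl g k b' = Vl g (k+1) b := by
      intro hne
      rcases up b (by omega) h3 (by omega) with e | e
      · exact ⟨b, le_rfl, h3, e⟩
      · rcases lab_right hB hk h3 (by omega) with ⟨d, -⟩ | ⟨y2, d1, d2, d3, -⟩
        · omega
        · exact ⟨y2, by omega, d2, by omega⟩
    have lb := lab_lek hB hk h1 (by omega) h5
    have fin : ∀ a', a ≤ a' → a' < b → Vl g k a' = Vl g (k+1) a → 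
      ∃ x z, 1 ≤ x ∧ x ≤ k + 1 ∧ 1 ≤ z ∧ z ≤ g.n ∧ g.tile x z = .cross ∧ Vl g x z = Vl g (k+1) b ∧ Hl g x (z-1) = Vl g (k+1) a := by
      intro a' a1 a2 a3
      obtain ⟨b', b1, b2, b3⟩ := ub (by omega)
      obtain ⟨x, z, c1, c2, c3, c4, c5, c6, c7⟩ := ih (a := a') (b := b') (by omega) (by omega) (by omega) b2 (by omega) (by omega)
      exact ⟨x, z, c1, by omega, c3, c4, c5, by omega, by omega⟩
    rcases up a h1 (by omega) h5 with e | e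
    · exact fin a le_rfl h2 e
    · rcases lab_right hB hk (y := a) (by omega) (by omega) with ⟨d, d'⟩ | ⟨y2, d1, d2, d3, d4, d5⟩
      · obtain ⟨p, q⟩ := d' b h2 h3 (by omega)
        exact ⟨k+1, b, by omega, le_rfl, by omega, h3, p, rfl, by omega⟩
      · rcases lt_trichotomy y2 b with c | c | c
        · exact fin y2 (by omega) c (by omega)
        · subst c; omega
        · obtain ⟨p, q⟩ := d5 b h2 c (by omega)
          exact ⟨k+1, b, by omega, le_rfl, by omega, h3, p, rfl, by omega⟩

theorem lab_strict {g : Grid} (hB : IsBPD g) {k y : ℕ} (hk : k + 1 ≤ g.n) (h1 : 1 ≤ y) (h2 : y ≤ g.n) (hc : g.tile (k+1) y = .cross) :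
    Vl g k y < Hl g (k+1) y := by
  have q := lab_locW hB hk h1 h2
  rw [hc] at q; simp only [LocW] at q
  by_contra hlt
  have lu := lab_lek hB (k := k) (by omega) h1 h2 q.2.2.2
  rcases lab_right hB hk h2 q.2.2.1 with ⟨d, -⟩ | ⟨y2, d1, d2, d3, -⟩
  · omega
  have hne : Vl g k y ≠ Vl g k y2 := by
    intro he
    have := lab_inj hB (k := k) (by omega) h1 h2 (by omega) d2 he q.2.2.2
    omega
  obtain ⟨x, z, c1, c2, c3, c4, c5, c6, c7⟩ := lab_cross_above hB (k := k) (a := y) (b := y2) (by omega) h1 d1 d2 (by omega) (by omega)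
  obtain ⟨p1, p1a, p1b, p1c, p1d⟩ := (path_lab hB _ (k+1) y (by omega) hk h1 h2 le_rfl).1 (by omega)
  obtain ⟨p2, p2a, p2b, p2c, p2d⟩ := (path_lab hB _ (k+1) y (by omega) hk h1 h2 le_rfl).2 (by omega)
  obtain ⟨p3, p3a, p3b, p3c, p3d⟩ := (path_lab hB _ x z c1 (by omega) c3 c4 le_rfl).1 (by omega)
  obtain ⟨p4, p4a, p4b, p4c, p4d⟩ := (path_lab hB _ x z c1 (by omega) c3 c4 le_rfl).2 (by omega)
  have e1 : p3 = p2 := lab_inj hB le_rfl p3a p3b p2a p2b (by omega) (lab_bottom_real hB p3a p3b)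
  have e2 : p4 = p1 := lab_inj hB le_rfl p4a p4b p1a p1b (by omega) (lab_bottom_real hB p4a p4b)
  subst e1 e2
  have hne2 : p4 ≠ p3 := by
    intro he; subst he; omega
  have := hB.2.2.2.2.2.2.2.2.2 p4 p3 p4a p4b p3a p3b hne2
    (show (k+1, y) ∈ _ from ⟨hc, ⟨_, p1d⟩, ⟨_, p2d⟩⟩) (show (x, z) ∈ _ from ⟨c5, ⟨_, p4d⟩, ⟨_, p3d⟩⟩)
  simp at this; omega

theorem bpd_LG {g : Grid} (hB : IsBPD g) : LG g.n g.tile (Vl g) := by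
  refine ⟨hB.1, fun y _ _ => rfl, ?_, ?_⟩
  · intro k h1 h2
    obtain ⟨k, rfl⟩ : ∃ k', k = k' + 1 := ⟨k-1, by omega⟩
    refine ⟨Hl g (k+1), lab_H0 hB h2, lab_Hn, fun y y1 y2 => ?_⟩
    have q := lab_locW hB h2 y1 y2
    have s := lab_strict hB h2 y1 y2
    rw [Nat.add_sub_cancel]
    revert q s
    cases g.tile (k+1) y <;> simp [LocW, Loc] <;> omega
  · intro i j h
    rw [hB.2.1 i j h]; simp



/-! ### Edge facts for labelled grids -/

section edges
variable {n : ℕ} {T : ℕ → ℕ → Tile} {V : ℕ → ℕ → ℕ}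

theorem LG.nb (hg : LG n T V) {x y} (h1 : 1 ≤ x) (h2 : x ≤ n) (h3 : 1 ≤ y) (h4 : y ≤ n) : T x y ≠ .bump := by
  obtain ⟨h, hh⟩ := hg.row x h1 h2
  have q := hh.2.2 y h3 h4
  intro e; rw [e] at q; exact q

theorem LG.hN (hg : LG n T V) {x y} (h2 : x + 1 ≤ n) (h3 : 1 ≤ y) (h4 : y ≤ n) :
    V x y ≤ n ↔ hasN (T (x+1) y) = true := by
  obtain ⟨h, hh⟩ := hg.row (x+1) (by omega) h2
  have q := hh.2.2 y h3 h4
  rw [Nat.add_sub_cancel] at q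
  revert q
  cases T (x+1) y <;> simp [Loc, hasN] <;> omega

theorem LG.hS (hg : LG n T V) {x y} (h1 : 1 ≤ x) (h2 : x ≤ n) (h3 : 1 ≤ y) (h4 : y ≤ n) :
    V x y ≤ n ↔ hasS (T x y) = true := by
  obtain ⟨h, hh⟩ := hg.row x h1 h2
  have q := hh.2.2 y h3 h4
  revert q
  cases T x y <;> simp [Loc, hasS] <;> omega

theorem LG.hEW (hg : LG n T V) {x y} (h1 : 1 ≤ x) (h2 : x ≤ n) (h3 : 1 ≤ y) (h4 : y ≤ n)
    (hw : hasW (T x y) = true) : 2 ≤ y ∧ hasE (T x (y-1)) = true := by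
  obtain ⟨h, hh⟩ := hg.row x h1 h2
  have q := hh.2.2 y h3 h4
  have hr : h (y-1) < n + 1 := by
    revert q hw
    cases T x y <;> simp [Loc, hasW] <;> omega
  have hy : y - 1 ≠ 0 := by
    intro e; rw [e, hh.1] at hr; omega
  refine ⟨by omega, ?_⟩
  have q2 := hh.2.2 (y-1) (by omega) (by omega)
  revert q2
  cases T x (y-1) <;> simp [Loc, hasE] <;> omega

theorem LG.bot (hg : LG n T V) {y} (h3 : 1 ≤ y) (h4 : y ≤ n) : V n y ≤ n := by
  have := hg.rk_total (x := n) le_rfl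
  unfold rk at this
  rw [← Finset.card_filter] at this
  have h2 : (Finset.Icc 1 n).filter (fun z => V n z ≤ n) = Finset.Icc 1 n := by
    apply Finset.eq_of_subset_of_card_le (Finset.filter_subset _ _)
    rw [this]; simp
  have h5 : y ∈ (Finset.Icc 1 n).filter (fun z => V n z ≤ n) := by rw [h2]; simp; omega
  simp at h5; exact h5.2

end edges

/-! ### Backward tracing -/

theorem back_le {g : Grid} (f x y : ℕ) (b : Bool) (c : ℕ) (h : backAux g f x y b = some c) : c ≤ y := by
  induction f generalizing x y b with
  | zero => simp [backAux] at h
  | succ f ih =>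
    simp only [backAux] at h
    have dn : (if x = g.n then some y else backAux g f (x+1) y true) = some c → c ≤ y := by
      intro h
      split_ifs at h
      · exact le_of_eq (Option.some.inj h).symm
      · exact ih _ _ _ h
    have lf : backAux g f x (y-1) false = some c → c ≤ y := by
      intro h
      have := ih _ _ _ h; omega
    by_cases h1 : g.n < x
    · rw [if_pos h1] at h; exact absurd h (by simp)
    rw [if_neg h1] at h
    by_cases h2 : b = true
    · rw [if_pos h2] at h
      revert h
      cases g.tile x y <;> simp only <;> intro h
      all_goals first
        | (exact absurd h (by simp))
        | exact dn h
        | exact lf h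
    · rw [if_neg h2] at h
      revert h
      cases g.tile x y <;> simp only <;> intro h
      all_goals first
        | (exact absurd h (by simp))
        | exact dn h
        | exact lf h

/-- vertical straight tile -/
def St (t : Tile) : Prop := t = .vert ∨ t = .cross

theorem back_straight {n T} (f x y : ℕ) (hx : x ≤ n) (hf : n - x < f) (hs : ∀ z, x ≤ z → z ≤ n → St (T z y)) :
    backAux ⟨n, T⟩ f x y true = some y := by
  induction f generalizing x with
  | zero => omega
  | succ f ih =>
    simp only [backAux]
    rw [if_neg (by omega), if_pos trivial]
    have key : (if x = n then some y else backAux ⟨n, T⟩ f (x+1) y true) = some y := by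
      split_ifs with h
      · rfl
      · exact ih (x+1) (by omega) (by omega) (fun z z1 z2 => hs z (by omega) z2)
    rcases hs x le_rfl hx with h | h <;> simp only [h] <;> exact key

theorem back_nw {n T} (f x y x' c : ℕ) (hx : x ≤ x') (hn : x' ≤ n) (hy : 1 ≤ y) (hs : ∀ z, x ≤ z → z < x' → St (T z y))
    (hT : T x' y = .nw) (h : backAux ⟨n, T⟩ f x y true = some c) : c < y := by
  induction f generalizing x with
  | zero => simp [backAux] at h
  | succ f ih =>
    simp only [backAux] at h
    rw [if_neg (by omega), if_pos trivial] at h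
    rcases Nat.eq_or_lt_of_le hx with rfl | hlt
    · simp only [hT] at h
      have := back_le _ _ _ _ _ h; omega
    · have key : (if x = n then some y else backAux ⟨n, T⟩ f (x+1) y true) = some c := by
        rcases hs x le_rfl hlt with h' | h' <;> simp only [h'] at h <;> exact h
      rw [if_neg (by omega)] at key
      exact ih (x+1) (by omega) (fun z z1 z2 => hs z (by omega) z2) key

theorem back_ex {n T V} (hg : LG n T V) (f x y : ℕ) (hx : 1 ≤ x) (hxn : x ≤ n) (hy : 1 ≤ y) (hyn : y ≤ n) (hf : (n - x) + y < f) :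
    (hasN (T x y) = true → ∃ c, backAux ⟨n, T⟩ f x y true = some c) ∧
    (hasE (T x y) = true → ∃ c, backAux ⟨n, T⟩ f x y false = some c) := by
  induction f generalizing x y with
  | zero => omega
  | succ f ih =>
    have down : hasS (T x y) = true → ∃ c, (if x = n then some y else backAux ⟨n, T⟩ f (x+1) y true) = some c := by
      intro h
      split_ifs with hc
      · exact ⟨y, rfl⟩
      · exact (ih (x+1) y (by omega) (by omega) hy hyn (by omega)).1
          ((hg.hN (by omega) hy hyn).1 ((hg.hS hx hxn hy hyn).2 h))
    have left : hasW (T x y) = true → ∃ c, backAux ⟨n, T⟩ f x (y-1) false = some c := by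
      intro h
      obtain ⟨a, b⟩ := hg.hEW hx hxn hy hyn h
      exact (ih x (y-1) hx hxn (by omega) (by omega) (by omega)).2 b
    simp only [backAux]
    simp only [if_neg (show ¬ n < x by omega), if_true, Bool.false_eq_true, if_false]
    revert down left
    have := hg.nb hx hxn hy hyn
    revert this
    cases T x y <;> simp [hasN, hasE, hasS, hasW] <;> tauto

/-! ### Columns -/

section col
variable {n : ℕ} {T : ℕ → ℕ → Tile} {V : ℕ → ℕ → ℕ}

theorem col_up (hg : LG n T V) {i k j} (hi : 1 ≤ i) (hik : i < k) (hk : k ≤ n + 1) (hj : 1 ≤ j) (hjn : j ≤ n)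
    (hb : T i j = .blank) (hr : V (k-1) j ≤ n) :
    ∃ κ, i < κ ∧ κ < k ∧ T κ j = .se ∧ ∀ z, κ < z → z < k → St (T z j) := by
  induction k, hik using Nat.le_induction with
  | base =>
    rw [Nat.succ_sub_one] at hr
    have := (hg.hS hi (by omega) hj hjn).1 hr
    rw [hb] at this; simp [hasS] at this
  | succ k hik ih =>
    rw [Nat.add_sub_cancel] at hr
    have s := (hg.hS (by omega) (by omega) hj hjn).1 hr
    have nb := hg.nb (x := k) (y := j) (by omega) (by omega) hj hjn
    by_cases hse : T k j = .se
    · exact ⟨k, by omega, by omega, hse, fun z z1 z2 => by omega⟩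
    · have st : St (T k j) := by
        revert s nb hse
        cases T k j <;> simp [hasS, St]
      have hr' : V (k-1) j ≤ n := by
        rw [hg.hN (by omega) hj hjn, show k - 1 + 1 = k by omega]
        rcases st with h | h <;> rw [h] <;> rfl
      obtain ⟨κ, a, b, c, d⟩ := ih (by omega) hr'
      refine ⟨κ, a, by omega, c, fun z z1 z2 => ?_⟩
      rcases Nat.eq_or_lt_of_le (Nat.le_of_lt_succ z2) with rfl | h
      · exact st
      · exact d z z1 h

theorem col_down (hg : LG n T V) {k e j} (hke : k < e) (he : e ≤ n + 1) (hj : 1 ≤ j) (hjn : j ≤ n)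
    (hr : V k j ≤ n) (hM : V (e-1) j = n + 1) :
    ∃ κ, k < κ ∧ κ < e ∧ T κ j = .nw ∧ ∀ z, k < z → z < κ → St (T z j) := by
  obtain ⟨m, hm⟩ : ∃ m, m = e - k := ⟨_, rfl⟩
  induction m generalizing k with
  | zero => omega
  | succ m ih =>
    have hne : k ≠ e - 1 := by intro h; subst h; omega
    have s := (hg.hN (x := k) (by omega) hj hjn).1 hr
    have nb := hg.nb (x := k+1) (y := j) (by omega) (by omega) hj hjn
    by_cases hse : T (k+1) j = .nw
    · exact ⟨k+1, by omega, by omega, hse, fun z z1 z2 => by omega⟩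
    · have st : St (T (k+1) j) := by
        revert s nb hse
        cases T (k+1) j <;> simp [hasN, St]
      have hr' : V (k+1) j ≤ n := by
        rw [hg.hS (by omega) (by omega) hj hjn]
        rcases st with h | h <;> rw [h] <;> rfl
      obtain ⟨κ, a, b, c, d⟩ := ih (k := k+1) (by omega) hr' (by omega)
      refine ⟨κ, by omega, b, c, fun z z1 z2 => ?_⟩
      rcases Nat.eq_or_lt_of_le z1 with rfl | h
      · exact st
      · exact d z h z2

theorem col_in (hg : LG n T V) {κ κ' j} (h1 : 1 ≤ κ) (he : κ' ≤ n + 1) (hj : 1 ≤ j) (hjn : j ≤ n)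
    (hs : T κ j = .se) (hno : ∀ z, κ < z → z < κ' → T z j ≠ .nw) (z : ℕ) (hz : κ < z) (hz2 : z < κ') : St (T z j) := by
  have hr : V (z-1) j ≤ n := by
    induction z, hz using Nat.le_induction with
    | base =>
      rw [Nat.succ_sub_one, hg.hS h1 (by omega) hj hjn, hs]; rfl
    | succ z hz ih =>
      have hr := ih (by omega)
      have s := (hg.hN (x := z-1) (by omega) hj hjn).1 hr
      rw [show z - 1 + 1 = z by omega] at s
      have := hno z (by omega) (by omega)
      have nb := hg.nb (x := z) (y := j) (by omega) (by omega) hj hjn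
      rw [Nat.add_sub_cancel, hg.hS (by omega) (by omega) hj hjn]
      revert s this nb
      cases T z j <;> simp [hasN, hasS]
  have s := (hg.hN (x := z-1) (by omega) hj hjn).1 hr
  rw [show z - 1 + 1 = z by omega] at s
  have := hno z (by omega) (by omega)
  have nb := hg.nb (x := z) (y := j) (by omega) (by omega) hj hjn
  revert s this nb
  cases T z j <;> simp [hasN, St]

end col

/-! ### The rewriting of one iteration -/

def qT (κ κ' j x y : ℕ) (t : Tile) : Tile :=
  if x = κ ∧ y = j then (match t with | Tile.se => Tile.vert | _ => t)
  else if x = κ' ∧ y = j then (match t with | Tile.nw => Tile.cross | _ => t)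
  else if x = κ ∧ y = j + 1 then (match t with | Tile.horiz => Tile.se | _ => t)
  else if x = κ' ∧ y = j + 1 then (match t with | Tile.blank => Tile.nw | _ => t)
  else if y = j + 1 ∧ κ < x ∧ x < κ' then
    (match t with | Tile.blank => Tile.vert | Tile.horiz => Tile.cross | _ => t)
  else t

theorem qfold (Q : List (ℕ × ℕ)) (T : ℕ → ℕ → Tile) (j x y : ℕ) :
    (Q.foldl (fun T kk => nablaQDroop T kk.1 kk.2 j) T) x y =
      Q.foldl (fun t kk => qT kk.1 kk.2 j x y t) (T x y) := by
  induction Q generalizing T with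
  | nil => rfl
  | cons p Q ih => simp only [List.foldl_cons]; rw [ih]; rfl

theorem qT_out {κ κ' j x y t} (h : ¬ (κ ≤ x ∧ x ≤ κ')) (hk : κ ≤ κ') : qT κ κ' j x y t = t := by
  unfold qT
  rw [if_neg (by omega), if_neg (by omega), if_neg (by omega), if_neg (by omega), if_neg (by omega)]

theorem qT_col {κ κ' j x y t} (h : y ≠ j) (h2 : y ≠ j + 1) : qT κ κ' j x y t = t := by
  unfold qT
  rw [if_neg (by omega), if_neg (by omega), if_neg (by omega), if_neg (by omega), if_neg (by omega)]

theorem qT_idem {κ κ' j x y t} : qT κ κ' j x y (qT κ κ' j x y t) = qT κ κ' j x y t := by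
  unfold qT
  split_ifs <;> cases t <;> rfl

theorem qfold_id {Q : List (ℕ × ℕ)} {j x y t} (h : ∀ p ∈ Q, ∀ t, qT p.1 p.2 j x y t = t) :
    Q.foldl (fun t kk => qT kk.1 kk.2 j x y t) t = t := by
  induction Q with
  | nil => rfl
  | cons p Q ih => simp only [List.foldl_cons]; rw [h p (by simp)]; exact ih (fun p hp => h p (by simp [hp]))

theorem qfold_one {Q : List (ℕ × ℕ)} {j x y t} {p : ℕ × ℕ} (hp : p ∈ Q)
    (h : ∀ q ∈ Q, q = p ∨ ∀ t, qT q.1 q.2 j x y t = t) :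
    Q.foldl (fun t kk => qT kk.1 kk.2 j x y t) t = qT p.1 p.2 j x y t := by
  have fix : ∀ Q' : List (ℕ × ℕ), (∀ q ∈ Q', q ∈ Q) → 
      Q'.foldl (fun t kk => qT kk.1 kk.2 j x y t) (qT p.1 p.2 j x y t) = qT p.1 p.2 j x y t := by
    intro Q' hQ'
    induction Q' with
    | nil => rfl
    | cons q Q' ih =>
      simp only [List.foldl_cons]
      have : qT q.1 q.2 j x y (qT p.1 p.2 j x y t) = qT p.1 p.2 j x y t := by
        rcases h q (hQ' q (by simp)) with rfl | h'
        · exact qT_idem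
        · exact h' _
      rw [this]; exact ih (fun q hq => hQ' q (by simp [hq]))
  have main : ∀ Q' : List (ℕ × ℕ), (∀ q ∈ Q', q ∈ Q) → p ∈ Q' →
      Q'.foldl (fun t kk => qT kk.1 kk.2 j x y t) t = qT p.1 p.2 j x y t := by
    intro Q' hQ' hp'
    induction Q' with
    | nil => simp at hp'
    | cons q Q' ih =>
      simp only [List.foldl_cons]
      rcases h q (hQ' q (by simp)) with rfl | h'
      · exact fix Q' (fun q hq => hQ' q (by simp [hq]))
      · rw [h']
        rcases List.mem_cons.1 hp' with rfl | hp'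
        · have := fix Q' (fun q hq => hQ' q (by simp [hq]))
          rw [h' t] at this
          rw [h' t]; exact this
        · exact ih (fun q hq => hQ' q (by simp [hq])) hp'
  exact main Q (fun _ h => h) hp



section pairs
variable {n : ℕ} {T : ℕ → ℕ → Tile} {V : ℕ → ℕ → ℕ}

theorem mem_qPairs {i i' j κ κ' : ℕ} (hn : i' ≤ n) : (κ, κ') ∈ qPairs ⟨n, T⟩ i i' j ↔
    i < κ ∧ κ < κ' ∧ κ' < i' ∧ T κ j = .se ∧ T κ' j = .nw ∧ ∀ z, κ < z → z < κ' → T z j ≠ .nw := by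
  unfold qPairs
  simp only [List.mem_filterMap]
  constructor
  · rintro ⟨k, hk, h⟩
    by_cases hc : i < k ∧ k < i' ∧ T k j = Tile.se
    · rw [if_pos hc] at h
      split at h
      · rename_i k' hf
        rw [List.find?_range'_eq_some] at hf
        obtain ⟨a, b, c⟩ := hf
        simp only [Option.some.injEq, Prod.mk.injEq] at h
        obtain ⟨rfl, rfl⟩ := h
        simp only [decide_eq_true_eq] at a
        refine ⟨hc.1, a.1, a.2.1, hc.2.2, a.2.2, fun z z1 z2 e => ?_⟩
        have := c z (by omega) z2
        simp [e, z1] at this; omega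
      · simp at h
    · rw [if_neg hc] at h; simp at h
  · rintro ⟨a, b, c, d, e, f⟩
    refine ⟨κ, by simp only [List.mem_range'_1]; omega, ?_⟩
    rw [if_pos ⟨a, by omega, d⟩]
    have : (List.range' 1 n).find? (fun k' => decide (κ < k' ∧ k' < i' ∧ T k' j = Tile.nw)) = some κ' := by
      rw [List.find?_range'_eq_some]
      refine ⟨by simp [b, c, e], by simp only [List.mem_range'_1]; omega, fun z z1 z2 => ?_⟩
      by_cases hz : κ < z
      · simp [f z hz z2]
      · simp; omega
    simp only [this]

theorem iter_eq (i i' j x y : ℕ) : (nablaIter ⟨n, T⟩ i i' j).tile x y =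
    (qPairs ⟨n, T⟩ i i' j).foldl (fun t kk => qT kk.1 kk.2 j x y t) (nablaUndroop T i i' j x y) := by
  unfold nablaIter
  simp only
  rw [qfold]

theorem iter_row {i i' j x : ℕ} (hn : i' ≤ n) (h : x ≤ i ∨ i' ≤ x) (y : ℕ) : (nablaIter ⟨n, T⟩ i i' j).tile x y =
    nablaUndroop T i i' j x y := by
  rw [iter_eq]
  apply qfold_id
  rintro ⟨κ, κ'⟩ hp t
  rw [mem_qPairs hn] at hp
  exact qT_out (by simp only; omega) (by simp only; omega)

theorem iter_col {i i' j x y : ℕ} (h : y ≠ j) (h2 : y ≠ j + 1) : (nablaIter ⟨n, T⟩ i i' j).tile x y = T x y := by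
  rw [iter_eq, qfold_id (fun p _ t => qT_col h h2)]
  unfold nablaUndroop
  simp only
  rw [if_neg (by omega), if_neg (by omega), if_neg (by omega), if_neg (by omega), if_neg (by omega), if_neg (by omega)]

theorem iter_out {i i' j x : ℕ} (hii : i < i') (hn : i' ≤ n) (h : x < i ∨ i' < x) : (nablaIter ⟨n, T⟩ i i' j).tile x = T x := by
  funext y
  rw [iter_row hn (by omega)]
  unfold nablaUndroop
  simp only
  rw [if_neg (by omega), if_neg (by omega), if_neg (by omega), if_neg (by omega), if_neg (by omega), if_neg (by omega)]

theorem eq_upd2 {τ τ' : ℕ → Tile} {j : ℕ} {a b : Tile} (h1 : τ' j = a) (h2 : τ' (j+1) = b)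
    (h3 : ∀ y, y ≠ j → y ≠ j + 1 → τ' y = τ y) : τ' = upd2 τ j a b := by
  funext y
  unfold upd2
  split_ifs with e1 e2
  · rw [e1, h1]
  · rw [e2, h2]
  · exact h3 y e1 e2

theorem iter_top {i i' j : ℕ} {t3 : Tile} (hii : i < i') (hn : i' ≤ n) (hb : T i j = .blank) (h3 : srcT (T i (j+1)) = some t3) :
    (nablaIter ⟨n, T⟩ i i' j).tile i = upd2 (T i) j .se t3 := by
  apply eq_upd2
  · rw [iter_row hn (by omega)]
    unfold nablaUndroop
    simp only
    rw [if_pos (by first | omega | (simp <;> omega)), hb]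
  · rw [iter_row hn (by omega)]
    unfold nablaUndroop
    simp only
    rw [if_neg (by omega), if_neg (by omega), if_pos (by first | omega | (simp <;> omega))]
    rcases srcT_cases h3 with ⟨a, b⟩ | ⟨a, b⟩ <;> rw [a, b]
  · intro y h1 h2; exact iter_col h1 h2

theorem iter_half {i i' j : ℕ} {t1 : Tile} (hii : i < i') (hn : i' ≤ n) (h3 : halfT (T i' j) (T i' (j+1)) = some t1) :
    (nablaIter ⟨n, T⟩ i i' j).tile i' = upd2 (T i') j t1 .blank := by
  obtain ⟨e, h⟩ := halfT_cases h3
  apply eq_upd2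
  · rw [iter_row hn (by omega)]
    unfold nablaUndroop
    simp only
    rw [if_neg (by omega), if_pos (by first | omega | (simp <;> omega))]
    rcases h with ⟨a, b⟩ | ⟨a, b⟩ <;> rw [a, b]
  · rw [iter_row hn (by omega)]
    unfold nablaUndroop
    simp only
    rw [if_neg (by omega), if_neg (by omega), if_neg (by omega), if_pos (by first | omega | (simp <;> omega)), e]
  · intro y h1 h2; exact iter_col h1 h2

theorem iter_fin {i i' j : ℕ} (hii : i < i') (hn : i' ≤ n) (h1 : T i' j = .se) (h2 : T i' (j+1) = .cross) :
    (nablaIter ⟨n, T⟩ i i' j).tile i' = upd2 (T i') j .vert .se := by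
  apply eq_upd2
  · rw [iter_row hn (by omega)]
    unfold nablaUndroop
    simp only
    rw [if_neg (by omega), if_pos (by first | omega | (simp <;> omega)), h1]
  · rw [iter_row hn (by omega)]
    unfold nablaUndroop
    simp only
    rw [if_neg (by omega), if_neg (by omega), if_neg (by omega), if_pos (by first | omega | (simp <;> omega)), h2]
  · intro y h1 h2; exact iter_col h1 h2

theorem pair_uniq (hg : LG n T V) {i i' j a a' b b' x : ℕ} (hn : i' ≤ n) (hj : 1 ≤ j) (hjn : j ≤ n)
    (h1 : (a, a') ∈ qPairs ⟨n, T⟩ i i' j) (h2 : (b, b') ∈ qPairs ⟨n, T⟩ i i' j)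
    (ha : a ≤ x) (ha' : x ≤ a') (hb : b ≤ x) (hb' : x ≤ b') : (a, a') = (b, b') := by
  rw [mem_qPairs hn] at h1 h2
  obtain ⟨p1, p2, p3, p4, p5, p6⟩ := h1
  obtain ⟨q1, q2, q3, q4, q5, q6⟩ := h2
  have e : a = b := by
    rcases lt_trichotomy a b with h | h | h
    · exfalso
      rcases Nat.eq_or_lt_of_le (show b ≤ a' by omega) with e | e
      · rw [e, p5] at q4; cases q4
      · have := col_in hg (by omega) (by omega) hj hjn p4 p6 b h e
        rcases this with r | r <;> rw [r] at q4 <;> cases q4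
    · exact h
    · exfalso
      rcases Nat.eq_or_lt_of_le (show a ≤ b' by omega) with e | e
      · rw [e, q5] at p4; cases p4
      · have := col_in hg (by omega) (by omega) hj hjn q4 q6 a h e
        rcases this with r | r <;> rw [r] at p4 <;> cases p4
  subst e
  have e : a' = b' := by
    rcases lt_trichotomy a' b' with h | h | h
    · exact absurd p5 (q6 _ p2 h)
    · exact h
    · exact absurd q5 (p6 _ q2 h)
  rw [e]

theorem iter_pass (hg : LG n T V) {i i' j k : ℕ} {t1 t2 : Tile} (hi : 1 ≤ i) (hn : i' ≤ n) (hj : 1 ≤ j) (hjn : j + 1 ≤ n)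
    (hb : T i j = .blank) (hM : V (i'-1) j = n + 1) (hk : i < k) (hk' : k < i')
    (hp : passT (T k j) (T k (j+1)) = some (t1, t2)) :
    (nablaIter ⟨n, T⟩ i i' j).tile k = upd2 (T k) j t1 t2 := by
  -- no pair
  have noP : (T k j = .blank ∨ T k j = .horiz) → ∀ y t, ∀ p ∈ qPairs ⟨n, T⟩ i i' j, qT p.1 p.2 j k y t = t := by
    rintro hT y t ⟨κ, κ'⟩ hp
    rw [mem_qPairs hn] at hp
    obtain ⟨p1, p2, p3, p4, p5, p6⟩ := hp
    apply qT_out (by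
      rintro ⟨a, b⟩
      simp only at a b
      rcases Nat.eq_or_lt_of_le a with rfl | a
      · rcases hT with h | h <;> rw [h] at p4 <;> cases p4
      rcases Nat.eq_or_lt_of_le b with rfl | b
      · rcases hT with h | h <;> rw [h] at p5 <;> cases p5
      rcases col_in hg (by omega) (by omega) hj (by omega) p4 p6 k a b with r | r <;>
        rcases hT with h | h <;> rw [h] at r <;> cases r) (by simp only; omega)
  have yesP : ∀ κ κ', (κ, κ') ∈ qPairs ⟨n, T⟩ i i' j → κ ≤ k → k ≤ κ' → ∀ y,
      (nablaIter ⟨n, T⟩ i i' j).tile k y = qT κ κ' j k y (nablaUndroop T i i' j k y) := by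
    intro κ κ' h h1 h2 y
    rw [iter_eq]
    rw [qfold_one h]
    rintro ⟨a, a'⟩ hq
    by_cases hc : a ≤ k ∧ k ≤ a'
    · left; exact pair_uniq hg hn hj (by omega) hq h hc.1 hc.2 h1 h2
    · right; intro t
      have hq' := hq
      rw [mem_qPairs hn] at hq'
      exact qT_out hc (by simp only; omega)
  have u1 : nablaUndroop T i i' j k j = (match T k j with | Tile.blank => Tile.vert | Tile.horiz => Tile.cross | _ => T k j) := by
    unfold nablaUndroop
    simp only
    rw [if_neg (by omega), if_neg (by omega), if_neg (by omega), if_neg (by omega), if_pos (by first | omega | (simp <;> omega))]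
    all_goals (cases T k j <;> rfl)
  have u2 : nablaUndroop T i i' j k (j+1) = (match T k (j+1) with | Tile.vert => Tile.blank | Tile.cross => Tile.horiz | _ => T k (j+1)) := by
    unfold nablaUndroop
    simp only
    rw [if_neg (by omega), if_neg (by omega), if_neg (by omega), if_neg (by omega), if_neg (by omega), if_pos (by first | omega | (simp <;> omega))]
    all_goals (cases T k (j+1) <;> rfl)
  -- pairs
  have pS : T k j = .se → ∃ κ', (k, κ') ∈ qPairs ⟨n, T⟩ i i' j := by
    intro h
    obtain ⟨κ', a, b, c, d⟩ := col_down hg (k := k) (e := i') (j := j) hk' (by omega) hj (by omega)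
      ((hg.hS (by omega) (by omega) hj (by omega)).2 (by rw [h]; rfl)) hM
    refine ⟨κ', (mem_qPairs hn).2 ⟨hk, a, b, h, c, fun z z1 z2 e => ?_⟩⟩
    rcases d z z1 z2 with r | r <;> rw [r] at e <;> cases e
  have pU : hasN (T k j) = true → ∃ κ, i < κ ∧ κ < k ∧ T κ j = .se ∧ ∀ z, κ < z → z < k → St (T z j) := by
    intro h
    exact col_up hg hi hk (by omega) hj (by omega) hb
      ((hg.hN (x := k - 1) (by omega) hj (by omega)).2 (by rw [show k - 1 + 1 = k by omega]; exact h))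
  have pN : T k j = .nw → ∃ κ, κ < k ∧ (κ, k) ∈ qPairs ⟨n, T⟩ i i' j := by
    intro h
    obtain ⟨κ, a, b, c, d⟩ := pU (by rw [h]; rfl)
    refine ⟨κ, b, (mem_qPairs hn).2 ⟨a, b, hk', c, h, fun z z1 z2 e => ?_⟩⟩
    rcases d z z1 z2 with r | r <;> rw [r] at e <;> cases e
  have pI : St (T k j) → ∃ κ κ', κ < k ∧ k < κ' ∧ (κ, κ') ∈ qPairs ⟨n, T⟩ i i' j := by
    intro h
    obtain ⟨κ, a, b, c, d⟩ := pU (by rcases h with h | h <;> rw [h] <;> rfl)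
    obtain ⟨κ', a', b', c', d'⟩ := col_down hg (k := k) (e := i') (j := j) hk' (by omega) hj (by omega)
      ((hg.hS (by omega) (by omega) hj (by omega)).2 (by rcases h with h | h <;> rw [h] <;> rfl)) hM
    refine ⟨κ, κ', b, a', (mem_qPairs hn).2 ⟨a, by omega, b', c, c', fun z z1 z2 e => ?_⟩⟩
    rcases lt_trichotomy z k with hz | hz | hz
    · rcases d z z1 hz with r | r <;> rw [r] at e <;> cases e
    · subst hz; rcases h with r | r <;> rw [r] at e <;> cases e
    · rcases d' z hz z2 with r | r <;> rw [r] at e <;> cases e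
  have key : (nablaIter ⟨n, T⟩ i i' j).tile k j = t1 ∧ (nablaIter ⟨n, T⟩ i i' j).tile k (j+1) = t2 := by
    rcases passT_cases hp with ⟨a, b, rfl, rfl⟩ | ⟨a, b, rfl, rfl⟩ | ⟨a, b, rfl, rfl⟩ | ⟨a, b, rfl, rfl⟩ | ⟨a, b, rfl, rfl⟩ | ⟨a, b, rfl, rfl⟩
    · rw [iter_eq, iter_eq, qfold_id (fun p hp t => noP (Or.inl a) j t p hp), qfold_id (fun p hp t => noP (Or.inl a) (j+1) t p hp), u1, u2, a, b]
      exact ⟨rfl, rfl⟩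
    · rw [iter_eq, iter_eq, qfold_id (fun p hp t => noP (Or.inr a) j t p hp), qfold_id (fun p hp t => noP (Or.inr a) (j+1) t p hp), u1, u2, a, b]
      exact ⟨rfl, rfl⟩
    · obtain ⟨κ', h⟩ := pS a
      have h' := (mem_qPairs hn).1 h
      rw [yesP _ _ h le_rfl (by omega), yesP _ _ h le_rfl (by omega), u1, u2, a, b]
      unfold qT
      constructor
      · rw [if_pos (by first | omega | (simp <;> omega))]
      · rw [if_neg (by omega), if_neg (by omega), if_pos (by first | omega | (simp <;> omega))]
    · obtain ⟨κ, κ', h1, h2, h⟩ := pI (Or.inl a)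
      rw [yesP _ _ h (by omega) (by omega), yesP _ _ h (by omega) (by omega), u1, u2, a, b]
      unfold qT
      constructor
      · rw [if_neg (by omega), if_neg (by omega), if_neg (by omega), if_neg (by omega), if_neg (by omega)]
      · rw [if_neg (by omega), if_neg (by omega), if_neg (by omega), if_neg (by omega), if_pos (by first | omega | (simp <;> omega))]
    · obtain ⟨κ, κ', h1, h2, h⟩ := pI (Or.inr a)
      rw [yesP _ _ h (by omega) (by omega), yesP _ _ h (by omega) (by omega), u1, u2, a, b]
      unfold qT
      constructor
      · rw [if_neg (by omega), if_neg (by omega), if_neg (by omega), if_neg (by omega), if_neg (by omega)]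
      · rw [if_neg (by omega), if_neg (by omega), if_neg (by omega), if_neg (by omega), if_pos (by first | omega | (simp <;> omega))]
    · obtain ⟨κ, h1, h⟩ := pN a
      rw [yesP _ _ h (by omega) (by omega), yesP _ _ h (by omega) (by omega), u1, u2, a, b]
      unfold qT
      constructor
      · rw [if_neg (by omega), if_pos (by first | omega | (simp <;> omega))]
      · rw [if_neg (by omega), if_neg (by omega), if_neg (by omega), if_pos (by first | omega | (simp <;> omega))]
  exact eq_upd2 key.1 key.2 (fun y h1 h2 => iter_col h1 h2)

end pairs

section ranges
variable {n : ℕ} {T : ℕ → ℕ → Tile} {V : ℕ → ℕ → ℕ}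

theorem LG.topM (hg : LG n T V) {x y} (h1 : 1 ≤ x) (h2 : x ≤ n) (h3 : 1 ≤ y) (h4 : y ≤ n)
    (h : hasN (T x y) = false) : V (x-1) y = n + 1 := by
  obtain ⟨q, hh⟩ := hg.row x h1 h2
  have q := hh.2.2 y h3 h4
  revert q h
  cases T x y <;> simp [Loc, hasN] <;> omega

theorem pass_range (hg : LG n T V) {i j m : ℕ} {t3 : Tile} (hi : 1 ≤ i) (him : i ≤ m) (hn : m ≤ n) (hj : 1 ≤ j) (hjn : j + 1 ≤ n)
    (hb : T i j = .blank) (h3 : srcT (T i (j+1)) = some t3) (hno : ∀ z, i < z → z ≤ m → T z (j+1) ≠ .nw) :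
    (∀ k, i ≤ k → k ≤ m → V k (j+1) < V k j) ∧
    (∀ k, i < k → k ≤ m → ∃ t, passT (T k j) (T k (j+1)) = some t) := by
  have orr : ∀ k, i ≤ k → k + 1 ≤ m → V k (j+1) < V k j → ∃ t, passT (T (k+1) j) (T (k+1) (j+1)) = some t := by
    intro k k1 k2 h
    rcases row_or (hg.row (k+1) (by omega) (by omega)) hj hjn h with ⟨t, ht⟩ | ⟨t, ht⟩
    · exact ⟨t, ht⟩
    · exact absurd (halfT_cases ht).1 (hno _ (by omega) k2)
  have A : ∀ k, i ≤ k → k ≤ m → V k (j+1) < V k j := by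
    intro k hk
    induction k, hk using Nat.le_induction with
    | base => intro _; exact (row_src (hg.row i hi (by omega)) hj hjn hb h3).2
    | succ k hk ih =>
      intro h
      obtain ⟨⟨t1, t2⟩, ht⟩ := orr k hk h (ih (by omega))
      exact (row_pass (hg.row (k+1) (by omega) (by omega)) hj hjn (ih (by omega)) ht).2
  refine ⟨A, fun k k1 k2 => ?_⟩
  have := orr (k-1) (by omega) (by omega) (A (k-1) (by omega) (by omega))
  rwa [show k - 1 + 1 = k by omega] at this

theorem slide_eq {i j b : ℕ} (hjb : j ≤ b) (hb : b < n) (h1 : ∀ y, j ≤ y → y ≤ b → T i y = .blank)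
    (h2 : T i (b+1) ≠ .blank) : slideEast ⟨n, T⟩ i j = b := by
  unfold slideEast
  simp only
  have e : List.range' j (n+1) = List.range' j (b - j + 1) ++ (b+1) :: List.range' (b+2) (n - 1 - (b - j)) := by
    rw [← List.range'_succ (s := b+1) (step := 1)]
    have := @List.range'_append j (b-j+1) (n-1-(b-j)+1) 1
    rw [show j + 1 * (b-j+1) = b+1 by omega, show b - j + 1 + (n-1-(b-j)+1) = n+1 by omega] at this
    exact this.symm
  rw [e, List.takeWhile_append_of_pos, List.takeWhile_cons_of_neg, List.append_nil, List.range'_concat, List.getLastD_concat]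
  · omega
  · simpa using h2
  · intro a ha
    simp only [List.mem_range'_1] at ha
    simp [h1 a (by omega) (by omega)]

end ranges



/-- Description of the effect of the marked-tile procedure started at `(i, j0)`. -/
structure NS (n : ℕ) (T : ℕ → ℕ → Tile) (V : ℕ → ℕ → ℕ) (i j0 : ℕ) (T' : ℕ → ℕ → Tile) (a : ℕ) (js : ℕ → ℕ) : Prop where
  above : ∀ k, k < i → T' k = T k
  ge : j0 ≤ js i
  blanks : ∀ y, j0 ≤ y → y ≤ js i → T i y = .blank
  src : ∃ t3, srcT (T i (js i + 1)) = some t3 ∧ T' i = upd2 (T i) (js i) .se t3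
  step : ∀ k, i < k → k ≤ n → StepB (T k) (js (k-1)) (js k) (T' k)
  last : a = js n
  lg : LG n T' (fun k => if k < i then V k else sw (js k) (V k))
  one : ∀ k, i ≤ k → k ≤ n → 1 ≤ js k
  lt : ∀ k, i ≤ k → k ≤ n → js k + 1 ≤ n
  desc : ∀ k, i ≤ k → k ≤ n → V k (js k + 1) < V k (js k)

section loop
variable {n : ℕ}

theorem blank_upd {T T' : ℕ → ℕ → Tile} {V : ℕ → ℕ → ℕ} {k j : ℕ} {a b : Tile} (hg : LG n T V) (h : T' k = upd2 (T k) j a b)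
    (hk : 1 ≤ k) (hkn : k ≤ n) (hj : 1 ≤ j) (hjn : j + 1 ≤ n) (y : ℕ) (hy : ¬ (1 ≤ y ∧ y ≤ n)) : T' k y ≠ .blank := by
  rw [h]; unfold upd2
  rw [if_neg (by omega), if_neg (by omega)]
  exact hg.out k y (by omega)

/-- Final iteration -/
theorem loop_final {T : ℕ → ℕ → Tile} {V : ℕ → ℕ → ℕ} (hg : LG n T V) {i j : ℕ} {t3 : Tile} (hi : 1 ≤ i) (hin : i ≤ n) (hj : 1 ≤ j) (hjn : j + 1 ≤ n)
    (hb : T i j = .blank) (h3 : srcT (T i (j+1)) = some t3) (hno : ∀ z, i < z → z ≤ n → T z (j+1) ≠ .nw) :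
    ∃ i', (List.range' 1 n).find? (fun x =>
            decide (i < x) && (T x (j + 1) == Tile.cross) &&
            (backAux ⟨n, T⟩ (2 * n + 2) x (j + 1) false == some j)) = some i' ∧
      NS n T V i j (nablaIter ⟨n, T⟩ i i' j).tile j (fun _ => j) := by
  obtain ⟨A, P⟩ := pass_range hg hi hin le_rfl hj hjn hb h3 hno
  obtain ⟨κ, k1, k2, k3, k4⟩ := col_up hg (k := n+1) hi (by omega) le_rfl hj (by omega) hb
    (by rw [Nat.add_sub_cancel]; exact hg.bot hj (by omega))
  have hM : V (κ-1) j = n + 1 := hg.topM (by omega) (by omega) hj (by omega) (by rw [k3]; rfl)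
  have kc : T κ (j+1) = .cross := by
    obtain ⟨⟨t1, t2⟩, ht⟩ := P κ k1 (by omega)
    have := passT_cases ht
    rw [k3] at this; simp at this; exact this.1
  refine ⟨κ, ?_, ?_⟩
  · rw [List.find?_range'_eq_some]
    refine ⟨?_, by simp only [List.mem_range'_1]; omega, ?_⟩
    · simp only [k1, decide_true, kc, beq_self_eq_true, Bool.true_and, beq_iff_eq]
      rw [show 2 * n + 2 = 2 * n + 1 + 1 by omega, backAux]
      simp only [kc]
      rw [if_neg (by omega), if_neg (by simp), Nat.add_sub_cancel, show 2 * n + 1 = 2 * n + 1 by omega, backAux]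
      simp only [k3]
      rw [if_neg (by omega), if_neg (by simp)]
      split_ifs with hc
      · rfl
      · exact back_straight _ _ _ (by omega) (by omega) (fun z z1 z2 => k4 z (by omega) (by omega))
    · intro x x1 x2
      simp only [Bool.not_eq_true', Bool.and_eq_false_iff, decide_eq_false_iff_not, beq_eq_false_iff_ne, ne_eq]
      by_cases hx : i < x
      · by_cases hc : T x (j+1) = .cross
        · right
          intro hbk
          rw [show 2 * n + 2 = 2 * n + 1 + 1 by omega, backAux] at hbk
          simp only [hc] at hbk
          rw [if_neg (by omega), if_neg (by simp), Nat.add_sub_cancel, show 2 * n + 1 = 2 * n + 1 by omega, backAux] at hbk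
          simp only at hbk
          rw [if_neg (by omega), if_neg (by simp)] at hbk
          obtain ⟨⟨t1, t2⟩, ht⟩ := P x hx (by omega)
          have := passT_cases ht
          rw [hc] at this; simp at this
          rcases this with h | h | h
          · rw [h.1] at hbk; simp only at hbk
            have := back_le _ _ _ _ _ hbk; omega
          · rw [h.1] at hbk; simp only at hbk
            rw [if_neg (by omega)] at hbk
            obtain ⟨κ', a, b, c, d⟩ := col_down hg (k := x) (e := κ) (j := j) x2 (by omega) hj (by omega)
              ((hg.hS (by omega) (by omega) hj (by omega)).2 (by rw [h.1]; rfl)) hM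
            have := back_nw _ _ _ κ' _ (by omega) (by omega) hj (fun z z1 z2 => d z (by omega) z2) c hbk
            omega
          · rw [h.1] at hbk; simp only at hbk
            have := back_le _ _ _ _ _ hbk; omega
        · left; right; exact hc
      · left; left; exact hx
  · have row : ∀ k, i < k → k ≤ n → ∃ t1 t2, passT (T k j) (T k (j+1)) = some (t1, t2) ∧
        (nablaIter ⟨n, T⟩ i κ j).tile k = upd2 (T k) j t1 t2 := by
      intro k h1 h2
      obtain ⟨⟨t1, t2⟩, ht⟩ := P k h1 h2
      refine ⟨t1, t2, ht, ?_⟩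
      rcases lt_trichotomy k κ with h | rfl | h
      · exact iter_pass hg hi (by omega) hj hjn hb hM h1 h ht
      · rw [iter_fin k1 h2 k3 kc]
        rw [k3, kc] at ht; simp [passT] at ht
        rw [← ht.1, ← ht.2]
      · rw [iter_out k1 (by omega) (Or.inr h)]
        have := k4 k h (by omega)
        apply eq_upd2 _ _ (fun _ _ _ => rfl)
        · rcases passT_cases ht with q | q | q | q | q | q <;> rcases this with r | r <;> simp_all
        · rcases passT_cases ht with q | q | q | q | q | q <;> rcases this with r | r <;> simp_all
    have hn : κ ≤ n := by omega
    have top := iter_top (n := n) (T := T) (i' := κ) k1 hn hb h3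
    refine ⟨fun k hk => iter_out k1 hn (Or.inl hk), le_rfl, ?_, ⟨t3, h3, top⟩, ?_, rfl, ?_, fun _ _ _ => hj, fun _ _ _ => hjn, A⟩
    · intro y y1 y2; rw [show y = j by omega]; exact hb
    · intro k k1 k2
      obtain ⟨t1, t2, a, b⟩ := row k k1 k2
      exact StepB.pass t1 t2 a rfl (fun y => by rw [b]; rfl)
    · refine ⟨hg.pos, ?_, ?_, ?_⟩
      · intro y y1 y2
        rw [if_pos (by omega)]; exact hg.top y y1 y2
      · intro k h1 h2
        rcases lt_trichotomy k i with h | rfl | h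
        · rw [if_pos (by omega), if_pos h, iter_out k1 hn (Or.inl h)]; exact hg.row k h1 h2
        · rw [if_pos (by omega), if_neg (by omega), top]
          exact (row_src (hg.row k h1 h2) hj hjn hb h3).1
        · rw [if_neg (by omega), if_neg (by omega)]
          obtain ⟨t1, t2, a, b⟩ := row k h h2
          rw [b]
          exact (row_pass (hg.row k h1 h2) hj hjn (A _ (by omega) (by omega)) a).1
      · intro x y hxy
        by_cases hc : y = j ∨ y = j + 1
        · rw [iter_out k1 hn (by omega)]; exact hg.out x y hxy
        · rw [iter_col (by omega) (by omega)]; exact hg.out x y hxy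

/-- Nonfinal iteration -/
theorem loop_next {T : ℕ → ℕ → Tile} {V : ℕ → ℕ → ℕ} (hg : LG n T V) {i i' j : ℕ} {t3 : Tile} (hi : 1 ≤ i) (hii : i < i') (hn : i' ≤ n) (hj : 1 ≤ j) (hjn : j + 1 ≤ n)
    (hb : T i j = .blank) (h3 : srcT (T i (j+1)) = some t3) (hno : ∀ z, i < z → z < i' → T z (j+1) ≠ .nw) (hnw : T i' (j+1) = .nw) :
    LG n (nablaIter ⟨n, T⟩ i i' j).tile (fun k => if i ≤ k ∧ k < i' then sw j (V k) else V k) ∧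
    (nablaIter ⟨n, T⟩ i i' j).tile i' (j+1) = .blank ∧
    ∀ {T' : ℕ → ℕ → Tile} {a : ℕ} {js : ℕ → ℕ}, NS n (nablaIter ⟨n, T⟩ i i' j).tile (fun k => if i ≤ k ∧ k < i' then sw j (V k) else V k) i' (j+1) T' a js →
      NS n T V i j T' a (fun k => if k < i' then j else js k) := by
  obtain ⟨A, P⟩ := pass_range hg hi (show i ≤ i' - 1 by omega) (by omega) hj hjn hb h3 (fun z z1 z2 => hno z z1 (by omega))
  have half : ∃ t, halfT (T i' j) (T i' (j+1)) = some t := by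
    rcases row_or (hg.row i' (by omega) (by omega)) hj hjn (A (i'-1) (by omega) le_rfl) with ⟨⟨t1, t2⟩, ht⟩ | h
    · have := passT_cases ht; rw [hnw] at this; simp at this
    · exact h
  obtain ⟨t, ht⟩ := half
  have hM : V (i'-1) j = n + 1 := hg.topM (by omega) (by omega) hj (by omega) (by
    rcases (halfT_cases ht).2 with ⟨a, b⟩ | ⟨a, b⟩ <;> rw [a] <;> rfl)
  have row : ∀ k, i < k → k < i' → ∃ t1 t2, passT (T k j) (T k (j+1)) = some (t1, t2) ∧
        (nablaIter ⟨n, T⟩ i i' j).tile k = upd2 (T k) j t1 t2 := by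
    intro k h1 h2
    obtain ⟨⟨t1, t2⟩, ht⟩ := P k h1 (by omega)
    exact ⟨t1, t2, ht, iter_pass hg hi (by omega) hj hjn hb hM h1 h2 ht⟩
  have top := iter_top (n := n) (T := T) (i' := i') hii hn hb h3
  have bot := iter_half (n := n) (T := T) (i := i) hii hn ht
  have out : ∀ x, x < i ∨ i' < x → (nablaIter ⟨n, T⟩ i i' j).tile x = T x := fun x h => iter_out hii hn h
  have lg : LG n (nablaIter ⟨n, T⟩ i i' j).tile (fun k => if i ≤ k ∧ k < i' then sw j (V k) else V k) := by
    refine ⟨hg.pos, ?_, ?_, ?_⟩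
    · intro y y1 y2
      rw [if_neg (by omega)]; exact hg.top y y1 y2
    · intro k h1 h2
      rcases lt_trichotomy k i with h | rfl | h
      · rw [if_neg (by omega), if_neg (by omega), out k (Or.inl h)]; exact hg.row k h1 h2
      · rw [if_neg (by omega), if_pos (by omega), top]
        exact (row_src (hg.row k h1 h2) hj hjn hb h3).1
      · rcases lt_trichotomy k i' with h' | rfl | h'
        · rw [if_pos (by omega), if_pos (by omega)]
          obtain ⟨t1, t2, a, b⟩ := row k h h'
          rw [b]
          exact (row_pass (hg.row k h1 h2) hj hjn (A _ (by omega) (by omega)) a).1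
        · rw [if_pos (by omega), if_neg (by omega), bot]
          exact row_half (hg.row k h1 h2) hj hjn (A _ (by omega) (by omega)) ht
        · rw [if_neg (by omega), if_neg (by omega), out k (Or.inr h')]; exact hg.row k h1 h2
    · intro x y hxy
      by_cases hc : y = j ∨ y = j + 1
      · rw [iter_out hii hn (by omega)]; exact hg.out x y hxy
      · rw [iter_col (by omega) (by omega)]; exact hg.out x y hxy
  refine ⟨lg, by rw [bot]; simp [upd2], ?_⟩
  intro T' a js h
  have hV : ∀ k, i' ≤ k → (fun k => if i ≤ k ∧ k < i' then sw j (V k) else V k) k = V k := by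
    intro k hk; simp only; rw [if_neg (by omega)]
  refine ⟨?_, ?_, ?_, ⟨t3, ?_, ?_⟩, ?_, ?_, ?_, ?_, ?_, ?_⟩
  · intro k hk; rw [h.above k (by omega), out k (Or.inl hk)]
  · rw [if_pos hii]
  · rw [if_pos hii]; intro y y1 y2; rw [show y = j by omega]; exact hb
  · rw [if_pos hii]; exact h3
  · rw [if_pos hii, h.above i hii]; exact top
  · intro k k1 k2
    rcases lt_trichotomy k i' with h' | rfl | h'
    · rw [if_pos (by omega), if_pos h', h.above k h']
      obtain ⟨t1, t2, a, b⟩ := row k k1 h'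
      exact StepB.pass t1 t2 a rfl (fun y => by rw [b]; rfl)
    · rw [if_pos (by omega), if_neg (by omega)]
      obtain ⟨t4, s1, s2⟩ := h.src
      have ge := h.ge
      have bl := h.blanks
      rw [bot] at s1 s2 bl
      refine StepB.jump t t4 ht ge ?_ ?_ ?_
      · intro y y1 y2
        have := bl y (by omega) y2
        simpa [upd2, show y ≠ j by omega, show y ≠ j + 1 by omega] using this
      · simpa [upd2, show js k + 1 ≠ j by omega, show js k ≠ j by omega] using s1
      · intro y
        rw [s2]
        simp only [upd2]
        split_ifs <;> first | rfl | omega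
    · rw [if_neg (by omega), if_neg (by omega)]
      have := h.step k h' k2
      rwa [out k (Or.inr h')] at this
  · rw [if_neg (by omega)]; exact h.last
  · have := h.lg
    have e : (fun k => if k < i then V k else sw ((fun k => if k < i' then j else js k) k) (V k)) =
      (fun k => if k < i' then (fun k => if i ≤ k ∧ k < i' then sw j (V k) else V k) k else sw (js k) ((fun k => if i ≤ k ∧ k < i' then sw j (V k) else V k) k)) := by
      funext k
      simp only
      split_ifs <;> first | rfl | omega
    rw [e]; exact this
  · intro k k1 k2; split_ifs with hc
    · exact hj
    · exact h.one k (by omega) k2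
  · intro k k1 k2; split_ifs with hc
    · exact hjn
    · exact h.lt k (by omega) k2
  · intro k k1 k2; split_ifs with hc
    · exact A k k1 (by omega)
    · have := h.desc k (by omega) k2
      rwa [if_neg (by omega)] at this

theorem NS.slide {T : ℕ → ℕ → Tile} {V : ℕ → ℕ → ℕ} {i j0 j : ℕ} {T' : ℕ → ℕ → Tile} {a : ℕ} {js : ℕ → ℕ} (h : NS n T V i j T' a js) (h0 : j0 ≤ j)
    (hb : ∀ y, j0 ≤ y → y ≤ j → T i y = .blank) : NS n T V i j0 T' a js := by
  refine ⟨h.above, ?_, ?_, h.src, h.step, h.last, h.lg, h.one, h.lt, h.desc⟩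
  · have := h.ge; omega
  · intro y y1 y2
    by_cases hc : y ≤ j
    · exact hb y y1 hc
    · exact h.blanks y (by omega) y2

theorem loop_spec (f : ℕ) {T : ℕ → ℕ → Tile} {V : ℕ → ℕ → ℕ} (hg : LG n T V) {i j0 : ℕ} (hi : 1 ≤ i) (hin : i ≤ n)
    (hj : 1 ≤ j0) (hjn : j0 ≤ n) (hb : T i j0 = .blank) (hf : n - j0 + 1 ≤ f) :
    ∃ T' a js, nablaLoop ⟨n, T⟩ f (i, j0) = (⟨n, T'⟩, a) ∧ NS n T V i j0 T' a js := by
  induction f generalizing T V i j0 with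
  | zero => omega
  | succ f ih =>
    obtain ⟨j, t3, a1, a2, a3, a4⟩ := row_next (hg.row i hi hin) hin hj hjn hb
    have hs : slideEast ⟨n, T⟩ i j0 = j := slide_eq a1 (by omega) a3 (by
      rcases srcT_cases a4 with ⟨h, _⟩ | ⟨h, _⟩ <;> rw [h] <;> simp)
    have hbj := a3 j a1 le_rfl
    simp only [nablaLoop, hs]
    by_cases hex : ∃ z, i < z ∧ z ≤ n ∧ T z (j+1) = .nw
    · classical
      obtain ⟨e1, e2, e3⟩ := Nat.find_spec hex
      have e4 : ∀ z, i < z → z < Nat.find hex → T z (j+1) ≠ .nw := by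
        intro z z1 z2 h
        exact Nat.find_min hex z2 ⟨z1, by omega, h⟩
      generalize Nat.find hex = i' at e1 e2 e3 e4
      obtain ⟨-, P⟩ := pass_range hg hi (show i ≤ i' - 1 by omega) (by omega) (by omega) a2 hbj a4 (fun z z1 z2 => e4 z z1 (by omega))
      have st : ∀ z, i < z → z < i' → St (T z (j+1)) := by
        intro z z1 z2
        obtain ⟨⟨t1, t2⟩, ht⟩ := P z z1 (by omega)
        rcases passT_cases ht with q | q | q | q | q | q <;> simp [St, q.2.1]
      have hN : hasN (T (i+1) (j+1)) = true := by
        rcases Nat.eq_or_lt_of_le (show i + 1 ≤ i' from e1) with h | h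
        · rw [h, e3]; rfl
        · rcases st (i+1) (by omega) h with q | q <;> rw [q] <;> rfl
      have hp : ∃ c, pipeFromS ⟨n, T⟩ i (j+1) = some c ∧ c < j + 1 := by
        unfold pipeFromS
        simp only
        rw [if_neg (by omega)]
        obtain ⟨c, hc⟩ := (back_ex hg (2*n+2) (i+1) (j+1) (by omega) (by omega) (by omega) a2 (by omega)).1 hN
        exact ⟨c, hc, back_nw _ _ _ i' _ (by omega) e2 (by omega) (fun z z1 z2 => st z (by omega) z2) e3 hc⟩
      obtain ⟨c, c1, c2⟩ := hp
      have hf' : (List.range' 1 n).find? (fun x => decide (i < x) && (T x (j + 1) == Tile.nw)) = some i' := by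
        rw [List.find?_range'_eq_some]
        refine ⟨by simp [e1, e3], by simp only [List.mem_range'_1]; omega, fun z z1 z2 => ?_⟩
        by_cases hz : i < z
        · simp [e4 z hz z2]
        · simp [hz]
      simp only [c1, hf']
      rw [if_neg (by omega)]
      obtain ⟨b1, b2, b3⟩ := loop_next hg hi e1 e2 (by omega) a2 hbj a4 e4 e3
      obtain ⟨T', a, js, d1, d2⟩ := ih b1 (by omega) e2 (by omega) a2 b2 (by omega)
      exact ⟨T', a, _, d1, (b3 d2).slide a1 a3⟩
    · push Not at hex
      obtain ⟨-, P⟩ := pass_range hg hi hin le_rfl (by omega) a2 hbj a4 (fun z z1 z2 => hex z z1 z2)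
      have st : ∀ z, i < z → z ≤ n → St (T z (j+1)) := by
        intro z z1 z2
        obtain ⟨⟨t1, t2⟩, ht⟩ := P z z1 (by omega)
        rcases passT_cases ht with q | q | q | q | q | q <;> simp [St, q.2.1]
      have hp : pipeFromS ⟨n, T⟩ i (j+1) = some (j+1) := by
        unfold pipeFromS
        simp only
        split_ifs with hc
        · rfl
        · exact back_straight _ _ _ (by omega) (by omega) (fun z z1 z2 => st z (by omega) z2)
      obtain ⟨i', g1, g2⟩ := loop_final hg hi hin (by omega) a2 hbj a4 (fun z z1 z2 => hex z z1 z2)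
      simp only [hp, g1, if_true]
      exact ⟨_, _, _, rfl, g2.slide a1 a3⟩

/-- the whole operator -/
theorem nabla_spec {T : ℕ → ℕ → Tile} {V : ℕ → ℕ → ℕ} (hg : LG n T V) (hex : ∃ x y, T x y = .blank) :
    ∃ r j0 T' a js, 1 ≤ r ∧ r ≤ n ∧ nabla ⟨n, T⟩ = ⟨n, T'⟩ ∧ pop ⟨n, T⟩ = (r, a) ∧ NS n T V r j0 T' a js ∧
      ∀ x y, x < r → T x y ≠ .blank := by
  obtain ⟨x0, y0, h0⟩ := hex
  have hin : 1 ≤ x0 ∧ x0 ≤ n ∧ 1 ≤ y0 ∧ y0 ≤ n := by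
    by_contra hc; exact hg.out _ _ hc h0
  have hf : ∃ r, (List.range' 1 n).find?
      (fun i => (List.range' 1 n).any (fun j => T i j == Tile.blank)) = some r := by
    rw [← Option.isSome_iff_exists, List.find?_isSome]
    refine ⟨x0, by simp only [List.mem_range'_1]; omega, ?_⟩
    rw [List.any_eq_true]
    exact ⟨y0, by simp only [List.mem_range'_1]; omega, by simp [h0]⟩
  obtain ⟨r, hr⟩ := hf
  have hr2 := hr
  rw [List.find?_range'_eq_some] at hr2
  obtain ⟨h1, h2, h3⟩ := hr2
  simp only [List.mem_range'_1] at h2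
  rw [List.any_eq_true] at h1
  obtain ⟨y1, m1, m2⟩ := h1
  have hmem : ((List.range' 1 n).filter (fun j => T r j == Tile.blank)).getLastD 0 ∈ (List.range' 1 n).filter (fun j => T r j == Tile.blank) := by
    have hne : (List.range' 1 n).filter (fun j => T r j == Tile.blank) ≠ [] := by
      intro e
      have : y1 ∈ (List.range' 1 n).filter (fun j => T r j == Tile.blank) := List.mem_filter.2 ⟨m1, m2⟩
      rw [e] at this; simp at this
    rw [List.getLastD_eq_getLast?, List.getLast?_eq_some_getLast hne]
    exact List.getLast_mem hne
  generalize hj0 : ((List.range' 1 n).filter (fun j => T r j == Tile.blank)).getLastD 0 = j0 at hmem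
  simp only [List.mem_filter, List.mem_range'_1, beq_iff_eq] at hmem
  obtain ⟨T', a, js, e1, e2⟩ := loop_spec (n+1) hg (i := r) (j0 := j0) (by omega) (by omega) (by omega) (by omega) hmem.2 (by omega)
  have hp : nablaPop ⟨n, T⟩ = (⟨n, T'⟩, r, a) := by
    unfold nablaPop
    simp only [hr, hj0, e1]
  refine ⟨r, j0, T', a, js, by omega, by omega, by simp [nabla, hp], by simp [pop, hp], e2, ?_⟩
  intro x y hx hbl
  have hin : 1 ≤ x ∧ x ≤ n ∧ 1 ≤ y ∧ y ≤ n := by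
    by_contra hc; exact hg.out _ _ hc hbl
  have := h3 x (by omega) hx
  rw [Bool.not_eq_true', List.any_eq_false] at this
  exact this y (by simp only [List.mem_range'_1]; omega) (by simp [hbl])

end loop



/-! ### Counting blank tiles, and the main run of the Gao–Huang map -/

def ib (t : Tile) : ℕ := if t = .blank then 1 else 0
def bc (n : ℕ) (τ : ℕ → Tile) : ℕ := ∑ y ∈ Finset.Icc 1 n, ib (τ y)
def blk (n : ℕ) (T : ℕ → ℕ → Tile) (k : ℕ) : ℕ := ∑ x ∈ Finset.Icc 1 k, bc n (T x)

theorem bc_upd2 {n j τ a b} (h1 : 1 ≤ j) (h2 : j + 1 ≤ n) :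
    bc n (upd2 τ j a b) + ib (τ j) + ib (τ (j+1)) = bc n τ + ib a + ib b := by
  unfold bc
  rw [sum_two h1 h2, sum_two h1 h2 (fun y => ib (τ y)),
    sum_rest (n := n) (j := j) (fun y => ib (upd2 τ j a b y)) (fun y => ib (τ y)) (fun z hz hz' => by simp [upd2, hz, hz'])]
  have e1 : upd2 τ j a b j = a := by simp [upd2]
  have e2 : upd2 τ j a b (j+1) = b := by simp [upd2]
  rw [e1, e2]
  omega

theorem StepB.bc {n τ j j' τ'} (h : StepB τ j j' τ') (h1 : 1 ≤ j) (h2 : j + 1 ≤ n) (h3 : j' + 1 ≤ n) :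
    bc n τ' = bc n τ := by
  cases h with
  | pass t1 t2 h hj ht =>
    have e : τ' = upd2 τ j t1 t2 := by funext y; rw [ht y]; rfl
    have q := bc_upd2 (τ := τ) (a := t1) (b := t2) h1 h2
    rw [← e] at q
    rcases passT_cases h with ⟨a,b,c,d⟩ | ⟨a,b,c,d⟩ | ⟨a,b,c,d⟩ | ⟨a,b,c,d⟩ | ⟨a,b,c,d⟩ | ⟨a,b,c,d⟩ <;>
      rw [a, b, c, d] at q <;> simp [ib] at q <;> omega
  | jump t1 t3 h hj hb h4 ht =>
    have e : τ' = upd2 (upd2 τ j t1 .blank) j' .se t3 := by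
      funext y; rw [ht y]; simp only [upd2]; split_ifs <;> first | rfl | omega
    have q := bc_upd2 (τ := τ) (a := t1) (b := .blank) h1 h2
    have q2 := bc_upd2 (τ := upd2 τ j t1 .blank) (a := .se) (b := t3) (show 1 ≤ j' by omega) h3
    rw [← e] at q2
    have e1 : upd2 τ j t1 .blank j' = .blank := by
      simp only [upd2]; rw [if_neg (by omega)]
      split_ifs
      · rfl
      · exact hb j' (by omega) le_rfl
    have e2 : upd2 τ j t1 .blank (j'+1) = τ (j'+1) := by
      simp only [upd2]; rw [if_neg (by omega), if_neg (by omega)]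
    rw [e1, e2] at q2
    obtain ⟨hn, ha⟩ := halfT_cases h
    rw [hn] at q
    rcases ha with ⟨a1, a2⟩ | ⟨a1, a2⟩ <;> rcases srcT_cases h4 with ⟨b1, b2⟩ | ⟨b1, b2⟩ <;>
      subst a2 <;> subst b2 <;> rw [a1] at q <;> rw [b1] at q2 <;> simp [ib] at q q2 <;> omega

theorem NS.bc_lt {n T V i j0 T' a js} (h : NS n T V i j0 T' a js) {k} (hk : k < i) : bc n (T' k) = bc n (T k) := by
  rw [h.above k hk]

theorem NS.bc_gt {n T V i j0 T' a js} (h : NS n T V i j0 T' a js) {k} (hk : i < k) (hn : k ≤ n) :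
    bc n (T' k) = bc n (T k) :=
  (h.step k hk hn).bc (h.one _ (by omega) (by omega)) (h.lt _ (by omega) (by omega)) (h.lt _ (by omega) (by omega))

theorem NS.bc_eq {n T V i j0 T' a js} (h : NS n T V i j0 T' a js) (hn : i ≤ n) :
    bc n (T' i) + 1 = bc n (T i) := by
  obtain ⟨t3, h3, e⟩ := h.src
  have q := bc_upd2 (τ := T i) (a := .se) (b := t3) (h.one i le_rfl hn) (h.lt i le_rfl hn)
  rw [← e, h.blanks _ h.ge le_rfl] at q
  rcases srcT_cases h3 with ⟨b1, b2⟩ | ⟨b1, b2⟩ <;> rw [b1, b2] at q <;> simp [ib] at q <;> omega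

theorem blk_succ {n T k} : blk n T (k+1) = blk n T k + bc n (T (k+1)) := by
  unfold blk; rw [Icc_succ_sum]

theorem NS.blk {n T V i j0 T' a js} (h : NS n T V i j0 T' a js) (hi : 1 ≤ i) (k : ℕ) (hk : k ≤ n) :
    blk n T k = blk n T' k + if k < i then 0 else 1 := by
  induction k with
  | zero => simp [BPDPaper.blk]; omega
  | succ k ih =>
    have := ih (by omega)
    rw [blk_succ, blk_succ, this]
    rcases lt_trichotomy (k+1) i with hl | hl | hl
    · rw [if_pos (by omega), if_pos hl, h.bc_lt hl]; rfl
    · rw [if_pos (by omega), if_neg (by omega)]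
      subst hl
      have := h.bc_eq hk
      omega
    · rw [if_neg (by omega), if_neg (by omega), h.bc_gt hl hk]; omega

theorem blk_zero {n T k} (h : ∀ x y, x ≤ k → T x y ≠ .blank) : blk n T k = 0 := by
  unfold blk bc
  apply Finset.sum_eq_zero
  intro x hx
  apply Finset.sum_eq_zero
  intro y hy
  simp at hx
  rw [ib, if_neg (h x y hx.2)]

theorem blk_zero_iff {n T V} (hg : LG n T V) (h : blk n T n = 0) : ∀ x y, T x y ≠ .blank := by
  intro x y hb
  have hin : 1 ≤ x ∧ x ≤ n ∧ 1 ≤ y ∧ y ≤ n := by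
    by_contra hc; exact hg.out _ _ hc hb
  have h1 : bc n (T x) = 0 := by
    have := Finset.sum_eq_zero_iff.1 h x (by simp; omega)
    exact this
  have h2 := Finset.sum_eq_zero_iff.1 h1 y (by simp; omega)
  rw [hb] at h2
  simp [ib] at h2

/-- With no blank tile at all, the labels are the identity. -/
theorem noblank_labels {n T V} (hg : LG n T V) (h : ∀ x y, T x y ≠ .blank) (k : ℕ) (hk : k ≤ n) :
    ∀ y, 1 ≤ y → y ≤ n → V k y = if y ≤ k then y else n + 1 := by
  induction k with
  | zero => intro y h1 h2; rw [hg.top y h1 h2, if_neg (by omega)]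
  | succ k ih =>
    obtain ⟨f, f0, fn, fl⟩ := hg.row (k+1) (by omega) hk
    rw [Nat.add_sub_cancel] at fl
    have key : ∀ y, y ≤ n → f y = (if y ≤ k then n + 1 else k + 1) ∧
        (1 ≤ y → V (k+1) y = if y ≤ k + 1 then y else n + 1) := by
      intro y
      induction y with
      | zero => intro _; rw [f0]; simp
      | succ y ihy =>
        intro hy
        obtain ⟨e, -⟩ := ihy (by omega)
        have l := fl (y+1) (by omega) hy
        have e2 := ih (by omega) (y+1) (by omega) hy
        have hb := h (k+1) (y+1)
        rw [Nat.add_sub_cancel, e, e2] at l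
        have pr : ∀ t, t ≠ Tile.blank → y + 1 = k + 1 → Loc (n+1) t (n+1) (V (k+1) (y+1)) (n+1) (f (y+1)) →
            V (k+1) (y+1) = f (y+1) ∧ f (y+1) < n + 1 := by
          intro t ht _ hl
          cases t <;> simp only [Loc] at hl <;> first | exact absurd rfl ht | omega
        rcases lt_trichotomy (y+1) (k+1) with c | c | c
        · rw [if_pos (by omega), if_pos (by omega)] at l
          rw [if_pos (by omega), if_pos (by omega)]
          revert l hb
          cases T (k+1) (y+1) <;> simp only [Loc] <;> intro hb l <;> first | exact hb.elim | omega
        · rw [if_neg (by omega), if_pos (by omega)] at l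
          obtain ⟨p1, p2⟩ := pr _ hb c l
          -- the label is new: it must be `k+1`
          have hl := hg.label_le (k := k+1) hk (y := y+1) (by omega) hy
          have hv : V (k+1) (y+1) = k + 1 := by
            obtain hl | hl := hl
            swap; · omega
            by_contra hne
            -- a smaller label already sits to the left
            have hlt : V (k+1) (y+1) ≤ k := by omega
            have ex : V (k+1) (V (k+1) (y+1)) = V (k+1) (y+1) := by
              have l0 := fl (V (k+1) (y+1)) hl.1 (by omega)
              have e0 := ih (by omega) (V (k+1) (y+1)) hl.1 (by omega)
              rw [e0, if_pos (by omega)] at l0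
              have hf : ∀ z, z ≤ y → f z = n + 1 := by
                intro z hz
                induction z with
                | zero => exact f0
                | succ z ihz =>
                  have l1 := fl (z+1) (by omega) (by omega)
                  have e1 := ih (by omega) (z+1) (by omega) (by omega)
                  have hb1 := h (k+1) (z+1)
                  rw [Nat.add_sub_cancel, ihz (by omega), e1, if_pos (by omega)] at l1
                  revert l1 hb1
                  cases T (k+1) (z+1) <;> simp only [Loc] <;> intro hb l <;> first | exact hb.elim | omega
              rw [hf _ (by omega)] at l0
              revert l0
              cases T (k+1) (V (k+1) (y+1)) <;> simp only [Loc] <;> intro l0 <;> first | exact l0.elim | omega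
            have := hg.label_inj (k := k+1) hk (y := V (k+1) (y+1)) (z := y+1) hl.1 (by omega) (by omega) (by omega)
            omega
          rw [if_neg (by omega), if_pos (by omega)]
          omega
        · rw [if_neg (by omega), if_neg (by omega)] at l
          rw [if_neg (by omega), if_neg (by omega)]
          revert l hb
          cases T (k+1) (y+1) <;> simp only [Loc] <;> intro hb l <;> first | exact hb.elim | omega
    intro y h1 h2
    exact (key y h2).2 h1

theorem noblank_cst {n T V} (hg : LG n T V) (h : ∀ x y, T x y ≠ .blank) {k : ℕ} (hk : k ≤ n) :
    ∀ y, 1 ≤ y → y ≤ n → cst n (V k) y = 0 := by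
  intro y h1 h2
  unfold cst
  apply Finset.sum_eq_zero
  intro z hz
  simp at hz
  have e1 := noblank_labels hg h k hk y h1 h2
  have e2 := noblank_labels hg h k hk z hz.1 hz.2
  rw [if_neg]
  rintro ⟨a, b⟩
  rw [e1, e2] at b
  split_ifs at b <;> omega

theorem flow_nil (rows : List (ℕ → Tile)) : Flow rows [] [] := by
  induction rows with
  | nil => exact Flow.nil _
  | cons τ rows ih => exact Flow.cons (RunB.nil τ) ih

theorem flow_cons {T T' : ℕ → ℕ → Tile} {js : ℕ → ℕ} {m k W K}
    (h : ∀ x, k < x → x ≤ k + m → StepB (T x) (js (x-1)) (js x) (T' x))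
    (hf : Flow (rowsOf T' k m) W K) : Flow (rowsOf T k m) (js k :: W) (js (k+m) :: K) := by
  induction m generalizing k W with
  | zero =>
    simp only [rowsOf, List.range'_zero, List.map_nil] at hf ⊢
    cases hf; exact Flow.nil _
  | succ m ih =>
    simp only [rowsOf, List.range'_succ, List.map_cons] at hf ⊢
    cases hf with
    | cons hr hf =>
      have s := h (k+1) (by omega) (by omega)
      rw [Nat.add_sub_cancel] at s
      refine Flow.cons (RunB.cons s hr) ?_
      have := ih (k := k+1) (fun x h1 h2 => h x (by omega) (by omega)) hf
      rw [show k + (m+1) = k + 1 + m by omega]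
      exact this

theorem main_run {n : ℕ} (N : ℕ) : ∀ {T : ℕ → ℕ → Tile} {V : ℕ → ℕ → ℕ} {q : ℕ}, LG n T V → blk n T n = N →
    (∀ x y, x < q → T x y ≠ .blank) →
    (∀ k, k ≤ n → blk n T k = ∑ y ∈ Finset.Icc 1 n, cst n (V k) y) ∧
    ((phiAux N ⟨n, T⟩).map Prod.fst).Pairwise (· ≤ ·) ∧
    (∀ p ∈ phiAux N ⟨n, T⟩, q ≤ p.1 ∧ p.1 ≤ n) ∧
    ∀ k, k ≤ n → ∃ L1 L2 W, phiAux N ⟨n, T⟩ = L1 ++ L2 ∧ (∀ p ∈ L1, p.1 ≤ k) ∧ (∀ p ∈ L2, k < p.1) ∧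
      Flow (rowsOf T k (n-k)) W (L1.map Prod.snd) ∧ Valid n (V k) W ∧
      ∀ y, 1 ≤ y → y ≤ n → cst n (endS (V k) W) y = 0 := by
  induction N with
  | zero =>
    intro T V q hg h0 hq
    have nb := blk_zero_iff hg h0
    refine ⟨fun k hk => ?_, by simp [phiAux], by simp [phiAux], fun k hk => ?_⟩
    · rw [blk_zero (fun x y _ => nb x y), eq_comm]
      apply Finset.sum_eq_zero
      intro y hy; simp at hy
      exact noblank_cst hg nb hk y hy.1 hy.2
    · exact ⟨[], [], [], by simp [phiAux], by simp, by simp, flow_nil _, trivial,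
        fun y h1 h2 => noblank_cst hg nb hk y h1 h2⟩
  | succ N ih =>
    intro T V q hg h0 hq
    have hex : ∃ x y, T x y = .blank := by
      by_contra hc
      push Not at hc
      rw [blk_zero (fun x y _ => hc x y)] at h0
      omega
    obtain ⟨r, j0, T', a, js, hr1, hrn, hnab, hpop, hns, hab⟩ := nabla_spec hg hex
    have hqr : q ≤ r := by
      by_contra hc
      exact hq r (js r) (by omega) (hns.blanks _ hns.ge le_rfl)
    have hN : blk n T' n = N := by
      have := hns.blk hr1 n le_rfl
      rw [if_neg (by omega)] at this
      omega
    obtain ⟨i1, i2, i3, i4⟩ := ih (q := r) hns.lg hN (fun x y hx => by rw [hns.above x hx]; exact hab x y hx)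
    have hL : phiAux (N+1) ⟨n, T⟩ = (r, a) :: phiAux N ⟨n, T'⟩ := by
      rw [phiAux, hpop, hnab]
    rw [hL]
    have hval : ∀ k, r ≤ k → k ≤ n → Valid n (V k) [js k] := fun k h1 h2 =>
      ⟨hns.one k h1 h2, hns.lt k h1 h2, hns.desc k h1 h2, trivial⟩
    have hsum : ∀ k, k ≤ n → blk n T k = ∑ y ∈ Finset.Icc 1 n, cst n (V k) y := by
      intro k hk
      have e1 := hns.blk hr1 k hk
      have e2 := i1 k hk
      by_cases hkr : k < r
      · simp only [if_pos hkr] at e1 e2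
        omega
      · simp only [if_neg hkr] at e1 e2
        have := cst_total (hval k (by omega) hk)
        simp only [endS, List.length_singleton] at this
        omega
    refine ⟨hsum, ?_, ?_, ?_⟩
    · rw [List.map_cons, List.pairwise_cons]
      refine ⟨fun x hx => ?_, i2⟩
      rw [List.mem_map] at hx
      obtain ⟨p, hp, rfl⟩ := hx
      exact (i3 p hp).1
    · intro p hp
      rw [List.mem_cons] at hp
      rcases hp with rfl | hp
      · exact ⟨hqr, hrn⟩
      · exact ⟨hqr.trans (i3 p hp).1, (i3 p hp).2⟩
    · intro k hk
      by_cases hkr : k < r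
      · refine ⟨[], _, [], rfl, by simp, ?_, flow_nil _, trivial, ?_⟩
        · intro p hp
          rw [List.mem_cons] at hp
          rcases hp with rfl | hp
          · exact hkr
          · exact lt_of_lt_of_le hkr (i3 p hp).1
        · intro y h1 h2
          have := hsum k hk
          rw [blk_zero (fun x y hx => hab x y (by omega))] at this
          exact Finset.sum_eq_zero_iff.1 this.symm y (by simp; omega)
      · obtain ⟨L1, L2, W, e, b1, b2, b3, b4, b5⟩ := i4 k hk
        simp only [if_neg hkr] at b4 b5
        refine ⟨(r, a) :: L1, L2, js k :: W, by rw [e]; rfl, ?_, b2, ?_, ?_, ?_⟩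
        · intro p hp
          rw [List.mem_cons] at hp
          rcases hp with rfl | hp
          · simp; omega
          · exact b1 p hp
        · have := flow_cons (T := T) (js := js) (m := n - k) (fun x h1 h2 => hns.step x (by omega) (by omega)) b3
          rw [show k + (n-k) = n by omega] at this
          rw [List.map_cons, hns.last]
          exact this
        · exact ⟨hns.one k (by omega) hk, hns.lt k (by omega) hk, hns.desc k (by omega) hk, b4⟩
        · exact b5



/-! ### Crossings and blanks are equinumerous -/

theorem range_sum (n : ℕ) (f : ℕ → ℕ) : ((List.range' 1 n).map f).sum = ∑ x ∈ Finset.Icc 1 n, f x := by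
  induction n with
  | zero => simp
  | succ n ih =>
    rw [List.range'_concat, List.map_append, List.sum_append, ih, Icc_succ_sum]
    simp [add_comm]

theorem range_filter (n : ℕ) (p : ℕ → Bool) :
    ((List.range' 1 n).filter p).length = ∑ x ∈ Finset.Icc 1 n, if p x then 1 else 0 := by
  induction n with
  | zero => simp
  | succ n ih =>
    rw [List.range'_concat, List.filter_append, List.length_append, ih, Icc_succ_sum]
    simp only [List.filter_cons, List.filter_nil, Nat.one_mul, add_comm 1 n]
    split_ifs <;> simp

theorem LG.cross_eq {n T V} (hg : LG n T V) : crossCount ⟨n, T⟩ = blk n T n := by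
  have e1 : crossCount ⟨n, T⟩ = ∑ x ∈ Finset.Icc 1 n, ∑ y ∈ Finset.Icc 1 n, if T x y = .cross then 1 else 0 := by
    unfold crossCount
    rw [range_sum]
    apply Finset.sum_congr rfl
    intro x _
    rw [range_filter]
    simp
  have eN : ∀ x ∈ Finset.Icc 1 n, ∑ y ∈ Finset.Icc 1 n, (if hasN (T x y) then 1 else 0) = x - 1 := by
    intro x hx
    simp at hx
    rw [← hg.rk_total (x := x - 1) (by omega)]
    unfold rk
    apply Finset.sum_congr rfl
    intro y hy
    simp at hy
    have := hg.hN (x := x-1) (y := y) (by omega) hy.1 hy.2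
    rw [show x - 1 + 1 = x by omega] at this
    simp [this]
  have eE : ∀ y ∈ Finset.Icc 1 n, ∑ x ∈ Finset.Icc 1 n, (if hasE (T x y) then 1 else 0) = y := by
    intro y hy
    simp at hy
    have : ∀ m, m ≤ n → ∑ x ∈ Finset.Icc 1 m, (if hasE (T x y) then 1 else 0) = rk V n m y := by
      intro m
      induction m with
      | zero => intro _; rw [hg.rk_top hy.2]; simp
      | succ m ih =>
        intro hm
        rw [Icc_succ_sum, ih (by omega), hg.rk_row hm hy.1 hy.2]
    rw [this n le_rfl]
    unfold rk
    rw [Finset.sum_congr rfl (g := fun _ => 1) (fun i hi => by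
      simp at hi; rw [if_pos (hg.bot hi.1 (by omega))])]
    simp
  have tot : ∑ x ∈ Finset.Icc 1 n, ∑ y ∈ Finset.Icc 1 n,
      ((if hasN (T x y) then 1 else 0) + (if hasE (T x y) then 1 else 0) + ib (T x y)) =
      ∑ x ∈ Finset.Icc 1 n, ∑ y ∈ Finset.Icc 1 n, (1 + if T x y = .cross then 1 else 0) := by
    apply Finset.sum_congr rfl
    intro x hx
    apply Finset.sum_congr rfl
    intro y hy
    simp at hx hy
    have := hg.nb hx.1 hx.2 hy.1 hy.2
    revert this
    cases T x y <;> simp [hasN, hasE, ib]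
  simp only [Finset.sum_add_distrib] at tot
  rw [← e1, Finset.sum_congr rfl eN, Finset.sum_comm (s := Finset.Icc 1 n) (t := Finset.Icc 1 n) (f := fun x y => if hasE (T x y) then 1 else 0), Finset.sum_congr rfl eE] at tot
  have sq : ∀ m, ∑ x ∈ Finset.Icc 1 m, (x - 1) + ∑ x ∈ Finset.Icc 1 m, x = m * m := by
    intro m
    induction m with
    | zero => simp
    | succ m ih =>
      rw [Icc_succ_sum, Icc_succ_sum]
      simp only [Nat.add_sub_cancel]
      nlinarith
  have s1 := sq n
  have s2 : ∑ x ∈ Finset.Icc 1 n, ∑ y ∈ Finset.Icc 1 n, 1 = n * n := by simp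
  rw [s2] at tot
  unfold blk bc
  omega



/-! ### The shape of the recording tableau -/

theorem sorted_count {l : List ℕ} (h : l.Pairwise (· ≤ ·)) {i k : ℕ} (hi : i < l.length) :
    l.getD i 0 ≤ k ↔ i < (l.filter (fun r => decide (r ≤ k))).length := by
  induction l generalizing i with
  | nil => simp at hi
  | cons a l ih =>
    rw [List.pairwise_cons] at h
    by_cases ha : a ≤ k
    · rw [List.filter_cons_of_pos (by simpa using ha)]
      cases i with
      | zero => simp [ha]
      | succ i =>
        have := ih h.2 (i := i) (by simpa using hi)
        simp only [List.getD_cons_succ, List.length_cons, this]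
        omega
    · have hn : (a :: l).filter (fun r => decide (r ≤ k)) = [] := by
        rw [List.filter_eq_nil_iff]
        intro x hx
        rw [List.mem_cons] at hx
        simp only [decide_eq_true_eq, not_le]
        rcases hx with rfl | hx
        · omega
        · have := h.1 x hx; omega
      rw [hn]
      simp only [List.length_nil, Nat.not_lt_zero, iff_false, not_le]
      cases i with
      | zero => simp; omega
      | succ i =>
        have hi' : i < l.length := by simpa using hi
        rw [List.getD_cons_succ, List.getD_eq_getElem _ _ hi']
        have := h.1 l[i] (List.getElem_mem hi')
        omega

theorem LG.columns {n T V} (hg : LG n T V) (hb : ∀ k, k ≤ n → ¬ Bad n (V k)) (c : ℕ) :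
    (((EG (phiAux (blk n T n) ⟨n, T⟩)).2.getD c []).Pairwise (· ≤ ·)) ∧
    (∀ x ∈ (EG (phiAux (blk n T n) ⟨n, T⟩)).2.getD c [], x ≤ n) ∧
    ∀ k, k ≤ n → (((EG (phiAux (blk n T n) ⟨n, T⟩)).2.getD c []).filter (fun r => decide (r ≤ k))).length =
      colN n (V k) (c+1) := by
  obtain ⟨m1, m2, m3, m4⟩ := main_run (blk n T n) (q := 0) hg rfl (by simp)
  set L := phiAux (blk n T n) ⟨n, T⟩ with hL
  have hv : Valid n (V n) (L.map Prod.snd) := by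
    obtain ⟨L1, L2, W, e, b1, b2, b3, b4, b5⟩ := m4 n le_rfl
    have : L2 = [] := by
      rcases L2 with _ | ⟨p, L2⟩
      · rfl
      · have h1 := b2 p (by simp)
        have h2 := (m3 p (by rw [e]; simp)).2
        omega
    rw [this, List.append_nil] at e
    rw [Nat.sub_self, rowsOf, List.range'_zero, List.map_nil] at b3
    rw [e]
    cases b3; exact b4
  obtain ⟨s1, s2, s3, s4, s5⟩ := EG_spec hv
  refine ⟨m2.sublist (s5 c), ?_, ?_⟩
  · intro x hx
    have := (s5 c).subset hx
    rw [List.mem_map] at this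
    obtain ⟨p, hp, rfl⟩ := this
    exact (m3 p hp).2
  · intro k hk
    obtain ⟨L1, L2, W, e, b1, b2, b3, b4, b5⟩ := m4 k hk
    rw [e] at hv ⊢
    rw [EG_filter hv b1 b2 c]
    rw [List.map_append, valid_append] at hv
    obtain ⟨t1, t2, -⟩ := EG_spec hv.1
    refine shape_eq (M := n+1) (hg.finB (k := k) (m := n - k)) ?_ b4 b3 b5 ?_ ?_ (hb k hk) t1 t2 c
    · intro J hJ
      obtain ⟨K, hK, -⟩ := hg.flow (k := k) (m := n - k) (by omega) hJ
      exact ⟨K, hK⟩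
    · intro y h1 h2
      have := hg.label_le hk h1 h2
      omega
    · intro y z h1 h2 h3 h4 hne he
      exact hg.label_inj hk h1 h2 h3 h4 hne he

theorem LG.colN_mono {n T V} (hg : LG n T V) (hb : ∀ k, k ≤ n → ¬ Bad n (V k)) {c i k : ℕ} (hik : i ≤ k) (hk : k ≤ n)
    (hc : 1 ≤ c) : colN n (V i) c ≤ colN n (V k) c := by
  obtain ⟨-, -, h⟩ := hg.columns hb (c - 1)
  have h1 := h i (by omega)
  have h2 := h k hk
  rw [show c - 1 + 1 = c by omega] at h1 h2
  rw [← h1, ← h2]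
  apply List.Sublist.length_le
  apply List.monotone_filter_right
  intro x hx
  simp at hx ⊢
  omega

/-! ### The Weigandt side -/

def dgF (n : ℕ) (T : ℕ → ℕ → Tile) (d : ℤ) (i : ℕ) : Option (ℕ × ℕ) :=
  if 1 ≤ (i : ℤ) + d ∧ (i : ℤ) + d ≤ (n : ℤ) then
    (if T i ((i : ℤ) + d).toNat = Tile.blank then some (i, ((i : ℤ) + d).toNat) else none)
  else none

def dgC (n : ℕ) (T : ℕ → ℕ → Tile) (d : ℤ) (m : ℕ) : ℕ :=
  ((List.range' 1 m).filterMap (dgF n T d)).length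

theorem dgC_succ {n T d m} : dgC n T d (m+1) = dgC n T d m + (dgF n T d (m+1)).toList.length := by
  unfold dgC
  rw [List.range'_concat, List.filterMap_append, List.length_append]
  congr 1
  rw [Nat.one_mul, add_comm 1 m]
  cases h : dgF n T d (m+1) <;> simp [h]

theorem dg_low {n : ℕ} {T : ℕ → ℕ → Tile} {d : ℤ} {m : ℕ} (h : (m : ℤ) + d ≤ 0) : dgC n T d m = 0 := by
  induction m with
  | zero => simp [dgC]
  | succ m ih =>
    rw [dgC_succ, ih (by push_cast at h; omega)]
    rw [dgF, if_neg (by push_cast at h ⊢; omega)]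
    rfl

theorem LG.dg_diag {n T V} (hg : LG n T V) {e f : ℕ} (hef : e = 0 ∨ f = 0) (m : ℕ) (h1 : e + m ≤ n) (h2 : f + m ≤ n)
    (hc : ∀ x y, 1 ≤ x → x ≤ e + m → 1 ≤ y → y ≤ f + m → T x y ≠ .cross) :
    dgC n T ((f : ℤ) - e) (e + m) + rk V n (e+m) (f+m) = m := by
  induction m with
  | zero =>
    rcases hef with rfl | rfl
    · have := hg.rk_top (y := f) (by omega)
      simpa [dgC] using this
    · rw [dg_low (by simp)]
      simpa using rk_zero
  | succ m ih =>
    have q := ih (by omega) (by omega) (fun x y a b c d => hc x y a (by omega) c (by omega))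
    have q2 := hg.rk_diag (x := e + m) (y := f + m) (by omega) (by omega) (hc _ _ (by omega) (by omega) (by omega) (by omega))
    rw [← add_assoc, ← add_assoc, dgC_succ]
    have e1 : (((e + m + 1 : ℕ) : ℤ) + ((f : ℤ) - e)).toNat = f + m + 1 := by push_cast; omega
    unfold dgF
    rw [if_pos (by push_cast; omega), e1]
    split_ifs at q2 ⊢ with hbl <;> simp <;> omega

/-- A blank tile is the entry of its box. -/
theorem LG.box_entry {n T V} (hg : LG n T V) (hb : ∀ k, k ≤ n → ¬ Bad n (V k)) {i j} (hbl : T i j = .blank) :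
    1 ≤ i ∧ i ≤ n ∧ 1 ≤ j ∧ j ≤ n ∧ rk V n i j + 1 ≤ i ∧ rk V n i j + 1 ≤ j ∧
    (blanksOnDiag ⟨n, T⟩ (((j - rk V n i j : ℕ) : ℤ) - ((i - rk V n i j : ℕ) : ℤ))).getD
      (min (i - rk V n i j) (j - rk V n i j) - 1) (0, 0) = (i, j) ∧
    pipesAbove ⟨n, T⟩ i j + (i - rk V n i j) = i := by
  have hin : 1 ≤ i ∧ i ≤ n ∧ 1 ≤ j ∧ j ≤ n := by
    by_contra hc; exact hg.out _ _ hc hbl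
  obtain ⟨h1, h2, h3, h4⟩ := hin
  have hcr : ∀ x y, 1 ≤ x → x ≤ i → 1 ≤ y → y < j → T x y ≠ .cross := fun x y a b c d hcross =>
    hb i h2 (hg.cross_blank a b h2 c d h4 hcross hbl)
  have hpd := hg.rk_diag (x := i-1) (y := j-1) (by omega) (by omega) (by
    rw [show i - 1 + 1 = i by omega, show j - 1 + 1 = j by omega, hbl]; simp)
  rw [show i - 1 + 1 = i by omega, show j - 1 + 1 = j by omega, hbl, if_pos rfl] at hpd
  have hp1 := hg.rk_le_row (x := i-1) (y := j-1) (by omega) (by omega)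
  have hp2 := rk_le (V := V) (n := n) (x := i-1) (y := j-1)
  have hrow := hg.rk_row (x := i-1) (y := j) (by omega) h3 h4
  rw [show i - 1 + 1 = i by omega, hbl] at hrow
  simp only [hasE, Bool.false_eq_true, if_false] at hrow
  set p := rk V n i j with hp
  refine ⟨h1, h2, h3, h4, by omega, by omega, ?_, ?_⟩
  · have hdiag : (((j - p : ℕ) : ℤ) - ((i - p : ℕ) : ℤ)) = (j : ℤ) - i := by omega
    rw [hdiag]
    have e0 : blanksOnDiag ⟨n, T⟩ ((j : ℤ) - i) = (List.range' 1 n).filterMap (dgF n T ((j : ℤ) - i)) := rfl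
    have hsplit : List.range' 1 n = List.range' 1 (i-1) ++ i :: List.range' (i+1) (n-i) := by
      have a := List.range'_append (s := 1) (m := i - 1) (n := n - i + 1) (step := 1)
      rw [show i - 1 + (n - i + 1) = n by omega] at a
      rw [← a, List.range'_succ, show 1 + 1 * (i - 1) = i by omega]
    have hf : dgF n T ((j : ℤ) - i) i = some (i, j) := by
      unfold dgF
      rw [if_pos (by omega), show ((i : ℤ) + ((j : ℤ) - i)).toNat = j by omega, if_pos hbl]
    rw [e0, hsplit, List.filterMap_append, List.filterMap_cons_some hf]
    have hlen : ((List.range' 1 (i-1)).filterMap (dgF n T ((j : ℤ) - i))).length = min (i - p) (j - p) - 1 := by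
      have q := hg.dg_diag (e := i - min i j) (f := j - min i j) (by omega) (min i j - 1) (by omega) (by omega)
        (fun x y a b c d => hcr x y a (by omega) c (by omega))
      rw [show (i - min i j) + (min i j - 1) = i - 1 by omega, show (j - min i j) + (min i j - 1) = j - 1 by omega,
        show (((j - min i j : ℕ) : ℤ) - ((i - min i j : ℕ) : ℤ)) = (j : ℤ) - i by omega] at q
      unfold dgC at q
      omega
    rw [List.getD_eq_getElem?_getD, List.getElem?_append_right (by omega), hlen]
    simp
  · have : pipesAbove ⟨n, T⟩ i j = rk V n (i-1) j := by
      unfold pipesAbove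
      rw [range_filter]
      have : ∀ m, m ≤ n → (∑ x ∈ Finset.Icc 1 m, if (decide (x < i) && hasE (T x j)) = true then 1 else 0) = rk V n (min m (i-1)) j := by
        intro m
        induction m with
        | zero => intro _; simpa using (hg.rk_top h4).symm
        | succ m ih =>
          intro hm
          rw [Icc_succ_sum, ih (by omega)]
          by_cases hlt : m + 1 < i
          · rw [show min (m+1) (i-1) = m + 1 by omega, show min m (i-1) = m by omega, hg.rk_row hm h3 h4]
            simp [hlt]
          · rw [show min (m+1) (i-1) = i - 1 by omega, show min m (i-1) = i - 1 by omega]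
            simp [hlt]
      have q := this n le_rfl
      rw [show min n (i-1) = i - 1 by omega] at q
      exact q
    omega



theorem colN_le {n s C} : colN n s C ≤ n := by
  unfold colN
  exact (Finset.card_filter_le _ _).trans (by simp)

theorem sum_Icc_range (n : ℕ) (f : ℕ → ℕ) : ∑ t ∈ Finset.range n, f (t+1) = ∑ c ∈ Finset.Icc 1 n, f c := by
  induction n with
  | zero => simp
  | succ n ih => rw [Finset.sum_range_succ, Icc_succ_sum, ih]

theorem LG.box_surj {n T V} (hg : LG n T V) (hb : ∀ k, k ≤ n → ¬ Bad n (V k)) {k R C : ℕ} (hk : k ≤ n)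
    (hR : 1 ≤ R) (hC : 1 ≤ C) (h : R ≤ colN n (V k) C) :
    ∃ i j, i ≤ k ∧ T i j = .blank ∧ i - rk V n i j = R ∧ j - rk V n i j = C := by
  classical
  let S := (Finset.Icc 1 k ×ˢ Finset.Icc 1 n).filter (fun p => T p.1 p.2 = .blank)
  let B := (Finset.Icc 1 n ×ˢ Finset.Icc 1 n).filter (fun p => p.2 ≤ colN n (V k) p.1)
  let f : ℕ × ℕ → ℕ × ℕ := fun p => (p.2 - rk V n p.1 p.2, p.1 - rk V n p.1 p.2)
  have hSc : S.card = blk n T k := by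
    simp only [S, Finset.card_filter, Finset.sum_product]
    rfl
  have hBc : B.card = ∑ y ∈ Finset.Icc 1 n, cst n (V k) y := by
    rw [sum_cst, sum_Icc_range]
    simp only [B, Finset.card_filter, Finset.sum_product]
    apply Finset.sum_congr rfl
    intro c _
    rw [← Finset.card_filter]
    have : (Finset.Icc 1 n).filter (fun x => x ≤ colN n (V k) c) = Finset.Icc 1 (colN n (V k) c) := by
      ext x
      have := colN_le (n := n) (s := V k) (C := c)
      simp; omega
    rw [this]; simp
  have hmap : ∀ p ∈ S, f p ∈ B := by
    rintro ⟨i, j⟩ hp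
    simp only [S, Finset.mem_filter, Finset.mem_product, Finset.mem_Icc] at hp
    obtain ⟨a1, a2, a3, a4, a5, a6, -, -⟩ := hg.box_entry hb hp.2
    have h1 := hg.blank_box a1 a2 a3 a4
    have h2 := hg.colN_mono hb (c := j - rk V n i j) hp.1.1.2 hk (by omega)
    simp only [B, f, Finset.mem_filter, Finset.mem_product, Finset.mem_Icc]
    omega
  have hinj : ∀ p ∈ S, ∀ q ∈ S, f p = f q → p = q := by
    rintro ⟨i, j⟩ hp ⟨i', j'⟩ hq he
    simp only [S, Finset.mem_filter, Finset.mem_product, Finset.mem_Icc] at hp hq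
    obtain ⟨-, -, -, -, -, -, b1, -⟩ := hg.box_entry hb hp.2
    obtain ⟨-, -, -, -, -, -, b2, -⟩ := hg.box_entry hb hq.2
    simp only [f, Prod.mk.injEq] at he
    rw [he.1, he.2] at b1
    rw [← b1, ← b2]
  have hcard : B.card ≤ S.card := by
    rw [hSc, hBc, (main_run (blk n T n) (q := 0) hg rfl (by simp)).1 k hk]
  have hsub : S.image f = B := by
    apply Finset.eq_of_subset_of_card_le
    · intro b hb
      rw [Finset.mem_image] at hb
      obtain ⟨p, hp, rfl⟩ := hb
      exact hmap p hp
    · rw [Finset.card_image_of_injOn (fun p hp q hq he => hinj p hp q hq he)]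
      exact hcard
  have hCn : C ≤ n := by
    by_contra hc
    have : colN n (V k) C = 0 := by
      unfold colN
      rw [Finset.card_eq_zero, Finset.filter_eq_empty_iff]
      intro y _ hy
      have := cst_le (n := n) (s := V k) (y := y)
      omega
    omega
  have hmem : (C, R) ∈ B := by
    have := colN_le (n := n) (s := V k) (C := C)
    simp only [B, Finset.mem_filter, Finset.mem_product, Finset.mem_Icc]
    omega
  rw [← hsub, Finset.mem_image] at hmem
  obtain ⟨⟨i, j⟩, hp, he⟩ := hmem
  simp only [S, Finset.mem_filter, Finset.mem_product, Finset.mem_Icc] at hp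
  simp only [f, Prod.mk.injEq] at he
  exact ⟨i, j, hp.1.1.2, hp.2, he.2, he.1⟩

/-- Entries of the recording tableau agree with Weigandt's entries. -/
theorem LG.entry {n T V} (hg : LG n T V) (hb : ∀ k, k ≤ n → ¬ Bad n (V k)) {r c : ℕ}
    (h : r < colN n (V n) (c+1)) :
    ((EG (phiAux (blk n T n) ⟨n, T⟩)).2.getD c []).getD r 0 =
      pipesAbove ⟨n, T⟩ ((blanksOnDiag ⟨n, T⟩ (((c+1 : ℕ) : ℤ) - ((r+1 : ℕ) : ℤ))).getD (min (r+1) (c+1) - 1) (0,0)).1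
        ((blanksOnDiag ⟨n, T⟩ (((c+1 : ℕ) : ℤ) - ((r+1 : ℕ) : ℤ))).getD (min (r+1) (c+1) - 1) (0,0)).2 + (r+1) := by
  obtain ⟨i, j, h1, hbl, e1, e2⟩ := hg.box_surj hb le_rfl (R := r+1) (C := c+1) (by omega) (by omega) h
  obtain ⟨a1, a2, a3, a4, a5, a6, a7, a8⟩ := hg.box_entry hb hbl
  rw [e1, e2] at a7
  rw [e1] at a8
  rw [a7, a8]
  obtain ⟨c1, c2, c3⟩ := hg.columns hb c
  set l := (EG (phiAux (blk n T n) ⟨n, T⟩)).2.getD c [] with hl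
  have hlen : l.length = colN n (V n) (c+1) := by
    rw [← c3 n le_rfl, List.filter_eq_self.2]
    intro x hx
    simpa using c2 x hx
  have hr : r < l.length := by omega
  have hiff : ∀ k, k ≤ n → (l.getD r 0 ≤ k ↔ i ≤ k) := by
    intro k hk
    rw [sorted_count c1 hr, c3 k hk]
    constructor
    · intro hlt
      obtain ⟨i', j', h1', hbl', e1', e2'⟩ := hg.box_surj hb hk (R := r+1) (C := c+1) (by omega) (by omega) hlt
      obtain ⟨-, -, -, -, -, -, a7', -⟩ := hg.box_entry hb hbl'
      rw [e1', e2', a7] at a7'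
      simp only [Prod.mk.injEq] at a7'
      omega
    · intro hik
      have q1 := hg.blank_box a1 a2 a3 a4
      rw [e1, e2] at q1
      have q2 := hg.colN_mono hb (c := c+1) hik hk (by omega)
      omega
  have hn : l.getD r 0 ≤ n := by
    rw [List.getD_eq_getElem _ _ hr]
    exact c2 _ (List.getElem_mem hr)
  have q1 := (hiff i a2).2 le_rfl
  have q2 := (hiff _ hn).1 le_rfl
  omega

/-! ### Lists -/

theorem filterMap_cols (cols : List (List ℕ)) (r N : ℕ) (h : ∀ c, r < (cols.getD c []).length ↔ c < N) :
    cols.filterMap (fun col => col[r]?) = (List.range N).map (fun c => (cols.getD c []).getD r 0) := by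
  induction cols generalizing N with
  | nil =>
    have : N = 0 := by
      by_contra hN
      have := (h 0).2 (by omega)
      simp at this
    rw [this]; simp
  | cons C cols ih =>
    cases N with
    | zero =>
      have h0 := h 0
      rw [List.getD_cons_zero] at h0
      rw [List.filterMap_cons_none (by simp; omega), ih 0 (fun c => by
        have := h (c+1)
        rw [List.getD_cons_succ] at this
        rw [this]; omega)]
      simp
    | succ N =>
      have h0 := h 0
      rw [List.getD_cons_zero] at h0
      have hC : r < C.length := h0.2 (by omega)
      rw [List.filterMap_cons_some (b := C[r]) (by simp [hC]), ih N (fun c => by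
        have := h (c+1)
        rw [List.getD_cons_succ] at this
        rw [this]; omega)]
      rw [List.range_succ_eq_map, List.map_cons, List.map_map]
      congr 1
      rw [List.getD_cons_zero, List.getD_eq_getElem _ _ hC]

theorem foldr_max (l : List (List ℕ)) (N : ℕ) (h0 : (l.getD 0 []).length = N)
    (h : ∀ c, (l.getD c []).length ≤ N) : (l.map List.length).foldr max 0 = N := by
  have hle : ∀ l : List (List ℕ), (∀ c, (l.getD c []).length ≤ N) → (l.map List.length).foldr max 0 ≤ N := by
    intro l
    induction l with
    | nil => simp
    | cons C l ih =>
      intro h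
      have a := h 0
      rw [List.getD_cons_zero] at a
      have b := ih (fun c => by have := h (c+1); rwa [List.getD_cons_succ] at this)
      simp only [List.map_cons, List.foldr_cons]
      omega
  apply le_antisymm (hle l h)
  cases l with
  | nil => simp at h0; omega
  | cons C l =>
    rw [List.getD_cons_zero] at h0
    simp only [List.map_cons, List.foldr_cons]
    omega

theorem insDesc_perm (x : ℕ) (l : List ℕ) : (insDesc x l).Perm (x :: l) := by
  induction l with
  | nil => exact List.Perm.refl _
  | cons y l ih =>
    unfold insDesc
    split_ifs
    · exact List.Perm.refl _
    · exact (List.Perm.cons y ih).trans (List.Perm.swap x y l)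

theorem insDesc_sorted (x : ℕ) (l : List ℕ) (h : l.Pairwise (· ≥ ·)) : (insDesc x l).Pairwise (· ≥ ·) := by
  induction l with
  | nil => simp [insDesc]
  | cons y l ih =>
    rw [List.pairwise_cons] at h
    unfold insDesc
    split_ifs with hlt
    · rw [List.pairwise_cons]
      refine ⟨fun z hz => ?_, List.pairwise_cons.2 h⟩
      rw [List.mem_cons] at hz
      rcases hz with rfl | hz
      · omega
      · have := h.1 z hz; omega
    · rw [List.pairwise_cons]
      refine ⟨fun z hz => ?_, ih h.2⟩
      have := (insDesc_perm x l).subset hz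
      rw [List.mem_cons] at this
      rcases this with rfl | hz
      · omega
      · exact h.1 z hz

theorem sortDesc_spec (l : List ℕ) : (sortDesc l).Perm l ∧ (sortDesc l).Pairwise (· ≥ ·) := by
  induction l with
  | nil => exact ⟨List.Perm.refl _, List.Pairwise.nil⟩
  | cons x l ih =>
    have e : sortDesc (x :: l) = insDesc x (sortDesc l) := rfl
    rw [e]
    exact ⟨(insDesc_perm x _).trans (ih.1.cons x), insDesc_sorted x _ ih.2⟩

theorem desc_getD (l : List ℕ) (h : l.Pairwise (· ≥ ·)) (r c : ℕ) :
    c < l.getD r 0 ↔ r < l.countP (fun x => decide (c < x)) := by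
  induction l generalizing r with
  | nil => simp
  | cons a l ih =>
    rw [List.pairwise_cons] at h
    by_cases ha : c < a
    · rw [List.countP_cons_of_pos (by simpa using ha)]
      cases r with
      | zero => simp [ha]
      | succ r => rw [List.getD_cons_succ, ih h.2]; omega
    · have : (a :: l).countP (fun x => decide (c < x)) = 0 := by
        rw [List.countP_eq_zero]
        intro x hx
        rw [List.mem_cons] at hx
        rcases hx with rfl | hx
        · simpa using ha
        · have := h.1 x hx
          simp; omega
      rw [this]
      have h2 := ih h.2 
      cases r with
      | zero => simp; omega
      | succ r =>
        rw [List.getD_cons_succ]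
        have h0 : l.countP (fun x => decide (c < x)) = 0 := by
          rw [List.countP_cons] at this; omega
        rw [h2, h0]; simp

theorem countP_range (n : ℕ) (f : ℕ → ℕ) (c : ℕ) :
    ((List.range' 1 n).map f).countP (fun x => decide (c < x)) =
      ((Finset.Icc 1 n).filter (fun i => c < f i)).card := by
  rw [List.countP_map, List.countP_eq_length_filter, range_filter, Finset.card_filter]
  simp

theorem shape_getD (v : Perm') (n r c : ℕ) :
    c < (shapeOf v n).getD r 0 ↔ r < ((Finset.Icc 1 n).filter (fun i => c < codeOf v i)).card := by
  obtain ⟨h1, h2⟩ := sortDesc_spec ((List.range' 1 n).map (codeOf v))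
  unfold shapeOf
  rw [desc_getD _ (h2.filter _), ← countP_range, List.countP_filter, ← h1.countP_eq]
  have : (fun x => (decide (c < x) && decide (0 < x))) = (fun x => decide (c < x)) := by
    funext x
    by_cases h : c < x
    · simp [h]; omega
    · simp [h]
  rw [this]

theorem shape_length (v : Perm') (n : ℕ) :
    (shapeOf v n).length = ((Finset.Icc 1 n).filter (fun i => 0 < codeOf v i)).card := by
  obtain ⟨h1, h2⟩ := sortDesc_spec ((List.range' 1 n).map (codeOf v))
  unfold shapeOf
  rw [← countP_range, ← h1.countP_eq, List.countP_eq_length_filter]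



theorem perm_mem {v : Perm'} {n : ℕ} (h0 : v 0 = 0) (hv : ∀ k, n < k → v k = k) {i : ℕ} (h1 : 1 ≤ i) (h2 : i ≤ n) :
    1 ≤ v i ∧ v i ≤ n := by
  constructor
  · by_contra hc
    have : v i = v 0 := by rw [h0]; omega
    have := v.injective this
    omega
  · by_contra hc
    have := v.injective (hv (v i) (by omega))
    omega

theorem perm_symm {v : Perm'} {n : ℕ} (h0 : v 0 = 0) (hv : ∀ k, n < k → v k = k) :
    v.symm 0 = 0 ∧ ∀ k, n < k → v.symm k = k := by
  refine ⟨?_, fun k hk => ?_⟩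
  · rw [Equiv.symm_apply_eq, h0]
  · rw [Equiv.symm_apply_eq, hv k hk]

theorem code_cst {v : Perm'} {n : ℕ} {s : ℕ → ℕ} (h0 : v 0 = 0) (hv : ∀ k, n < k → v k = k)
    (hs : ∀ y, 1 ≤ y → y ≤ n → s y = v.symm y) {i : ℕ} (h1 : 1 ≤ i) (h2 : i ≤ n) :
    codeOf v i = cst n s (v i) := by
  rw [cst_card, codeOf]
  have hm := perm_mem h0 hv h1 h2
  have e : {j : ℕ | i < j ∧ v j < v i} ≃ {z // z ∈ (Finset.Icc 1 n).filter (fun z => z < v i ∧ s (v i) < s z)} :=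
    Equiv.subtypeEquiv v (fun j => by
      simp only [Set.mem_setOf_eq, Finset.mem_filter, Finset.mem_Icc]
      rw [hs (v i) hm.1 hm.2, Equiv.symm_apply_apply]
      constructor
      · rintro ⟨a, b⟩
        have hj : j ≤ n := by
          by_contra hc
          rw [hv j (by omega)] at b
          omega
        have hj2 := perm_mem h0 hv (i := j) (by omega) hj
        rw [hs (v j) hj2.1 hj2.2, Equiv.symm_apply_apply]
        exact ⟨hj2, b, a⟩
      · rintro ⟨a, b, c⟩
        rw [hs (v j) a.1 a.2, Equiv.symm_apply_apply] at c
        exact ⟨c, b⟩)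
  rw [Nat.card_congr e, Nat.card_eq_fintype_card, Fintype.card_coe]

theorem code_colN {v : Perm'} {n : ℕ} {s : ℕ → ℕ} (h0 : v 0 = 0) (hv : ∀ k, n < k → v k = k)
    (hs : ∀ y, 1 ≤ y → y ≤ n → s y = v.symm y) (c : ℕ) :
    ((Finset.Icc 1 n).filter (fun i => c < codeOf v i)).card = colN n s (c+1) := by
  unfold colN
  obtain ⟨g0, gv⟩ := perm_symm h0 hv
  apply Finset.card_bij (fun i _ => v i)
  · intro i hi
    simp only [Finset.mem_filter, Finset.mem_Icc] at hi ⊢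
    rw [code_cst h0 hv hs hi.1.1 hi.1.2] at hi
    exact ⟨perm_mem h0 hv hi.1.1 hi.1.2, hi.2⟩
  · intro i _ j _ h
    exact v.injective h
  · intro y hy
    simp only [Finset.mem_filter, Finset.mem_Icc] at hy
    have hm := perm_mem g0 gv hy.1.1 hy.1.2
    refine ⟨v.symm y, ?_, by simp⟩
    simp only [Finset.mem_filter, Finset.mem_Icc]
    rw [code_cst h0 hv hs hm.1 hm.2, Equiv.apply_symm_apply]
    exact ⟨hm, hy.2⟩

theorem not_bad {v : Perm'} (hvex : Vexillary v) {n : ℕ} {s : ℕ → ℕ} (h0 : v 0 = 0) (hv : ∀ k, n < k → v k = k)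
    (hs : ∀ y, 1 ≤ y → y ≤ n → s y = v.symm y) : ¬ Bad n s := by
  rintro ⟨a, b, c, d, h1, h2, h3, h4, h5, h6, h7, h8⟩
  obtain ⟨g0, gv⟩ := perm_symm h0 hv
  rw [hs a (by omega) (by omega), hs b (by omega) (by omega)] at h6
  rw [hs a (by omega) (by omega), hs d (by omega) (by omega)] at h7
  rw [hs d (by omega) (by omega), hs c (by omega) (by omega)] at h8
  refine hvex.2 ⟨v.symm b, v.symm a, v.symm d, v.symm c, (perm_mem g0 gv (by omega) (by omega)).1, h6, h7, h8, ?_⟩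
  simp only [Equiv.apply_symm_apply]
  exact ⟨h2, h3, h4⟩

theorem zip_fst_snd (L : List (ℕ × ℕ)) : (L.map Prod.fst).zip (L.map Prod.snd) = L := by
  induction L with
  | nil => rfl
  | cons p L ih => simp [ih]

theorem stmt0 (v : Perm') (hv : Vexillary v) (B : Grid) (hB : MemBPD v B) :
    Qtilde (phi B) = weigandt B (shapeOf v B.n) := by
  obtain ⟨hB1, h0, hfix, hex⟩ := hB
  have hg := bpd_LG hB1
  have hs : ∀ y, 1 ≤ y → y ≤ B.n → Vl B B.n y = v.symm y := by
    intro y h1 h2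
    have a := exit_lab hB1 h1 h2
    rw [hex y h1 h2] at a
    exact (Option.some.inj a).symm
  have hnb : ∀ k, k ≤ B.n → ¬ Bad B.n (Vl B k) := fun k hk hbad =>
    not_bad hv h0 hfix hs (hg.bad_mono hk le_rfl hbad)
  have hE : (egPQ (phi B)).2 = (EG (phiAux (blk B.n B.tile B.n) ⟨B.n, B.tile⟩)).2 := by
    have hc : crossCount B = blk B.n B.tile B.n := hg.cross_eq
    unfold egPQ phi
    simp only [zip_fst_snd]
    rw [hc]
    rfl
  have hlen : ∀ c, ((EG (phiAux (blk B.n B.tile B.n) ⟨B.n, B.tile⟩)).2.getD c []).length =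
      colN B.n (Vl B B.n) (c+1) := by
    intro c
    obtain ⟨c1, c2, c3⟩ := hg.columns hnb c
    rw [← c3 B.n le_rfl, List.filter_eq_self.2]
    intro x hx
    simpa using c2 x hx
  unfold Qtilde weigandt colsToRows
  rw [hE, foldr_max _ _ (hlen 0) (fun c => by rw [hlen]; exact colN_anti (by omega)),
    shape_length, code_colN h0 hfix hs]
  apply List.map_congr_left
  intro r _
  rw [filterMap_cols _ r ((shapeOf v B.n).getD r 0) (fun c => by
    rw [hlen, shape_getD, code_colN h0 hfix hs])]
  apply List.map_congr_left
  intro c hc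
  rw [List.mem_range, shape_getD, code_colN h0 hfix hs] at hc
  exact hg.entry hnb hc


end BPDPaper
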